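/- Suppose F(X_1,…,X_m,Z,T) = f(Z,T) + X_1⋯X_m·g(X_1,…,X_m,Z,T) for some g ∈ k[X_1,…,X_m,Z,T]. Then the following statements are equivalent: (iv) A ≅ k^{[m+2]}; (ix) f(Z,T) is a line in k[Z,T] and ML(A) = k; (x) A^{[l]} ≅ k^{[l+m+2]} for some l ≥ 0 and ML(A) = k; (xi) A is an 𝔸²-fibration over E and ML(A) = k. -/

import Mathlib

/-!
Common definitions: exponential maps, the Derksen and Makar-Limanov invariants,
𝔸ⁿ-fibrations, and the ring
`A = k[X_1,…,X_m,Y,Z,T]/(X_1^{r_1}⋯X_m^{r_m}·Y − F(X_1,…,X_m,Z,T))`.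
-/

noncomputable section
open MvPolynomial

/-- An exponential map on a `k`-algebra `D`: a `k`-algebra homomorphism `φ : D → D[U]`
such that evaluating `U` at `0` gives the identity of `D`, and such that
`φ_V ∘ φ_U = φ_{U+V}` in `D[U,V]` (where `φ_V : D[U] → D[U,V]` extends `φ` with
`φ_V(U) = U`).  Here `D[U,V]` is modelled as `Polynomial (Polynomial D)`, with inner
variable `U` and outer variable `V`. -/
structure ExpMap (k D : Type) [CommRing k] [CommRing D] [Algebra k D] where
  toAlgHom : D →ₐ[k] Polynomial D
  eval_zero : ∀ d, Polynomial.eval 0 (toAlgHom d) = d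
  comp_add : ∀ d,
    Polynomial.eval₂ ((Polynomial.mapRingHom (Polynomial.C (R := D))).comp toAlgHom.toRingHom)
      (Polynomial.C Polynomial.X) (toAlgHom d)
    = Polynomial.eval₂ ((Polynomial.C (R := Polynomial D)).comp (Polynomial.C (R := D)))
      (Polynomial.C Polynomial.X + Polynomial.X) (toAlgHom d)

namespace ExpMap
variable {k D : Type} [CommRing k] [CommRing D] [Algebra k D]

/-- The ring of invariants `D^φ = {d ∈ D | φ(d) = d}` of an exponential map. -/
def invariants (φ : ExpMap k D) : Subalgebra k D where
  carrier := {d | φ.toAlgHom d = Polynomial.C d}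
  mul_mem' := fun ha hb => by
    simp only [Set.mem_setOf_eq] at *
    rw [map_mul, ha, hb, ← map_mul]
  add_mem' := fun ha hb => by
    simp only [Set.mem_setOf_eq] at *
    rw [map_add, ha, hb, ← map_add]
  algebraMap_mem' := fun c => by
    simp only [Set.mem_setOf_eq, AlgHom.commutes, Polynomial.algebraMap_apply]

end ExpMap

/-- The Derksen invariant `DK(D)`: the `k`-subalgebra of `D` generated by the rings of
invariants of all non-trivial exponential maps on `D`. -/
def Derksen (k D : Type) [CommRing k] [CommRing D] [Algebra k D] : Subalgebra k D :=
  Algebra.adjoin k (⋃ φ ∈ {ψ : ExpMap k D | ψ.invariants ≠ ⊤}, (φ.invariants : Set D))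

/-- The Makar-Limanov invariant `ML(D)`: the intersection of the rings of invariants of
all exponential maps on `D`. -/
def MakarLimanov (k D : Type) [CommRing k] [CommRing D] [Algebra k D] : Subalgebra k D :=
  ⨅ φ : ExpMap k D, φ.invariants

/-- `D` is an `𝔸ⁿ`-fibration over `R`: a finitely generated flat `R`-algebra all of whose
fibres `D ⊗_R κ(p)` over primes `p` of `R` are polynomial rings `κ(p)^{[n]}`. -/
def IsAnFibration (R D : Type) [CommRing R] [CommRing D] [Algebra R D] (n : ℕ) : Prop :=
  Algebra.FiniteType R D ∧ Module.Flat R D ∧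
  ∀ p : PrimeSpectrum R,
    Nonempty ((TensorProduct R (IsLocalRing.ResidueField (Localization.AtPrime p.asIdeal)) D)
      ≃ₐ[IsLocalRing.ResidueField (Localization.AtPrime p.asIdeal)]
      MvPolynomial (Fin n) (IsLocalRing.ResidueField (Localization.AtPrime p.asIdeal)))

/-- The polynomial ring `k[X_1,…,X_m,Y,Z,T]`:
variables `Sum.inl i` are the `X i`; `Sum.inr 0 = Y`, `Sum.inr 1 = Z`, `Sum.inr 2 = T`. -/
abbrev BigP (k : Type) [CommRing k] (m : ℕ) := MvPolynomial (Fin m ⊕ Fin 3) k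

/-- The inclusion `k[X_1,…,X_m,Z,T] → k[X_1,…,X_m,Y,Z,T]` (in the source,
`Sum.inr 0 = Z` and `Sum.inr 1 = T`). -/
def incl (k : Type) [CommRing k] (m : ℕ) : MvPolynomial (Fin m ⊕ Fin 2) k →ₐ[k] BigP k m :=
  rename (Sum.map id Fin.succ)

/-- The polynomial `G = X_1^{r_1}⋯X_m^{r_m}·Y − F(X_1,…,X_m,Z,T)`. -/
def relG (k : Type) [CommRing k] (m : ℕ) (r : Fin m → ℕ) (F : MvPolynomial (Fin m ⊕ Fin 2) k) :
    BigP k m :=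
  (∏ i, X (Sum.inl i) ^ r i) * X (Sum.inr 0) - incl k m F

/-- The ring `A = k[X_1,…,X_m,Y,Z,T]/(X_1^{r_1}⋯X_m^{r_m}·Y − F(X_1,…,X_m,Z,T))`. -/
abbrev RingA (k : Type) [CommRing k] (m : ℕ) (r : Fin m → ℕ)
    (F : MvPolynomial (Fin m ⊕ Fin 2) k) :=
  BigP k m ⧸ Ideal.span {relG k m r F}

variable (k : Type) [CommRing k] (m : ℕ) (r : Fin m → ℕ) (F : MvPolynomial (Fin m ⊕ Fin 2) k)

/-- `x i`, the image of `X i` in `A`. -/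
def xA (i : Fin m) : RingA k m r F := Ideal.Quotient.mk _ (X (Sum.inl i))
/-- `y`, the image of `Y` in `A`. -/
def yA : RingA k m r F := Ideal.Quotient.mk _ (X (Sum.inr 0))
/-- `z`, the image of `Z` in `A`. -/
def zA : RingA k m r F := Ideal.Quotient.mk _ (X (Sum.inr 1))
/-- `t`, the image of `T` in `A`. -/
def tA : RingA k m r F := Ideal.Quotient.mk _ (X (Sum.inr 2))

/-- `f(Z,T) := F(0,…,0,Z,T) ∈ k[Z,T]`. -/
def fOf : MvPolynomial (Fin 2) k :=
  aeval (Sum.elim (fun _ => (0 : MvPolynomial (Fin 2) k)) X) F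

/-- The subalgebra `E = k[x_1,…,x_m]` of `A`. -/
def EA : Subalgebra k (RingA k m r F) := Algebra.adjoin k (Set.range (xA k m r F))

/-- The subalgebra `B = k[x_1,…,x_m,z,t]` of `A`. -/
def BA : Subalgebra k (RingA k m r F) :=
  Algebra.adjoin k (Set.range (xA k m r F) ∪ {zA k m r F, tA k m r F})

namespace ExpMap
variable {k D : Type} [CommRing k] [CommRing D] [Algebra k D]

/-- The coefficient of `U ^ i` in `φ a`, as an additive map in `a`. -/
def co (φ : ExpMap k D) (i : ℕ) : D →ₗ[k] D where
  toFun a := (φ.toAlgHom a).coeff i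
  map_add' a b := by simp
  map_smul' c a := by simp

theorem co_apply (φ : ExpMap k D) (i : ℕ) (a : D) : φ.co i a = (φ.toAlgHom a).coeff i := rfl

theorem co_zero (φ : ExpMap k D) (a : D) : φ.co 0 a = a := by
  rw [co_apply, Polynomial.coeff_zero_eq_eval_zero, φ.eval_zero]

theorem co_mul (φ : ExpMap k D) (i : ℕ) (a b : D) :
    φ.co i (a * b) = ∑ x ∈ Finset.HasAntidiagonal.antidiagonal i, φ.co x.1 a * φ.co x.2 b := by
  simp [co_apply, Polynomial.coeff_mul]

theorem co_algebraMap (φ : ExpMap k D) {i : ℕ} (hi : i ≠ 0) (c : k) :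
    φ.co i (algebraMap k D c) = 0 := by
  simp [co_apply, Polynomial.algebraMap_apply, Polynomial.coeff_C, hi]

theorem co_co (φ : ExpMap k D) (i j : ℕ) (a : D) :
    φ.co j (φ.co i a) = ((i + j).choose i : D) * φ.co (i + j) a := by
  have h := congrArg (fun q : Polynomial (Polynomial D) => (q.coeff j).coeff i) (φ.comp_add a)
  simp only [Polynomial.eval₂_eq_sum_range, Polynomial.finsetSum_coeff, RingHom.comp_apply,
    ← map_pow, Polynomial.coeff_mul_C, Polynomial.coe_mapRingHom, Polynomial.coeff_map,
    Polynomial.coeff_C_mul, Polynomial.coeff_X_pow, AlgHom.toRingHom_eq_coe, RingHom.coe_coe,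
    add_comm (Polynomial.C Polynomial.X) Polynomial.X, Polynomial.coeff_X_add_C_pow] at h
  have e1 : ∀ n, (((Polynomial.X : Polynomial D) ^ (n - j) * (n.choose j : Polynomial D)).coeff i)
      = if n - j = i then (n.choose j : D) else 0 := by
    intro n
    rw [← Polynomial.C_eq_natCast, Polynomial.coeff_mul_C, Polynomial.coeff_X_pow]
    by_cases hn : n - j = i
    · simp [hn]
    · rw [if_neg hn, if_neg (Ne.symm hn), zero_mul]
  simp only [e1, mul_ite, mul_one, mul_zero] at h
  have hl : φ.co j (φ.co i a) = ∑ x ∈ Finset.range ((φ.toAlgHom a).natDegree + 1),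
      if i = x then (φ.toAlgHom ((φ.toAlgHom a).coeff x)).coeff j else 0 := by
    rw [Finset.sum_ite_eq]
    split_ifs with hi
    · rfl
    · rw [co_apply φ i, Polynomial.coeff_eq_zero_of_natDegree_lt (by simpa using hi), map_zero]
  rw [hl, h, Finset.sum_eq_single (i + j)]
  · rw [if_pos (by omega), Nat.choose_symm_add, co_apply, mul_comm]
  · intro n _ hn
    by_cases hij : n - j = i
    · rw [if_pos hij, Nat.choose_eq_zero_of_lt (by omega)]; simp
    · rw [if_neg hij]
  · intro hn
    rw [Polynomial.coeff_eq_zero_of_natDegree_lt (by simpa using hn)]; simp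

theorem mem_invariants {φ : ExpMap k D} {a : D} :
    a ∈ φ.invariants ↔ ∀ i, 0 < i → φ.co i a = 0 := by
  constructor
  · intro h i hi
    have h' : φ.toAlgHom a = Polynomial.C a := h
    rw [co_apply, h', Polynomial.coeff_C, if_neg hi.ne']
  · intro h
    change φ.toAlgHom a = Polynomial.C a
    ext i
    rcases Nat.eq_zero_or_pos i with rfl | hi
    · rw [← co_apply, co_zero]; simp
    · rw [← co_apply, h i hi, Polynomial.coeff_C, if_neg hi.ne']

end ExpMap

/-- An exponential map together with a valuation on the ring and a slope `γ` such that the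
`i`-th coefficient of `φ` shifts the valuation by at least `i • γ`. -/
structure Slope (k D Γ : Type) [Field k] [CommRing D] [Algebra k D]
    [AddCommGroup Γ] [LinearOrder Γ] [IsOrderedAddMonoid Γ] where
  φ : ExpMap k D
  v : AddValuation D (WithTop Γ)
  γ : Γ
  ne_top : ∀ a, a ≠ 0 → v a ≠ ⊤
  alg : ∀ c : k, c ≠ 0 → v (algebraMap k D c) = 0
  slope : ∀ i a, v a ≤ v (φ.co i a) + ((-(i • γ) : Γ) : WithTop Γ)

namespace Slope
variable {k D Γ : Type} [Field k] [CommRing D] [Algebra k D]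
    [AddCommGroup Γ] [LinearOrder Γ] [IsOrderedAddMonoid Γ] (S : Slope k D Γ)

/-- The valuation shifted by `-(i • γ)`. -/
def w (i : ℕ) (b : D) : WithTop Γ := S.v b + ((-(i • S.γ) : Γ) : WithTop Γ)

theorem w_zero (b : D) : S.w 0 b = S.v b := by simp [w]

theorem w_mul (i j : ℕ) (b c : D) : S.w (i + j) (b * c) = S.w i b + S.w j c := by
  rw [w, w, w, S.v.map_mul, add_smul, neg_add, WithTop.coe_add]
  abel

theorem w_le_w {i : ℕ} {b c : D} (h : S.v b ≤ S.v c) : S.w i b ≤ S.w i c :=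
  add_le_add_left h _

theorem v_lt_of_w_lt {i : ℕ} {b c : D} (h : S.w i b < S.w i c) : S.v b < S.v c := by
  by_contra h'
  exact absurd h (not_lt.2 (S.w_le_w (not_lt.1 h')))

theorem w_inj {i : ℕ} {b c : D} : S.w i b = S.w i c ↔ S.v b = S.v c :=
  ⟨fun h => WithTop.add_right_cancel WithTop.coe_ne_top h, fun h => by rw [w, w, h]⟩

theorem w_add_lt {i : ℕ} {b c : D} {β : WithTop Γ} (hb : β < S.w i b) (hc : β < S.w i c) :
    β < S.w i (b + c) := by
  rcases le_total (S.v b) (S.v c) with h | h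
  · exact hb.trans_le (S.w_le_w (by simpa [h] using S.v.map_add b c))
  · exact hc.trans_le (S.w_le_w (by simpa [h] using S.v.map_add b c))

theorem w_neg (i : ℕ) (b : D) : S.w i (-b) = S.w i b := by rw [w, w, S.v.map_neg]

theorem w_sub_lt {i : ℕ} {b c : D} {β : WithTop Γ} (hb : β < S.w i b) (hc : β < S.w i c) :
    β < S.w i (b - c) := by
  rw [sub_eq_add_neg]; exact S.w_add_lt hb (by rwa [w_neg])

theorem w_sum_lt {ι : Type} {s : Finset ι} {i : ℕ} {f : ι → D} {β : WithTop Γ} (hβ : β ≠ ⊤)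
    (h : ∀ x ∈ s, β < S.w i (f x)) : β < S.w i (∑ x ∈ s, f x) := by
  induction s using Finset.cons_induction with
  | empty => rw [Finset.sum_empty, w, S.v.map_zero, WithTop.top_add]; exact lt_top_iff_ne_top.2 hβ
  | cons a s ha ih =>
    rw [Finset.sum_cons]
    exact S.w_add_lt (h a (by simp)) (ih fun x hx => h x (by simp [hx]))

theorem v_le_w (i : ℕ) (a : D) : S.v a ≤ S.w i (S.φ.co i a) := S.slope i a

/-- `n` is the largest index at which the slope inequality for `a` is an equality. -/
def HasDeg (a : D) (n : ℕ) : Prop :=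
  S.w n (S.φ.co n a) = S.v a ∧ ∀ i, n < i → S.v a < S.w i (S.φ.co i a)

/-- Above index `n`, the coefficients of `φ a` have shifted valuation larger than `β`. -/
def LeAt (β : WithTop Γ) (a : D) (n : ℕ) : Prop := ∀ i, n < i → β < S.w i (S.φ.co i a)

variable {S}

theorem HasDeg.v_ne_top {a : D} {n : ℕ} (h : S.HasDeg a n) : S.v a ≠ ⊤ :=
  (lt_top_of_lt (h.2 (n + 1) (by omega))).ne

theorem HasDeg.ne_zero {a : D} {n : ℕ} (h : S.HasDeg a n) : a ≠ 0 := by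
  rintro rfl; exact h.v_ne_top S.v.map_zero

theorem exists_hasDeg {a : D} (ha : a ≠ 0) : ∃ n, S.HasDeg a n := by
  classical
  have hfin : ∀ i, S.w i (S.φ.co i a) = S.v a → i ≤ (S.φ.toAlgHom a).natDegree := by
    intro i hi
    by_contra h
    rw [ExpMap.co_apply, Polynomial.coeff_eq_zero_of_natDegree_lt (not_le.1 h), w, S.v.map_zero,
      WithTop.top_add] at hi
    exact S.ne_top a ha hi.symm
  refine ⟨Nat.findGreatest (fun i => S.w i (S.φ.co i a) = S.v a) (S.φ.toAlgHom a).natDegree, ?_, ?_⟩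
  · exact Nat.findGreatest_spec (P := fun i => S.w i (S.φ.co i a) = S.v a) (Nat.zero_le _)
      (by rw [w_zero, ExpMap.co_zero])
  · intro i hi
    refine lt_of_le_of_ne (S.v_le_w i a) fun h => ?_
    exact absurd (Nat.le_findGreatest (hfin i h.symm) h.symm) (not_le.2 hi)

theorem HasDeg.leAt {a : D} {n m : ℕ} (h : S.HasDeg a n) (hm : n ≤ m) : S.LeAt (S.v a) a m :=
  fun i hi => h.2 i (by omega)

theorem HasDeg.le_of_leAt {a : D} {n m : ℕ} (h : S.HasDeg a n) (h' : S.LeAt (S.v a) a m) :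
    n ≤ m := by
  by_contra hn
  exact (h' n (by omega)).ne' h.1

theorem HasDeg.unique {a : D} {n m : ℕ} (h : S.HasDeg a n) (h' : S.HasDeg a m) : n = m :=
  le_antisymm (h.le_of_leAt (h'.leAt le_rfl)) (h'.le_of_leAt (h.leAt le_rfl))

theorem LeAt.of_lt {β : WithTop Γ} {a : D} (h : β < S.v a) (n : ℕ) : S.LeAt β a n :=
  fun i _ => h.trans_le (S.v_le_w i a)

theorem LeAt.add {β : WithTop Γ} {a b : D} {n : ℕ} (ha : S.LeAt β a n) (hb : S.LeAt β b n) :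
    S.LeAt β (a + b) n := fun i hi => by
  rw [map_add]; exact S.w_add_lt (ha i hi) (hb i hi)

theorem LeAt.neg {β : WithTop Γ} {a : D} {n : ℕ} (ha : S.LeAt β a n) :
    S.LeAt β (-a) n := fun i hi => by
  rw [map_neg, w_neg]; exact ha i hi

theorem LeAt.sub {β : WithTop Γ} {a b : D} {n : ℕ} (ha : S.LeAt β a n) (hb : S.LeAt β b n) :
    S.LeAt β (a - b) n := by
  rw [sub_eq_add_neg]; exact ha.add hb.neg

theorem LeAt.sum {ι : Type} {s : Finset ι} {β : WithTop Γ} (hβ : β ≠ ⊤) {f : ι → D} {n : ℕ}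
    (h : ∀ x ∈ s, S.LeAt β (f x) n) : S.LeAt β (∑ x ∈ s, f x) n := fun i hi => by
  rw [map_sum]; exact S.w_sum_lt hβ fun x hx => h x hx i hi

theorem HasDeg.congr {a b : D} {n : ℕ} (h : S.HasDeg a n) (hb : S.v a < S.v (b - a)) :
    S.v b = S.v a ∧ S.HasDeg b n := by
  have hv : S.v b = S.v a := S.v.map_eq_of_lt_sub hb
  have hba : ∀ i, S.φ.co i b = S.φ.co i a + S.φ.co i (b - a) := fun i => by
    rw [← map_add]; congr 1; ring
  have hlt : ∀ i, S.v a < S.w i (S.φ.co i (b - a)) := fun i => hb.trans_le (S.v_le_w i _)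
  refine ⟨hv, ?_, fun i hi => ?_⟩
  · rw [hv, hba, ← h.1, w_inj]
    refine S.v.map_add_eq_of_lt_left ?_
    refine S.v_lt_of_w_lt (i := n) ?_
    rw [h.1]; exact hlt n
  · rw [hv, hba]; exact S.w_add_lt (h.2 i hi) (hlt i)

theorem HasDeg.add_leAt {a b : D} {n m : ℕ} (h : S.HasDeg a n) (hb : S.v a ≤ S.v b)
    (hm : m < n) (hl : S.LeAt (S.v a) b m) : S.v (a + b) = S.v a ∧ S.HasDeg (a + b) n := by
  have h1 : S.w n (S.φ.co n (a + b)) = S.v a := by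
    rw [map_add, ← h.1, w_inj]
    refine S.v.map_add_eq_of_lt_left (S.v_lt_of_w_lt (i := n) ?_)
    rw [h.1]; exact hl n hm
  have hv : S.v (a + b) = S.v a :=
    le_antisymm (h1 ▸ S.v_le_w n (a + b)) (by simpa [hb] using S.v.map_add a b)
  refine ⟨hv, h1.trans hv.symm, fun i hi => ?_⟩
  rw [hv, map_add]; exact S.w_add_lt (h.2 i hi) (hl i (by omega))

theorem HasDeg.pair_lt {a b : D} {n m : ℕ} (ha : S.HasDeg a n) (hb : S.HasDeg b m) {i j : ℕ}
    (h : n < i ∨ m < j) : S.v (a * b) < S.w (i + j) (S.φ.co i a * S.φ.co j b) := by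
  rw [w_mul, S.v.map_mul]
  rcases h with h | h
  · exact WithTop.add_lt_add_of_lt_of_le hb.v_ne_top (ha.2 i h) (S.v_le_w j b)
  · exact WithTop.add_lt_add_of_le_of_lt ha.v_ne_top (S.v_le_w i a) (hb.2 j h)

theorem HasDeg.mul_co {a b : D} {n m : ℕ} (ha : S.HasDeg a n) (hb : S.HasDeg b m) :
    S.v (a * b) < S.w (n + m) (S.φ.co (n + m) (a * b) - S.φ.co n a * S.φ.co m b) := by
  rw [ExpMap.co_mul, ← Finset.sum_erase_eq_sub (a := (n, m)) (by simp)]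
  refine S.w_sum_lt ?_ fun x hx => ?_
  · rw [S.v.map_mul]; exact WithTop.add_ne_top.2 ⟨ha.v_ne_top, hb.v_ne_top⟩
  · simp only [Finset.mem_erase, Finset.HasAntidiagonal.mem_antidiagonal] at hx
    rw [← hx.2]
    refine ha.pair_lt hb ?_
    by_contra hc
    exact hx.1 (Prod.ext (by simp only; omega) (by simp only; omega))

theorem HasDeg.mul {a b : D} {n m : ℕ} (ha : S.HasDeg a n) (hb : S.HasDeg b m) :
    S.HasDeg (a * b) (n + m) := by
  have hne : S.v (a * b) ≠ ⊤ := by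
    rw [S.v.map_mul]; exact WithTop.add_ne_top.2 ⟨ha.v_ne_top, hb.v_ne_top⟩
  have h1 : S.w (n + m) (S.φ.co n a * S.φ.co m b) = S.v (a * b) := by
    rw [w_mul, ha.1, hb.1, S.v.map_mul]
  refine ⟨?_, fun i hi => ?_⟩
  · rw [← h1, w_inj]
    refine S.v.map_eq_of_lt_sub (S.v_lt_of_w_lt (i := n + m) ?_)
    rw [h1]; exact ha.mul_co hb
  · rw [ExpMap.co_mul]
    refine S.w_sum_lt hne fun x hx => ?_
    rw [Finset.HasAntidiagonal.mem_antidiagonal] at hx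
    rw [← hx]
    exact ha.pair_lt hb (by omega)

theorem hasDeg_algebraMap {c : k} (hc : c ≠ 0) : S.HasDeg (algebraMap k D c) 0 := by
  refine ⟨by rw [w_zero, ExpMap.co_zero], fun i hi => ?_⟩
  rw [ExpMap.co_algebraMap _ hi.ne', w, S.v.map_zero, WithTop.top_add, S.alg c hc]
  exact WithTop.coe_lt_top 0

theorem hasDeg_one : S.HasDeg (1 : D) 0 := by
  simpa using S.hasDeg_algebraMap (one_ne_zero (α := k))

theorem HasDeg.pow {a : D} {n : ℕ} (ha : S.HasDeg a n) (e : ℕ) : S.HasDeg (a ^ e) (e * n) := by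
  induction e with
  | zero => simpa using S.hasDeg_one
  | succ e ih => rw [pow_succ, Nat.succ_mul]; exact ih.mul ha

end Slope

theorem exists_choose_ne_zero (k : Type) [Field k] (p : ℕ) [ExpChar k p] {n : ℕ} (hn : 0 < n) :
    ∃ e, p ^ e ∣ n ∧ (n.choose (p ^ e) : k) ≠ 0 := by
  obtain ⟨e, m, hm, rfl⟩ : ∃ e m : ℕ, (m : k) ≠ 0 ∧ n = p ^ e * m := by
    rcases ‹ExpChar k p› with _ | ⟨hp⟩
    · exact ⟨0, n, by exact_mod_cast hn.ne', by simp⟩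
    · obtain ⟨e, m, hm, rfl⟩ := Nat.exists_eq_pow_mul_and_not_dvd hn.ne' p hp.ne_one
      exact ⟨e, m, fun h => hm ((CharP.cast_eq_zero_iff k p m).1 h), rfl⟩
  refine ⟨e, dvd_mul_right _ _, ?_⟩
  have hp : 0 < p ^ e := pow_pos (expChar_pos k p) e
  have h : ((1 + Polynomial.X : Polynomial k) ^ (p ^ e * m)).coeff (p ^ e)
      = ((p ^ e * m).choose (p ^ e) : k) := Polynomial.coeff_one_add_X_pow _ _ _
  have h2 : (1 + Polynomial.X : Polynomial k) ^ (p ^ e * m)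
      = Polynomial.expand k (p ^ e) ((1 + Polynomial.X) ^ m) := by
    rw [pow_mul, add_pow_expChar_pow]; simp
  rw [← h, h2]
  have := Polynomial.coeff_expand_mul hp ((1 + Polynomial.X : Polynomial k) ^ m) 1
  rw [one_mul] at this
  rw [this, Polynomial.coeff_one_add_X_pow]
  simpa using hm

namespace Slope
variable {k D Γ : Type} [Field k] [CommRing D] [Algebra k D]
    [AddCommGroup Γ] [LinearOrder Γ] [IsOrderedAddMonoid Γ] {S : Slope k D Γ}

theorem w_add_index (i j : ℕ) (b : D) :
    S.w (i + j) b = S.w i b + ((-(j • S.γ) : Γ) : WithTop Γ) := by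
  rw [w, w, add_smul, neg_add, WithTop.coe_add, add_assoc]

theorem v_natCast_mul_le (c : ℕ) (b : D) : S.v b ≤ S.v ((c : D) * b) := by
  by_cases h : (c : k) = 0
  · have : (c : D) = 0 := by rw [← map_natCast (algebraMap k D), h, map_zero]
    rw [this, zero_mul, S.v.map_zero]; exact le_top
  · rw [← map_natCast (algebraMap k D), S.v.map_mul, S.alg _ h, zero_add]

theorem v_natCast_mul {c : ℕ} (h : (c : k) ≠ 0) (b : D) : S.v ((c : D) * b) = S.v b := by
  rw [← map_natCast (algebraMap k D), S.v.map_mul, S.alg _ h, zero_add]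

theorem HasDeg.top {a : D} {n : ℕ} (h : S.HasDeg a n) : S.HasDeg (S.φ.co n a) 0 := by
  refine ⟨by rw [w_zero, ExpMap.co_zero], fun j hj => ?_⟩
  rw [ExpMap.co_co]
  have h1 : S.w n (S.φ.co n a) < S.w (j + n) (S.φ.co (n + j) a) := by
    rw [h.1, add_comm j n]; exact h.2 _ (by omega)
  rw [w_add_index] at h1
  have h2 : S.v (S.φ.co n a) < S.w j (S.φ.co (n + j) a) :=
    lt_of_not_ge fun hle => absurd h1 (not_lt.2 (add_le_add_left hle _))
  exact h2.trans_le (S.w_le_w (v_natCast_mul_le _ _))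

theorem HasDeg.co_of_choose {a : D} {n i : ℕ} (h : S.HasDeg a n) (hi : i ≤ n)
    (hc : (n.choose i : k) ≠ 0) :
    S.w i (S.φ.co i a) = S.v a ∧ S.HasDeg (S.φ.co i a) (n - i) := by
  obtain ⟨l, rfl⟩ := Nat.exists_eq_add_of_le hi
  rw [Nat.add_sub_cancel_left]
  have hcan : ∀ x y : WithTop Γ, x + ((-(i • S.γ) : Γ) : WithTop Γ) =
      y + ((-(i • S.γ) : Γ) : WithTop Γ) → x = y := fun x y =>
    WithTop.add_right_cancel WithTop.coe_ne_top
  have h1 : S.w (l + i) (S.φ.co l (S.φ.co i a)) = S.v a := by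
    rw [ExpMap.co_co, ← h.1, add_comm l i, w_inj, v_natCast_mul hc]
  have h2 : S.w (l + i) (S.φ.co l (S.φ.co i a)) ≥ S.w i (S.φ.co i a) := by
    rw [w_add_index]; exact add_le_add_left (S.v_le_w l _) _
  have h3 : S.w i (S.φ.co i a) = S.v a := le_antisymm (h2.trans h1.le) (S.v_le_w i a)
  refine ⟨h3, ?_, fun j hj => ?_⟩
  · apply hcan
    rw [← w_add_index, h1, ← h3]; rfl
  · rw [ExpMap.co_co]
    have h4 : S.w i (S.φ.co i a) < S.w (j + i) (S.φ.co (i + j) a) := by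
      rw [h3, add_comm j i]; exact h.2 _ (by omega)
    rw [w_add_index] at h4
    have h5 : S.v (S.φ.co i a) < S.w j (S.φ.co (i + j) a) :=
      lt_of_not_ge fun hle => absurd h4 (not_lt.2 (add_le_add_left hle _))
    exact h5.trans_le (S.w_le_w (v_natCast_mul_le _ _))

/-- `d` is the least positive degree. -/
def IsMinDeg (S : Slope k D Γ) (d : ℕ) : Prop :=
  0 < d ∧ (∃ a, S.HasDeg a d) ∧ ∀ a n, S.HasDeg a n → 0 < n → d ≤ n

theorem exists_isMinDeg {a : D} {n : ℕ} (h : S.HasDeg a n) (hn : 0 < n) : ∃ d, S.IsMinDeg d := by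
  classical
  have hex : ∃ d, 0 < d ∧ ∃ a, S.HasDeg a d := ⟨n, hn, a, h⟩
  exact ⟨Nat.find hex, (Nat.find_spec hex).1, (Nat.find_spec hex).2,
    fun b l hb hl => Nat.find_min' hex ⟨hl, b, hb⟩⟩

theorem IsMinDeg.dvd {d : ℕ} (hd : S.IsMinDeg d) {a : D} {n : ℕ} (h : S.HasDeg a n) : d ∣ n := by
  rcases Nat.eq_zero_or_pos n with rfl | hn
  · exact dvd_zero _
  obtain ⟨p, hp⟩ := ExpChar.exists k
  have key : ∀ b l, S.HasDeg b l → 0 < l → ∃ e, p ^ e ∣ l ∧ d ≤ p ^ e := by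
    intro b l hb hl
    obtain ⟨e, he, hc⟩ := exists_choose_ne_zero k p hl
    have hle : p ^ e ≤ l := Nat.le_of_dvd hl he
    rw [← Nat.choose_symm hle] at hc
    have := (hb.co_of_choose (Nat.sub_le _ _) hc).2
    rw [Nat.sub_sub_self hle] at this
    exact ⟨e, he, hd.2.2 _ _ this (pow_pos (expChar_pos k p) e)⟩
  obtain ⟨s, hs⟩ := hd.2.1
  obtain ⟨e₀, h0, h0'⟩ := key s d hs hd.1
  have hde : d = p ^ e₀ := le_antisymm h0' (Nat.le_of_dvd hd.1 h0)
  obtain ⟨e, he, he'⟩ := key a n h hn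
  rw [hde] at he' ⊢
  refine dvd_trans ?_ he
  rcases Nat.lt_or_ge p 2 with hp2 | hp2
  · have : p = 1 := by have := expChar_pos k p; omega
    simp [this]
  · exact pow_dvd_pow p ((Nat.pow_le_pow_iff_right hp2).1 he')

theorem HasDeg.pow_co {a : D} {n : ℕ} (ha : S.HasDeg a n) (e : ℕ) :
    S.v (a ^ e) < S.w (e * n) (S.φ.co (e * n) (a ^ e) - S.φ.co n a ^ e) := by
  induction e with
  | zero =>
    rw [pow_zero, pow_zero, zero_mul, ExpMap.co_zero, sub_self, w, S.v.map_zero, WithTop.top_add]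
    exact lt_top_iff_ne_top.2 S.hasDeg_one.v_ne_top
  | succ e ih =>
    have h1 := (ha.pow e).mul_co ha
    rw [pow_succ, Nat.succ_mul, pow_succ]
    have h2 : S.φ.co (e * n + n) (a ^ e * a) - S.φ.co n a ^ e * S.φ.co n a =
      (S.φ.co (e * n + n) (a ^ e * a) - S.φ.co (e * n) (a ^ e) * S.φ.co n a) +
      (S.φ.co (e * n) (a ^ e) - S.φ.co n a ^ e) * S.φ.co n a := by ring
    rw [h2]
    refine S.w_add_lt h1 ?_
    rw [w_mul, S.v.map_mul, ha.1]
    exact WithTop.add_lt_add_right ha.v_ne_top ih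

theorem HasDeg.expansion {d : ℕ} (hd : S.IsMinDeg d) {s : D} (hs : S.HasDeg s d) :
    ∀ e : ℕ, ∀ a, S.HasDeg a (e * d) → ∃ (M : ℕ) (ρ : Polynomial D) (b : D),
      S.φ.co d s ^ M * a = ρ.eval s + b ∧ S.v (S.φ.co d s ^ M * a) < S.v b ∧ ρ.natDegree ≤ e ∧
      ∀ i, ρ.coeff i = 0 ∨ (S.HasDeg (ρ.coeff i) 0 ∧
        S.v (ρ.coeff i * s ^ i) = S.v (S.φ.co d s ^ M * a)) := by
  intro e
  induction e using Nat.strong_induction_on with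
  | _ e ih =>
  intro a ha
  set c := S.φ.co d s with hc
  have hc0 : S.HasDeg c 0 := hs.top
  rcases Nat.eq_zero_or_pos e with rfl | he
  · refine ⟨0, Polynomial.C a, 0, by simp, ?_, by simp, fun i => ?_⟩
    · rw [S.v.map_zero]; simpa using lt_top_iff_ne_top.2 ha.v_ne_top
    · rcases i with _ | i
      · right; simpa using ha
      · left; simp
  have hn0 : 0 < e * d := Nat.mul_pos he hd.1
  set n := e * d with hn
  set an := S.φ.co n a with han
  have han0 : S.HasDeg an 0 := ha.top
  have hce : S.HasDeg (c ^ e) 0 := by simpa using hc0.pow e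
  have h1 : S.HasDeg (c ^ e * a) n := by simpa using hce.mul ha
  have hse : S.HasDeg (s ^ e) n := hs.pow e
  have h2 : S.HasDeg (an * s ^ e) n := by simpa using han0.mul hse
  have hv : S.v (an * s ^ e) = S.v (c ^ e * a) := by
    rw [S.v.map_mul, S.v.map_mul, S.v.map_pow, S.v.map_pow, ← hs.1, ← ha.1, w, w, hn, mul_smul,
      nsmul_add, ← WithTop.coe_nsmul, smul_neg]
    ring_nf
    abel
  have h3 : S.LeAt (S.v (c ^ e * a)) (c ^ e * a - an * s ^ e) (n - 1) := by
    intro i hi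
    rcases eq_or_lt_of_le (show n ≤ i by omega) with rfl | hi'
    · have e1 := hce.mul_co ha
      have e2 := han0.mul_co hse
      have e3 := hs.pow_co e
      rw [ExpMap.co_zero, zero_add] at e1 e2
      have e4 : S.φ.co n (c ^ e * a - an * s ^ e) = (S.φ.co n (c ^ e * a) - c ^ e * an)
          - (S.φ.co n (an * s ^ e) - an * S.φ.co n (s ^ e))
          - an * (S.φ.co n (s ^ e) - c ^ e) := by rw [map_sub]; ring
      rw [e4]
      refine S.w_sub_lt (S.w_sub_lt e1 (hv ▸ e2)) ?_
      have e5 := S.w_mul 0 n an (S.φ.co n (s ^ e) - c ^ e)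
      rw [zero_add, w_zero] at e5
      rw [e5, ← hv, S.v.map_mul]
      exact WithTop.add_lt_add_left han0.v_ne_top e3
    · exact ((h1.leAt le_rfl).sub (hv ▸ h2.leAt le_rfl)) i hi'
  set b₁ := c ^ e * a - an * s ^ e with hb₁
  have hvb : S.v (c ^ e * a) ≤ S.v b₁ := by
    have := S.v.map_sub (c ^ e * a) (an * s ^ e)
    simpa [hv] using this
  have hXe : ∀ x : D, (Polynomial.C x * Polynomial.X ^ e : Polynomial D).natDegree ≤ e :=
    fun x => Polynomial.natDegree_C_mul_X_pow_le x e
  rcases hvb.lt_or_eq with hlt | heq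
  · refine ⟨e, Polynomial.C an * Polynomial.X ^ e, b₁, by simp [hb₁], hlt, hXe _, fun i => ?_⟩
    rw [Polynomial.coeff_C_mul_X_pow]
    split_ifs with hie
    · right; rw [hie]; exact ⟨han0, hv⟩
    · left; rfl
  · have hb0 : b₁ ≠ 0 := by
      intro h0; rw [h0, S.v.map_zero] at heq; exact h1.v_ne_top heq
    obtain ⟨n', hn'⟩ := S.exists_hasDeg hb0
    obtain ⟨e', rfl⟩ := hd.dvd hn'
    have hle : d * e' ≤ n - 1 := hn'.le_of_leAt (heq ▸ h3)
    have hee : e' < e := by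
      have : d * e' < d * e := by rw [mul_comm d e]; omega
      exact lt_of_mul_lt_mul_left this (Nat.zero_le _)
    rw [mul_comm] at hn'
    obtain ⟨M, ρ, b, q1, q2, q3, q4⟩ := ih e' hee b₁ hn'
    have hcM : S.HasDeg (c ^ M) 0 := by simpa using hc0.pow M
    have hval : S.v (c ^ M * b₁) = S.v (c ^ (M + e) * a) := by
      rw [S.v.map_mul, ← heq, ← S.v.map_mul, pow_add, mul_assoc]
    refine ⟨M + e, Polynomial.C (c ^ M * an) * Polynomial.X ^ e + ρ, b, ?_, hval ▸ q2, ?_, ?_⟩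
    · rw [Polynomial.eval_add, add_assoc, ← q1, hb₁]
      simp; ring
    · exact (Polynomial.natDegree_add_le _ _).trans (max_le (hXe _) (q3.trans hee.le))
    · intro i
      rw [Polynomial.coeff_add, Polynomial.coeff_C_mul_X_pow]
      split_ifs with hie
      · right
        rw [hie, Polynomial.coeff_eq_zero_of_natDegree_lt (by omega), add_zero]
        refine ⟨by simpa using hcM.mul han0, ?_⟩
        rw [mul_assoc, S.v.map_mul, hv, ← S.v.map_mul, pow_add, mul_assoc]
      · rw [zero_add, ← hval]; exact q4 i

end Slope

namespace RingA
section
variable {k : Type} [Field k] {m : ℕ} {r : Fin m → ℕ} {F : MvPolynomial (Fin m ⊕ Fin 2) k}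

variable (r F) in
/-- The evaluation `k[X_1,…,X_m,Z,T] → A`. -/
def evB : MvPolynomial (Fin m ⊕ Fin 2) k →ₐ[k] RingA k m r F :=
  aeval (Sum.elim (xA k m r F) ![zA k m r F, tA k m r F])

variable (r F) in
/-- The evaluation `k[Z,T] → A`. -/
def evP : MvPolynomial (Fin 2) k →ₐ[k] RingA k m r F :=
  aeval ![zA k m r F, tA k m r F]

theorem evB_rename_inr (p : MvPolynomial (Fin 2) k) : evB r F (rename Sum.inr p) = evP r F p := by
  rw [evB, aeval_rename]; rfl

theorem relation : (∏ i, xA k m r F i ^ r i) * yA k m r F = evB r F F := by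
  have h : (Ideal.Quotient.mk (Ideal.span {relG k m r F})) (relG k m r F) = 0 :=
    Ideal.Quotient.eq_zero_iff_mem.2 (Ideal.mem_span_singleton_self _)
  rw [relG, map_sub, sub_eq_zero, map_mul, map_prod] at h
  have e : (Ideal.Quotient.mkₐ k (Ideal.span {relG k m r F})).comp (incl k m) = evB r F := by
    ext j
    rcases j with i | j
    · simp [incl, evB, xA]
    · fin_cases j <;> simp [incl, evB, zA, tA]
  rw [← e, AlgHom.comp_apply]
  simp only [map_pow] at h
  exact h

/-- The data of a normal form monomial: exponents `α` of `x` and `n` of `y` such that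
either `n = 0` or the product `∏ x_i ^ r_i` does not divide `x ^ α`. -/
def IsNormal (r : Fin m → ℕ) (κ : (Fin m → ℕ) × ℕ) : Prop := κ.2 = 0 ∨ ∃ i, κ.1 i < r i

variable (r F) in
/-- The element `p(z,t) x ^ α y ^ n` of `A`. -/
def term (κ : (Fin m → ℕ) × ℕ) (p : MvPolynomial (Fin 2) k) : RingA k m r F :=
  evP r F p * ((∏ i, xA k m r F i ^ κ.1 i) * yA k m r F ^ κ.2)

variable (r F) in
/-- The sum of the normal form terms given by a finitely supported family. -/
def nf : ({κ // IsNormal r κ} →₀ MvPolynomial (Fin 2) k) →+ RingA k m r F :=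
  Finsupp.liftAddHom fun κ =>
    { toFun := term r F κ.1
      map_zero' := by simp [term]
      map_add' := fun p q => by simp [term, add_mul] }

theorem nf_apply (q : {κ // IsNormal r κ} →₀ MvPolynomial (Fin 2) k) :
    nf r F q = ∑ κ ∈ q.support, term r F κ.1 (q κ) := by
  rw [nf, Finsupp.liftAddHom_apply]; rfl

theorem prod_pow_add_single (α : Fin m → ℕ) (i : Fin m) (x : Fin m → RingA k m r F) :
    ∏ j, x j ^ (α + Pi.single i 1 : Fin m → ℕ) j = (∏ j, x j ^ α j) * x i := by
  simp only [Pi.add_apply, pow_add, Finset.prod_mul_distrib]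
  congr 1
  rw [Finset.prod_eq_single i]
  · simp
  · intro j _ hj; simp [Pi.single_eq_of_ne hj]
  · simp

theorem term_mul_evB_mem {n : ℕ}
    (h : ∀ α p, term r F (α, n) p ∈ (nf r F).range) (G : MvPolynomial (Fin m ⊕ Fin 2) k) :
    ∀ α p, term r F (α, n) p * evB r F G ∈ (nf r F).range := by
  induction G using MvPolynomial.induction_on with
  | C c =>
    intro α p
    convert h α (p * C c) using 1
    rw [term, term, map_mul, algHom_C, algHom_C]; ring
  | add G₁ G₂ h₁ h₂ =>
    intro α p
    rw [map_add, mul_add]; exact add_mem (h₁ α p) (h₂ α p)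
  | mul_X G j ih =>
    intro α p
    rcases j with i | j
    · convert ih (α + Pi.single i 1) p using 1
      simp only [term, prod_pow_add_single, map_mul]
      simp only [evB, aeval_X, Sum.elim_inl]; ring
    · convert ih α (p * X j) using 1
      simp only [term, map_mul]
      simp only [evP, evB, aeval_X, Sum.elim_inr]; ring

theorem term_mem (n : ℕ) : ∀ α p, term r F (α, n) p ∈ (nf r F).range := by
  have hnorm : ∀ κ, IsNormal r κ → ∀ p, term r F κ p ∈ (nf r F).range := fun κ hκ p =>
    ⟨Finsupp.single ⟨κ, hκ⟩ p, by
      rw [nf, Finsupp.liftAddHom_apply_single]; rfl⟩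
  induction n with
  | zero => exact fun α p => hnorm (α, 0) (Or.inl rfl) p
  | succ n ih =>
    intro α p
    by_cases hα : ∃ i, α i < r i
    · exact hnorm (α, n + 1) (Or.inr hα) p
    · push Not at hα
      convert term_mul_evB_mem ih F (α - r) p using 1
      rw [← relation, term, term]
      have : ∏ i, xA k m r F i ^ α i
          = (∏ i, xA k m r F i ^ (α - r) i) * ∏ i, xA k m r F i ^ r i := by
        rw [← Finset.prod_mul_distrib]
        refine Finset.prod_congr rfl fun i _ => ?_
        rw [← pow_add, Pi.sub_apply, Nat.sub_add_cancel (hα i)]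
      simp only [this, pow_succ]; ring

theorem nf_surjective : Function.Surjective (nf r F) := by
  have key : ∀ G : BigP k m, ∀ α n p,
      term r F (α, n) p * Ideal.Quotient.mk _ G ∈ (nf r F).range := by
    intro G
    induction G using MvPolynomial.induction_on with
    | C c =>
      intro α n p
      convert term_mem n α (p * C c) using 1
      rw [term, term, map_mul, algHom_C, mul_right_comm]; rfl
    | add G₁ G₂ h₁ h₂ =>
      intro α n p
      rw [map_add, mul_add]; exact add_mem (h₁ α n p) (h₂ α n p)
    | mul_X G j ih =>
      intro α n p
      rcases j with i | j
      · convert ih (α + Pi.single i 1) n p using 1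
        simp only [term, prod_pow_add_single, map_mul, xA]; ring
      · fin_cases j
        · convert ih α (n + 1) p using 1
          simp only [term, map_mul, yA, pow_succ]; ring!
        · convert ih α n (p * X 0) using 1
          simp only [term, map_mul]
          simp [evP, zA]; ring
        · convert ih α n (p * X 1) using 1
          simp only [term, map_mul]
          simp [evP, tA]; ring
  intro a
  obtain ⟨G, rfl⟩ := Ideal.Quotient.mk_surjective a
  have := key G 0 0 1
  simpa [term] using this

section val
variable {Γ : Type} [AddCommGroup Γ] [LinearOrder Γ] [IsOrderedAddMonoid Γ]

/-- The map `x_i ↦ U ^ (w i)` from `k[X_1,…,X_m,Z,T]` to Hahn series over `k[Z,T]`. -/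
def hahnB (k : Type) [Field k] {m : ℕ} (w : Fin m → Γ) :
    MvPolynomial (Fin m ⊕ Fin 2) k →ₐ[k] HahnSeries Γ (MvPolynomial (Fin 2) k) :=
  aeval (Sum.elim (fun i => HahnSeries.single (w i) 1) (fun j => HahnSeries.C (X j)))

variable (r F) in
/-- The extension of `hahnB` to `A`. -/
def hahnA (w : Fin m → Γ) : RingA k m r F →ₐ[k] HahnSeries Γ (MvPolynomial (Fin 2) k) :=
  Ideal.Quotient.liftₐ _ (aeval (Sum.elim (fun i => HahnSeries.single (w i) 1)
    ![hahnB k w F * HahnSeries.single (-∑ i, r i • w i) 1,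
      HahnSeries.C (X 0), HahnSeries.C (X 1)])) (by
    intro a ha
    obtain ⟨b, rfl⟩ := Ideal.mem_span_singleton'.1 ha
    rw [map_mul]
    convert mul_zero _
    rw [relG, map_sub, sub_eq_zero, map_mul, map_prod, incl, aeval_rename]
    have h1 : (Sum.elim (fun i => HahnSeries.single (w i) 1)
        ![hahnB k w F * HahnSeries.single (-∑ i, r i • w i) 1,
          HahnSeries.C (X 0), HahnSeries.C (X 1)]) ∘ Sum.map id Fin.succ =
        (Sum.elim (fun i => HahnSeries.single (w i) 1)
          (fun j : Fin 2 => HahnSeries.C (X j : MvPolynomial (Fin 2) k))) := by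
      funext j
      rcases j with i | j
      · simp
      · fin_cases j <;> simp
    rw [h1, ← hahnB]
    have h2 : ∀ s : Finset (Fin m), ∏ i ∈ s,
        (HahnSeries.single (w i) (1 : MvPolynomial (Fin 2) k)) ^ r i
        = HahnSeries.single (∑ i ∈ s, r i • w i) 1 := by
      intro s
      induction s using Finset.cons_induction with
      | empty => simp
      | cons a s ha ih =>
        rw [Finset.prod_cons, ih, Finset.sum_cons, HahnSeries.single_pow,
          HahnSeries.single_mul_single]; simp
    simp only [map_pow, aeval_X, Sum.elim_inl, h2, Sum.elim_inr, Matrix.cons_val_zero]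
    rw [mul_left_comm, HahnSeries.single_mul_single]
    simp)

variable (r F) in
/-- The valuation on `A` pulled back from Hahn series. -/
def val (w : Fin m → Γ) : AddValuation (RingA k m r F) (WithTop Γ) :=
  (HahnSeries.addVal Γ (MvPolynomial (Fin 2) k)).comap (hahnA r F w).toRingHom

theorem hahnA_mk (w : Fin m → Γ) (G : BigP k m) :
    hahnA r F w (Ideal.Quotient.mk _ G) = aeval (Sum.elim (fun i => HahnSeries.single (w i) 1)
    ![hahnB k w F * HahnSeries.single (-∑ i, r i • w i) 1,
      HahnSeries.C (X 0), HahnSeries.C (X 1)]) G := rfl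

theorem val_apply (w : Fin m → Γ) (a : RingA k m r F) :
    val r F w a = (hahnA r F w a).orderTop := rfl

theorem val_xA (w : Fin m → Γ) (i : Fin m) : val r F w (xA k m r F i) = w i := by
  rw [val_apply]
  have : hahnA r F w (xA k m r F i) = HahnSeries.single (w i) 1 := by
    rw [xA, hahnA_mk]; simp
  rw [this, HahnSeries.orderTop_single one_ne_zero]

theorem hahnA_evP (w : Fin m → Γ) (p : MvPolynomial (Fin 2) k) :
    hahnA r F w (evP r F p) = HahnSeries.C p := by
  have : ((hahnA r F w).comp (evP r F)).toRingHom
      = (HahnSeries.C : MvPolynomial (Fin 2) k →+* HahnSeries Γ _) := by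
    apply MvPolynomial.ringHom_ext
    · intro c
      simp only [AlgHom.toRingHom_eq_coe, RingHom.coe_coe, algHom_C, HahnSeries.algebraMap_apply]
      rfl
    · intro j
      fin_cases j <;> simp [evP, hahnA_mk, zA, tA]
  exact congrArg (fun h : MvPolynomial (Fin 2) k →+* HahnSeries Γ _ => h p) this

theorem val_evP (w : Fin m → Γ) {p : MvPolynomial (Fin 2) k} (hp : p ≠ 0) :
    val r F w (evP r F p) = 0 := by
  rw [val_apply, hahnA_evP]
  exact HahnSeries.orderTop_single hp

theorem val_algebraMap (w : Fin m → Γ) {c : k} (hc : c ≠ 0) :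
    val r F w (algebraMap k _ c) = 0 := by
  have := val_evP (r := r) (F := F) w (p := C c) (by simpa using hc)
  rwa [algHom_C] at this

theorem val_evP_nonneg (w : Fin m → Γ) (p : MvPolynomial (Fin 2) k) :
    0 ≤ val r F w (evP r F p) := by
  by_cases hp : p = 0
  · simp [hp]
  · rw [val_evP w hp]

theorem val_evB_nonneg (w : Fin m → Γ) (hw : ∀ i, 0 < w i) (G : MvPolynomial (Fin m ⊕ Fin 2) k) :
    0 ≤ val r F w (evB r F G) := by
  induction G using MvPolynomial.induction_on with
  | C c =>
    have := val_evP_nonneg (r := r) (F := F) w (C c)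
    rwa [algHom_C] at this ⊢
  | add p q hp hq =>
    rw [map_add]
    exact (le_min hp hq).trans (AddValuation.map_add _ _ _)
  | mul_X p j hp =>
    rw [map_mul, AddValuation.map_mul]
    refine add_nonneg hp ?_
    rcases j with i | j
    · simp only [evB, aeval_X, Sum.elim_inl, val_xA]
      exact_mod_cast (hw i).le
    · have := val_evP_nonneg (r := r) (F := F) w (X j)
      simpa [evP, evB] using this

theorem val_prod (w : Fin m → Γ) (s : Finset (Fin m)) (α : Fin m → ℕ) :
    val r F w (∏ i ∈ s, xA k m r F i ^ α i) = ((∑ i ∈ s, α i • w i : Γ) : WithTop Γ) := by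
  induction s using Finset.cons_induction with
  | empty => simp
  | cons a s ha ih =>
    rw [Finset.prod_cons, AddValuation.map_mul, ih, AddValuation.map_pow, val_xA, Finset.sum_cons,
      WithTop.coe_add, WithTop.coe_nsmul]

end val
end
end RingA

namespace RingA
section
variable {k : Type} [Field k] {m : ℕ} {r : Fin m → ℕ} {F : MvPolynomial (Fin m ⊕ Fin 2) k}

/-- The standing hypotheses on `A`. -/
structure Hyp {k : Type} [Field k] {m : ℕ} (r : Fin m → ℕ)
    (F g : MvPolynomial (Fin m ⊕ Fin 2) k) : Prop where
  hm : 1 ≤ m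
  hr : ∀ i, 1 < r i
  hf : fOf k m F ≠ 0
  hFg : F = rename Sum.inr (fOf k m F) + (∏ i, X (Sum.inl i)) * g

variable {g : MvPolynomial (Fin m ⊕ Fin 2) k}

theorem Hyp.evB_F (H : Hyp r F g) :
    evB r F F = evP r F (fOf k m F) + (∏ i, xA k m r F i) * evB r F g := by
  have h := congrArg (evB r F) H.hFg
  rw [map_add, evB_rename_inr, map_mul, map_prod] at h
  rw [h]
  simp [evB]

variable {Γ : Type} [AddCommGroup Γ] [LinearOrder Γ] [IsOrderedAddMonoid Γ] {w : Fin m → Γ}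

theorem Hyp.val_evB_F (H : Hyp r F g) (hw : ∀ i, 0 < w i) : val r F w (evB r F F) = 0 := by
  have h0 := val_evP (r := r) (F := F) w H.hf
  rw [H.evB_F, AddValuation.map_add_eq_of_lt_left, h0]
  rw [h0, AddValuation.map_mul]
  have h1 := val_prod (r := r) (F := F) w Finset.univ (fun _ => 1)
  simp only [pow_one] at h1
  rw [h1]
  refine lt_of_lt_of_le ?_ (add_le_add_right (val_evB_nonneg w hw g) _)
  rw [add_zero]
  have : Nonempty (Fin m) := ⟨⟨0, H.hm⟩⟩
  exact_mod_cast Finset.sum_pos (fun i _ => by simpa using hw i) Finset.univ_nonempty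

theorem Hyp.val_yA (H : Hyp r F g) (hw : ∀ i, 0 < w i) :
    val r F w (yA k m r F) = ((-∑ i, r i • w i : Γ) : WithTop Γ) := by
  have h := H.val_evB_F hw
  rw [← relation, AddValuation.map_mul, val_prod] at h
  generalize val r F w (yA k m r F) = u at h ⊢
  cases u with
  | top => simp at h
  | coe u => norm_cast at h ⊢; exact eq_neg_of_add_eq_zero_right h

/-- The weight of a normal form monomial. -/
def wt (r : Fin m → ℕ) (w : Fin m → Γ) (κ : (Fin m → ℕ) × ℕ) : Γ :=
  ∑ i, ((κ.1 i : ℤ) - κ.2 * r i) • w i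

theorem Hyp.val_term (H : Hyp r F g) (hw : ∀ i, 0 < w i) (κ : (Fin m → ℕ) × ℕ)
    {p : MvPolynomial (Fin 2) k} (hp : p ≠ 0) : val r F w (term r F κ p) = wt r w κ := by
  rw [term, AddValuation.map_mul, AddValuation.map_mul, val_evP w hp, AddValuation.map_pow,
    H.val_yA hw, val_prod, zero_add, ← WithTop.coe_nsmul, ← WithTop.coe_add, wt]
  congr 1
  simp only [sub_smul, Finset.sum_sub_distrib, natCast_zsmul, mul_smul, smul_neg, Finset.smul_sum]
  rw [sub_eq_add_neg]

/-- Positive integrally independent weights. -/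
structure Weight (w : Fin m → Γ) : Prop where
  pos : ∀ i, 0 < w i
  inj : ∀ β : Fin m → ℤ, ∑ i, β i • w i = 0 → β = 0

theorem Weight.wt_inj (W : Weight w) {κ κ' : (Fin m → ℕ) × ℕ} (hκ : IsNormal r κ)
    (hκ' : IsNormal r κ') (h : wt r w κ = wt r w κ') : κ = κ' := by
  have h1 := W.inj (fun i => ((κ.1 i : ℤ) - κ.2 * r i) - ((κ'.1 i : ℤ) - κ'.2 * r i)) (by
    simp only [sub_smul _ _ (w _)] at h ⊢
    rw [Finset.sum_sub_distrib, sub_eq_zero]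
    simpa only [wt, sub_smul] using h)
  have h2 : ∀ i, (κ.1 i : ℤ) - κ.2 * r i = (κ'.1 i : ℤ) - κ'.2 * r i := fun i =>
    sub_eq_zero.1 (congrFun h1 i)
  have key : ∀ κ κ' : (Fin m → ℕ) × ℕ, IsNormal r κ' →
      (∀ i, (κ.1 i : ℤ) - κ.2 * r i = (κ'.1 i : ℤ) - κ'.2 * r i) → κ'.2 ≤ κ.2 := by
    intro κ κ' hκ' h
    rcases hκ' with h0 | ⟨i, hi⟩
    · omega
    · have hi2 := h i
      by_contra hlt
      push Not at hlt
      have h3 : ((κ.2 : ℤ) + 1) * r i ≤ κ'.2 * r i :=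
        mul_le_mul_of_nonneg_right (by exact_mod_cast hlt) (by positivity)
      have : (κ'.1 i : ℤ) < r i := by exact_mod_cast hi
      nlinarith [Int.natCast_nonneg (κ.1 i)]
  have hn : κ.2 = κ'.2 := le_antisymm (key κ' κ hκ fun i => (h2 i).symm) (key κ κ' hκ' h2)
  refine Prod.ext (funext fun i => ?_) hn
  have := h2 i
  rw [hn] at this
  exact_mod_cast sub_left_inj.1 this

theorem Hyp.exists_min (H : Hyp r F g) (W : Weight w)
    {q : {κ // IsNormal r κ} →₀ MvPolynomial (Fin 2) k} (hq : q ≠ 0) :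
    ∃ κ ∈ q.support, val r F w (nf r F q) = wt r w κ.1 ∧
      val r F w (nf r F q) < val r F w (term r F κ.1 (q κ) - nf r F q) ∧
      ∀ κ' ∈ q.support, wt r w κ.1 ≤ wt r w κ'.1 := by
  classical
  obtain ⟨κ, hκ, hmin⟩ := Finset.exists_min_image q.support (fun κ => wt r w κ.1)
    (Finsupp.support_nonempty_iff.2 hq)
  have hv : val r F w (term r F κ.1 (q κ)) = wt r w κ.1 :=
    H.val_term W.pos _ (Finsupp.mem_support_iff.1 hκ)
  have hlt : ((wt r w κ.1 : Γ) : WithTop Γ) < val r F w (nf r F q - term r F κ.1 (q κ)) := by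
    rw [nf_apply, ← Finset.sum_erase_eq_sub hκ]
    refine AddValuation.map_lt_sum _ WithTop.coe_ne_top fun κ' hκ' => ?_
    rw [Finset.mem_erase] at hκ'
    rw [H.val_term W.pos _ (Finsupp.mem_support_iff.1 hκ'.2)]
    refine WithTop.coe_lt_coe.2 (lt_of_le_of_ne (hmin κ' hκ'.2) fun h => hκ'.1 ?_)
    exact Subtype.ext (W.wt_inj κ'.2 κ.2 h.symm)
  have hval : val r F w (nf r F q) = wt r w κ.1 := by
    rw [← hv]; refine AddValuation.map_eq_of_lt_sub _ ?_
    rw [hv]; exact hlt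
  refine ⟨κ, hκ, hval, ?_, hmin⟩
  rw [hval, AddValuation.map_sub_swap]; exact hlt

theorem Hyp.val_ne_top (H : Hyp r F g) (W : Weight w) {a : RingA k m r F} (ha : a ≠ 0) :
    val r F w a ≠ ⊤ := by
  obtain ⟨q, rfl⟩ := nf_surjective a
  have hq : q ≠ 0 := by rintro rfl; exact ha (map_zero _)
  obtain ⟨κ, _, h, _⟩ := H.exists_min W hq
  rw [h]; exact WithTop.coe_ne_top

theorem Hyp.val_le_term (H : Hyp r F g) (W : Weight w)
    (q : {κ // IsNormal r κ} →₀ MvPolynomial (Fin 2) k) (κ : {κ // IsNormal r κ}) :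
    val r F w (nf r F q) ≤ val r F w (term r F κ.1 (q κ)) := by
  by_cases hκ : q κ = 0
  · simp [hκ, term]
  · have hq : q ≠ 0 := by rintro rfl; exact hκ rfl
    obtain ⟨κ', _, h, _, hmin⟩ := H.exists_min W hq
    rw [h, H.val_term W.pos _ hκ]
    exact WithTop.coe_le_coe.2 (hmin κ (Finsupp.mem_support_iff.2 hκ))

end
end RingA

namespace RingA
section
variable {k : Type} [Field k] {m : ℕ} {r : Fin m → ℕ} {F : MvPolynomial (Fin m ⊕ Fin 2) k}
variable {g : MvPolynomial (Fin m ⊕ Fin 2) k}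
variable {Γ : Type} [AddCommGroup Γ] [LinearOrder Γ] [IsOrderedAddMonoid Γ] {w : Fin m → Γ}

/-- All coefficients of `φ a` have shifted valuation at least `β`. -/
def Sl {D : Type} [CommRing D] [Algebra k D] (v : AddValuation D (WithTop Γ)) (γ : Γ)
    (φ : ExpMap k D) (β : WithTop Γ) (a : D) : Prop :=
  ∀ i, β ≤ v (φ.co i a) + ((-(i • γ) : Γ) : WithTop Γ)

section Sl
variable {D : Type} [CommRing D] [Algebra k D] {v : AddValuation D (WithTop Γ)} {γ : Γ}
    {φ : ExpMap k D} {β β' : WithTop Γ} {a b : D}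

theorem Sl.zero : Sl v γ φ β 0 := fun i => by simp

theorem Sl.add (ha : Sl v γ φ β a) (hb : Sl v γ φ β b) : Sl v γ φ β (a + b) := fun i => by
  rw [map_add]
  refine le_trans ?_ (add_le_add_left (v.map_add _ _) _)
  rcases min_choice (v (φ.co i a)) (v (φ.co i b)) with h | h <;> rw [h]
  exacts [ha i, hb i]

theorem Sl.sum {ι : Type} {s : Finset ι} {f : ι → D} (h : ∀ j ∈ s, Sl v γ φ β (f j)) :
    Sl v γ φ β (∑ j ∈ s, f j) := by
  induction s using Finset.cons_induction with
  | empty => simpa using Sl.zero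
  | cons a s ha ih =>
    rw [Finset.sum_cons]
    exact (h a (by simp)).add (ih fun j hj => h j (by simp [hj]))

theorem le_add_neg_iff {β x : WithTop Γ} {c : Γ} :
    β ≤ x + ((-c : Γ) : WithTop Γ) ↔ β + c ≤ x := by
  cases x with
  | top => simp
  | coe x =>
    cases β with
    | top => 
      rw [← WithTop.coe_add, WithTop.top_add]
      simp only [top_le_iff, WithTop.coe_ne_top]
    | coe β => norm_cast; rw [← sub_eq_add_neg, le_sub_iff_add_le]

theorem Sl.mul (ha : Sl v γ φ β a) (hb : Sl v γ φ β' b) : Sl v γ φ (β + β') (a * b) := fun i => by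
  rw [le_add_neg_iff, ExpMap.co_mul]
  refine v.map_le_sum fun x hx => ?_
  rw [Finset.HasAntidiagonal.mem_antidiagonal] at hx
  rw [v.map_mul, ← hx, add_smul, WithTop.coe_add, add_add_add_comm]
  exact add_le_add (le_add_neg_iff.1 (ha _)) (le_add_neg_iff.1 (hb _))

theorem Sl.one : Sl v γ φ 0 1 := fun i => by
  rcases Nat.eq_zero_or_pos i with rfl | hi
  · simp [ExpMap.co_zero]
  · rw [← map_one (algebraMap k D), ExpMap.co_algebraMap _ hi.ne']; simp

theorem Sl.pow (ha : Sl v γ φ β a) (n : ℕ) : Sl v γ φ (n • β) (a ^ n) := by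
  induction n with
  | zero => simpa using Sl.one
  | succ n ih => rw [pow_succ, succ_nsmul]; exact ih.mul ha

theorem Sl.prod {ι : Type} {s : Finset ι} {f : ι → D} {β : ι → WithTop Γ}
    (h : ∀ j ∈ s, Sl v γ φ (β j) (f j)) : Sl v γ φ (∑ j ∈ s, β j) (∏ j ∈ s, f j) := by
  induction s using Finset.cons_induction with
  | empty => simpa using Sl.one
  | cons a s ha ih =>
    rw [Finset.sum_cons, Finset.prod_cons]
    exact (h a (by simp)).mul (ih fun j hj => h j (by simp [hj]))

end Sl

variable (r F) in
/-- The generators `x_i, y, z, t` of `A`. -/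
def gen (s : Fin m ⊕ Fin 3) : RingA k m r F := Ideal.Quotient.mk _ (X s)

theorem Hyp.gen_ne_zero (H : Hyp r F g) (W : Weight w) (s : Fin m ⊕ Fin 3) : gen r F s ≠ 0 := by
  intro h
  have h' : val r F w (gen r F s) = ⊤ := by rw [h, AddValuation.map_zero]
  have hP : ∀ j : Fin 2, val r F w (evP r F (X j)) ≠ ⊤ := fun j => by
    rw [val_evP w (X_ne_zero j)]; exact WithTop.zero_ne_top
  rcases s with i | j
  · have := val_xA (r := r) (F := F) w i
    rw [xA, ← gen, h'] at this
    exact WithTop.top_ne_coe this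
  · fin_cases j
    · have := H.val_yA W.pos
      exact WithTop.top_ne_coe (h'.symm.trans this)
    · refine hP 0 (Eq.trans ?_ h'); simp [evP, gen, zA]
    · refine hP 1 (Eq.trans ?_ h'); simp [evP, gen, tA]

theorem Hyp.sl_of_gen (H : Hyp r F g) (W : Weight w) {γ : Γ} {φ : ExpMap k (RingA k m r F)}
    (h : ∀ s, Sl (val r F w) γ φ (val r F w (gen r F s)) (gen r F s)) (a : RingA k m r F) :
    Sl (val r F w) γ φ (val r F w a) a := by
  have hP : ∀ p, Sl (val r F w) γ φ 0 (evP r F p) := by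
    intro p
    induction p using MvPolynomial.induction_on with
    | C c =>
      rw [algHom_C]
      intro i
      rcases Nat.eq_zero_or_pos i with rfl | hi
      · rw [ExpMap.co_zero]
        have := val_evP_nonneg (r := r) (F := F) w (C c)
        rw [algHom_C] at this
        simpa using this
      · rw [ExpMap.co_algebraMap _ hi.ne']; simp
    | add p q hp hq => rw [map_add]; exact hp.add hq
    | mul_X p j hp =>
      rw [map_mul, ← add_zero (0 : WithTop Γ)]
      refine hp.mul ?_
      have hv := val_evP (r := r) (F := F) w (X_ne_zero (R := k) j)
      have hg : evP r F (X j) = gen r F (Sum.inr j.succ) := by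
        fin_cases j <;> simp [evP, gen, zA, tA]
      rw [← hv, hg]; exact h _
  have hterm : ∀ κ p, Sl (val r F w) γ φ (val r F w (term r F κ p)) (term r F κ p) := by
    intro κ p
    by_cases hp : p = 0
    · rw [hp]; simpa [term] using Sl.zero
    · have e : val r F w (term r F κ p) =
          0 + ((∑ i, κ.1 i • val r F w (xA k m r F i)) + κ.2 • val r F w (yA k m r F)) := by
        rw [term, AddValuation.map_mul, val_evP w hp, AddValuation.map_mul, AddValuation.map_pow,
          val_prod]
        simp [val_xA]
      rw [e]
      exact (hP p).mul ((Sl.prod fun i _ => (h (Sum.inl i)).pow _).mul ((h (Sum.inr 0)).pow _))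
  obtain ⟨q, rfl⟩ := nf_surjective a
  have h1 : ∀ κ ∈ q.support, Sl (val r F w) γ φ (val r F w (nf r F q)) (term r F κ.1 (q κ)) :=
    fun κ _ i => (H.val_le_term W q κ).trans (hterm _ _ i)
  have h2 := Sl.sum h1
  rwa [← nf_apply] at h2

theorem Hyp.exists_slope [Module ℚ Γ] (H : Hyp r F g) (W : Weight w)
    (φ : ExpMap k (RingA k m r F)) (hφ : ∃ s, gen r F s ∉ φ.invariants) :
    ∃ S : Slope k (RingA k m r F) Γ, S.φ = φ ∧ S.v = val r F w ∧
      ∃ s n, 0 < n ∧ S.HasDeg (gen r F s) n := by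
  classical
  let u : RingA k m r F → Γ := fun a => (val r F w a).untopD 0
  have hu : ∀ a, a ≠ 0 → val r F w a = u a := fun a ha => by
    have := H.val_ne_top W ha
    lift val r F w a to Γ using this with b hb
    simp [u, ← hb]
  let N := Finset.univ.sup fun s => (φ.toAlgHom (gen r F s)).natDegree
  let T := (Finset.univ ×ˢ Finset.range (N + 1)).filter fun x : (Fin m ⊕ Fin 3) × ℕ =>
    0 < x.2 ∧ φ.co x.2 (gen r F x.1) ≠ 0
  have hT : ∀ s i, 0 < i → φ.co i (gen r F s) ≠ 0 → (s, i) ∈ T := by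
    intro s i hi h
    simp only [T, Finset.mem_filter, Finset.mem_product, Finset.mem_univ, true_and,
      Finset.mem_range]
    refine ⟨Nat.lt_succ_of_le ?_, hi, h⟩
    by_contra hN
    refine h ?_
    rw [ExpMap.co_apply]
    refine Polynomial.coeff_eq_zero_of_natDegree_lt (lt_of_le_of_lt ?_ (not_le.1 hN))
    exact Finset.le_sup (f := fun s => (φ.toAlgHom (gen r F s)).natDegree) (Finset.mem_univ s)
  let c : (Fin m ⊕ Fin 3) × ℕ → Γ := fun x =>
    (x.2 : ℚ)⁻¹ • (u (φ.co x.2 (gen r F x.1)) - u (gen r F x.1))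
  have hc : ∀ x : (Fin m ⊕ Fin 3) × ℕ, 0 < x.2 →
      x.2 • c x = u (φ.co x.2 (gen r F x.1)) - u (gen r F x.1) := by
    intro x hx
    rw [← Nat.cast_smul_eq_nsmul ℚ, smul_smul, mul_inv_cancel₀ (by exact_mod_cast hx.ne'),
      one_smul]
  have hne : T.Nonempty := by
    obtain ⟨s, hs⟩ := hφ
    rw [ExpMap.mem_invariants] at hs
    push Not at hs
    obtain ⟨i, hi, h⟩ := hs
    exact ⟨(s, i), hT s i hi h⟩
  obtain ⟨x, hx, hmin⟩ := Finset.exists_min_image T c hne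
  have hx' : 0 < x.2 ∧ φ.co x.2 (gen r F x.1) ≠ 0 := (Finset.mem_filter.1 hx).2
  have hgen : ∀ s, Sl (val r F w) (c x) φ (val r F w (gen r F s)) (gen r F s) := by
    intro s i
    rcases Nat.eq_zero_or_pos i with rfl | hi
    · simp [ExpMap.co_zero]
    by_cases h0 : φ.co i (gen r F s) = 0
    · simp [h0]
    rw [hu _ h0, hu _ (H.gen_ne_zero W s), ← WithTop.coe_add, WithTop.coe_le_coe,
      ← sub_eq_add_neg, le_sub_comm, ← hc (s, i) hi]
    exact nsmul_le_nsmul_right (hmin _ (hT s i hi h0)) i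
  let S : Slope k (RingA k m r F) Γ :=
    { φ := φ
      v := val r F w
      γ := c x
      ne_top := fun a ha => H.val_ne_top W ha
      alg := fun a ha => val_algebraMap w ha
      slope := fun i a => H.sl_of_gen W hgen a i }
  refine ⟨S, rfl, rfl, x.1, ?_⟩
  obtain ⟨n, hn⟩ := S.exists_hasDeg (H.gen_ne_zero W x.1)
  refine ⟨n, ?_, hn⟩
  refine hx'.1.trans_le ?_
  by_contra hlt
  refine (hn.2 x.2 (not_le.1 hlt)).ne ?_
  change val r F w _ = val r F w _ + _
  rw [hu _ hx'.2, hu _ (H.gen_ne_zero W x.1), ← WithTop.coe_add, WithTop.coe_inj]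
  change _ = _ + -(x.2 • c x)
  rw [hc x hx'.1]; abel

end
end RingA

section trivialSlope
variable {k D : Type} [Field k] [CommRing D] [IsDomain D] [Algebra k D]

open Classical in
/-- The valuation vanishing on nonzero elements. -/
def trivialVal (D : Type) [CommRing D] [IsDomain D] : AddValuation D (WithTop ℤ) :=
  AddValuation.of (fun a => if a = 0 then ⊤ else 0) (by simp) (by simp)
    (fun a b => by
      by_cases ha : a = 0
      · simp [ha]
      · by_cases hb : b = 0
        · simp [hb]
        · simp only [if_neg ha, if_neg hb, min_self]; split_ifs <;> simp)
    (fun a b => by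
      by_cases ha : a = 0
      · simp [ha]
      · by_cases hb : b = 0
        · simp [hb]
        · simp [ha, hb])

theorem trivialVal_of_ne {a : D} (ha : a ≠ 0) : trivialVal D a = 0 := if_neg ha

/-- The slope structure given by the degree in `U`. -/
def trivialSlope (φ : ExpMap k D) : Slope k D ℤ where
  φ := φ
  v := trivialVal D
  γ := 0
  ne_top a ha := by rw [trivialVal_of_ne ha]; exact WithTop.zero_ne_top
  alg c hc := trivialVal_of_ne (by simpa using hc)
  slope i a := by
    by_cases h : φ.co i a = 0
    · simp [h]
    · have ha : a ≠ 0 := by rintro rfl; simp at h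
      rw [trivialVal_of_ne h, trivialVal_of_ne ha]; simp

theorem trivialSlope_hasDeg_zero {φ : ExpMap k D} {a : D} :
    (trivialSlope φ).HasDeg a 0 ↔ a ≠ 0 ∧ a ∈ φ.invariants := by
  have hw : ∀ i b, (trivialSlope φ).w i b = trivialVal D b := fun i b => by
    simp [Slope.w, trivialSlope]
  rw [ExpMap.mem_invariants]
  constructor
  · intro h
    refine ⟨h.ne_zero, fun i hi => ?_⟩
    by_contra hc
    have := h.2 i hi
    rw [hw] at this
    change trivialVal D a < trivialVal D (φ.co i a) at this
    rw [trivialVal_of_ne h.ne_zero, trivialVal_of_ne hc] at this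
    exact lt_irrefl _ this
  · rintro ⟨ha, h⟩
    refine ⟨by rw [Slope.w_zero, ExpMap.co_zero], fun i hi => ?_⟩
    rw [hw]
    change trivialVal D a < trivialVal D (φ.co i a)
    rw [h i hi, trivialVal_of_ne ha, AddValuation.map_zero]
    exact WithTop.coe_lt_top 0

theorem ExpMap.invariants_of_mul {φ : ExpMap k D} {a b : D} (hab : a * b ≠ 0)
    (h : a * b ∈ φ.invariants) : a ∈ φ.invariants := by
  obtain ⟨n, hn⟩ := (trivialSlope φ).exists_hasDeg (left_ne_zero_of_mul hab)
  obtain ⟨l, hl⟩ := (trivialSlope φ).exists_hasDeg (right_ne_zero_of_mul hab)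
  have := (hn.mul hl).unique (trivialSlope_hasDeg_zero.2 ⟨hab, h⟩)
  have : n = 0 := by omega
  subst this
  exact (trivialSlope_hasDeg_zero.1 hn).2

/-- A nontrivial exponential map admits a local slice. -/
theorem ExpMap.exists_slice {φ : ExpMap k D} {a : D} (ha : a ∉ φ.invariants) :
    ∃ s c : D, c ≠ 0 ∧ c ∈ φ.invariants ∧ ∀ b, ∃ (M : ℕ) (ρ : Polynomial D),
      c ^ M * b = ρ.eval s ∧ ∀ i, ρ.coeff i ∈ φ.invariants := by
  have ha0 : a ≠ 0 := by rintro rfl; exact ha (zero_mem _)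
  obtain ⟨n, hn⟩ := (trivialSlope φ).exists_hasDeg ha0
  have hn0 : 0 < n := Nat.pos_of_ne_zero fun h => by
    subst h; exact ha (trivialSlope_hasDeg_zero.1 hn).2
  obtain ⟨d, hd⟩ := Slope.exists_isMinDeg hn hn0
  obtain ⟨s, hs⟩ := hd.2.1
  have hc := trivialSlope_hasDeg_zero.1 hs.top
  refine ⟨s, φ.co d s, hc.1, hc.2, fun b => ?_⟩
  by_cases hb : b = 0
  · exact ⟨0, 0, by simp [hb], fun i => by simp⟩
  obtain ⟨l, hl⟩ := (trivialSlope φ).exists_hasDeg hb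
  obtain ⟨e, rfl⟩ := hd.dvd hl
  rw [mul_comm] at hl
  obtain ⟨M, ρ, b', h1, h2, -, h4⟩ := hs.expansion hd e b hl
  refine ⟨M, ρ, ?_, fun i => ?_⟩
  · have : b' = 0 := by
      by_contra hne
      have h3 : (trivialSlope φ).φ.co d s ^ M * b ≠ 0 := mul_ne_zero (pow_ne_zero _ hc.1) hb
      change trivialVal D _ < trivialVal D _ at h2
      rw [trivialVal_of_ne h3, trivialVal_of_ne hne] at h2
      exact lt_irrefl _ h2
    rw [this, add_zero] at h1; exact h1
  · rcases h4 i with h | h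
    · rw [h]; exact zero_mem _
    · exact (trivialSlope_hasDeg_zero.1 h.1).2

end trivialSlope

namespace RingA
section
variable {k : Type} [Field k] {m : ℕ} {r : Fin m → ℕ} {F : MvPolynomial (Fin m ⊕ Fin 2) k}
variable {g : MvPolynomial (Fin m ⊕ Fin 2) k}

/-- The ring `k[Z,T]/(f)`. -/
def Curve (k : Type) [Field k] (m : ℕ) (F : MvPolynomial (Fin m ⊕ Fin 2) k) : Type :=
  MvPolynomial (Fin 2) k ⧸ Ideal.span {fOf k m F}

instance : CommRing (Curve k m F) :=
  inferInstanceAs (CommRing (MvPolynomial (Fin 2) k ⧸ Ideal.span {fOf k m F}))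

instance : Algebra k (Curve k m F) :=
  inferInstanceAs (Algebra k (MvPolynomial (Fin 2) k ⧸ Ideal.span {fOf k m F}))

/-- The quotient map onto `k[Z,T]/(f)`. -/
def Curve.mk (k : Type) [Field k] (m : ℕ) (F : MvPolynomial (Fin m ⊕ Fin 2) k) :
    MvPolynomial (Fin 2) k →ₐ[k] Curve k m F :=
  Ideal.Quotient.mkₐ k (Ideal.span {fOf k m F})

theorem Curve.mk_fOf : Curve.mk k m F (fOf k m F) = 0 :=
  Ideal.Quotient.eq_zero_iff_mem.2 (Ideal.mem_span_singleton_self _)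

theorem Curve.isDomain (hp : Prime (fOf k m F)) : IsDomain (Curve k m F) := by
  have : (Ideal.span {fOf k m F}).IsPrime := (Ideal.span_singleton_prime hp.ne_zero).2 hp
  exact Ideal.Quotient.isDomain (Ideal.span {fOf k m F})

/-- The universal property of `k[Z,T]/(f)`. -/
def Curve.lift {S : Type} [CommRing S] [Algebra k S] (φ : MvPolynomial (Fin 2) k →ₐ[k] S)
    (h : φ (fOf k m F) = 0) : Curve k m F →ₐ[k] S :=
  Ideal.Quotient.liftₐ (Ideal.span {fOf k m F}) φ (by
    intro a ha
    obtain ⟨b, rfl⟩ := Ideal.mem_span_singleton'.1 ha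
    rw [map_mul, h, mul_zero])

/-- The polynomial ring over `k[Z,T]/(f)` in `m` variables. -/
abbrev Fib (k : Type) [Field k] (m : ℕ) (F : MvPolynomial (Fin m ⊕ Fin 2) k) : Type :=
  MvPolynomial (Fin m) (Curve k m F)

/-- The images of `x_i` in `Fib` with `x_{i₀}` sent to zero. -/
def fibX (k : Type) [Field k] {m : ℕ} (F : MvPolynomial (Fin m ⊕ Fin 2) k) (i₀ i : Fin m) :
    Fib k m F := if i = i₀ then 0 else X i

/-- The map `k[X_1,…,X_m,Z,T] → (k[Z,T]/(f))[X_1,…,X_m]` killing `X_{i₀}`. -/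
def fibB (k : Type) [Field k] {m : ℕ} (F : MvPolynomial (Fin m ⊕ Fin 2) k) (i₀ : Fin m) :
    MvPolynomial (Fin m ⊕ Fin 2) k →ₐ[k] Fib k m F :=
  aeval (Sum.elim (fibX k F i₀) (fun j => C (Curve.mk k m F (X j))))

theorem fibB_rename (i₀ : Fin m) (p : MvPolynomial (Fin 2) k) :
    fibB k F i₀ (rename Sum.inr p) = C (Curve.mk k m F p) := by
  let e : MvPolynomial (Fin 2) k →ₐ[k] Fib k m F :=
    (IsScalarTower.toAlgHom k (Curve k m F) (Fib k m F)).comp (Curve.mk k m F)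
  have : (fibB k F i₀).comp (rename Sum.inr) = e := by
    ext j; simp [fibB, e]
  exact DFunLike.congr_fun this p

theorem Hyp.fibB_F (H : Hyp r F g) (i₀ : Fin m) : fibB k F i₀ F = 0 := by
  have h := congrArg (fibB k F i₀) H.hFg
  rw [map_add, fibB_rename, map_mul, map_prod, Finset.prod_eq_zero (Finset.mem_univ i₀)
    (by simp [fibB, fibX]), zero_mul, add_zero, Curve.mk_fOf, map_zero] at h
  exact h

theorem aeval_relG {S : Type} [CommRing S] [Algebra k S] (v : Fin m ⊕ Fin 3 → S) :
    aeval v (relG k m r F) = (∏ i, v (Sum.inl i) ^ r i) * v (Sum.inr 0) -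
      aeval (v ∘ Sum.map id Fin.succ) F := by
  simp [relG, incl, aeval_rename]

/-- The universal property of `A`. -/
def liftA {S : Type} [CommRing S] [Algebra k S] (v : Fin m ⊕ Fin 3 → S)
    (h : (∏ i, v (Sum.inl i) ^ r i) * v (Sum.inr 0) = aeval (v ∘ Sum.map id Fin.succ) F) :
    RingA k m r F →ₐ[k] S :=
  Ideal.Quotient.liftₐ _ (aeval v) (by
    intro a ha
    obtain ⟨b, rfl⟩ := Ideal.mem_span_singleton'.1 ha
    rw [map_mul, aeval_relG, h, sub_self, mul_zero])

theorem liftA_mk {S : Type} [CommRing S] [Algebra k S] (v : Fin m ⊕ Fin 3 → S)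
    (h : (∏ i, v (Sum.inl i) ^ r i) * v (Sum.inr 0) = aeval (v ∘ Sum.map id Fin.succ) F)
    (G : BigP k m) : liftA v h (Ideal.Quotient.mk _ G) = aeval v G := rfl

/-- The images of the generators of `A` under `fibA`. -/
def fibV (k : Type) [Field k] {m : ℕ} (F : MvPolynomial (Fin m ⊕ Fin 2) k) (i₀ : Fin m) :
    Fin m ⊕ Fin 3 → Polynomial (Fib k m F) :=
  Sum.elim (fun i => Polynomial.C (fibX k F i₀ i))
    ![Polynomial.X, Polynomial.C (C (Curve.mk k m F (X 0))),
      Polynomial.C (C (Curve.mk k m F (X 1)))]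

theorem aeval_fibV (i₀ : Fin m) :
    aeval (fibV k F i₀ ∘ Sum.map id Fin.succ) =
      (IsScalarTower.toAlgHom k (Fib k m F) (Polynomial (Fib k m F))).comp (fibB k F i₀) := by
  ext j
  rcases j with i | j
  · simp [fibB, fibV]
  · fin_cases j <;> simp [fibB, fibV]

/-- The extension of `fibB` to `A`, with `y` sent to a new variable. -/
def Hyp.fibA (H : Hyp r F g) (i₀ : Fin m) : RingA k m r F →ₐ[k] Polynomial (Fib k m F) :=
  liftA (fibV k F i₀) (by
    rw [aeval_fibV, AlgHom.comp_apply, H.fibB_F, map_zero,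
      Finset.prod_eq_zero (Finset.mem_univ i₀), zero_mul]
    have := H.hr i₀
    simp only [fibV, Sum.elim_inl, fibX, if_pos, map_zero]
    exact zero_pow (by omega))

theorem Hyp.fibA_mk (H : Hyp r F g) (i₀ : Fin m) (G : BigP k m) :
    H.fibA i₀ (Ideal.Quotient.mk _ G) = aeval (fibV k F i₀) G := rfl

theorem Hyp.fibA_evB (H : Hyp r F g) (i₀ : Fin m) (G : MvPolynomial (Fin m ⊕ Fin 2) k) :
    H.fibA i₀ (evB r F G) = Polynomial.C (fibB k F i₀ G) := by
  have h1 : (H.fibA i₀).comp (evB r F) =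
      (IsScalarTower.toAlgHom k (Fib k m F) (Polynomial (Fib k m F))).comp (fibB k F i₀) := by
    ext j
    rcases j with i | j
    · simp [evB, fibB, xA, H.fibA_mk, fibV]
    · fin_cases j <;> simp [evB, fibB, zA, tA, H.fibA_mk, fibV]
  exact DFunLike.congr_fun h1 G

theorem Hyp.fibA_yA (H : Hyp r F g) (i₀ : Fin m) : H.fibA i₀ (yA k m r F) = Polynomial.X := by
  rw [yA, H.fibA_mk]; simp [fibV]

theorem Hyp.xA_dvd_f (H : Hyp r F g) (i₀ : Fin m) :
    xA k m r F i₀ ∣ evP r F (fOf k m F) := by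
  have h := relation (r := r) (F := F)
  rw [H.evB_F] at h
  rw [← sub_eq_iff_eq_add.2 h]
  refine dvd_sub (Dvd.dvd.mul_right ?_ _) (Dvd.dvd.mul_right ?_ _)
  · exact (dvd_pow_self _ (by have := H.hr i₀; omega)).trans
      (Finset.dvd_prod_of_mem (fun i => xA k m r F i ^ r i) (Finset.mem_univ i₀))
  · exact Finset.dvd_prod_of_mem _ (Finset.mem_univ i₀)

theorem Hyp.dvd_of_fibB_eq_zero (H : Hyp r F g) (i₀ : Fin m)
    {G : MvPolynomial (Fin m ⊕ Fin 2) k} (hG : fibB k F i₀ G = 0) :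
    xA k m r F i₀ ∣ evB r F G := by
  let I : Ideal (RingA k m r F) := Ideal.span {xA k m r F i₀}
  let σ₀ := Curve.lift (S := RingA k m r F ⧸ I) ((Ideal.Quotient.mkₐ k I).comp (evP r F))
    (Ideal.Quotient.eq_zero_iff_mem.2 (Ideal.mem_span_singleton.2 (H.xA_dvd_f i₀)))
  let σ : Fib k m F →+* RingA k m r F ⧸ I :=
    eval₂Hom σ₀.toRingHom (fun i => Ideal.Quotient.mk I (xA k m r F i))
  have h : σ.comp (fibB k F i₀).toRingHom = (Ideal.Quotient.mk I).comp (evB r F).toRingHom := by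
    apply MvPolynomial.ringHom_ext
    · intro c
      simp only [AlgHom.toRingHom_eq_coe, RingHom.comp_apply, RingHom.coe_coe, algHom_C]
      rw [IsScalarTower.algebraMap_apply k (Curve k m F) (Fib k m F), MvPolynomial.algebraMap_eq]
      simp only [σ, coe_eval₂Hom, eval₂_C, AlgHom.toRingHom_eq_coe, RingHom.coe_coe,
        AlgHom.commutes]
      rfl
    · intro j
      rcases j with i | j
      · simp only [AlgHom.toRingHom_eq_coe, RingHom.comp_apply, RingHom.coe_coe, fibB, aeval_X,
          Sum.elim_inl, evB, fibX]
        split_ifs with hi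
        · rw [map_zero, hi]
          exact (Ideal.Quotient.eq_zero_iff_mem.2 (Ideal.mem_span_singleton_self _)).symm
        · simp [σ]
      · simp only [AlgHom.toRingHom_eq_coe, RingHom.comp_apply, RingHom.coe_coe, fibB, aeval_X,
          Sum.elim_inr, evB, σ, coe_eval₂Hom, eval₂_C]
        change Ideal.Quotient.mk I (evP r F (X j)) = _
        simp [evP]
  have h2 := DFunLike.congr_fun h G
  simp only [AlgHom.toRingHom_eq_coe, RingHom.comp_apply, RingHom.coe_coe, hG, map_zero] at h2
  exact Ideal.mem_span_singleton.1 (Ideal.Quotient.eq_zero_iff_mem.1 h2.symm)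

theorem Hyp.exists_invariant_not_mem [IsDomain (RingA k m r F)] (H : Hyp r F g)
    (hp : Prime (fOf k m F)) {φ : ExpMap k (RingA k m r F)} {i₀ : Fin m}
    (hx : xA k m r F i₀ ∉ φ.invariants) : ∃ a ∈ φ.invariants, a ∉ (evB r F).range := by
  by_contra hcon
  push Not at hcon
  have hdom : IsDomain (Curve k m F) := Curve.isDomain hp
  have hinter : ∀ a ∈ φ.invariants, xA k m r F i₀ ∣ a → a = 0 := by
    rintro a ha ⟨b, rfl⟩
    by_contra hne
    exact hx (ExpMap.invariants_of_mul hne ha)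
  have hC : ∀ a ∈ φ.invariants, ∃ q, H.fibA i₀ a = Polynomial.C q ∧ (q = 0 → a = 0) := by
    intro a ha
    obtain ⟨G, rfl⟩ := hcon a ha
    exact ⟨_, H.fibA_evB i₀ G, fun h0 => hinter _ ha (H.dvd_of_fibB_eq_zero i₀ h0)⟩
  obtain ⟨s, c, hc0, hc, hs⟩ := ExpMap.exists_slice hx
  obtain ⟨c', hc', hcc⟩ := hC c hc
  have hc'0 : c' ≠ 0 := fun h => hc0 (hcc h)
  -- the image of an expansion
  have himg : ∀ b, ∃ (M : ℕ) (ρ : Polynomial (RingA k m r F)) (ρ' : Polynomial (Fib k m F)),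
      c ^ M * b = ρ.eval s ∧ (∀ i, ρ.coeff i ∈ φ.invariants) ∧
      (∀ i, ρ'.coeff i = 0 → ρ.coeff i = 0) ∧
      Polynomial.C (c' ^ M) * H.fibA i₀ b = ρ'.comp (H.fibA i₀ s) := by
    intro b
    obtain ⟨M, ρ, h1, h2⟩ := hs b
    choose q hq hq0 using fun i => hC _ (h2 i)
    have hmap : ∃ ρ' : Polynomial (Fib k m F), ∀ i, ρ'.coeff i = q i := by
      refine ⟨∑ i ∈ Finset.range (ρ.natDegree + 1), Polynomial.monomial i (q i), fun i => ?_⟩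
      rw [Polynomial.finsetSum_coeff]
      simp only [Polynomial.coeff_monomial]
      rw [Finset.sum_ite_eq']
      split_ifs with hi
      · rfl
      · have h3 := hq i
        rw [Polynomial.coeff_eq_zero_of_natDegree_lt (by simpa using hi), map_zero] at h3
        exact (Polynomial.C_eq_zero.1 h3.symm).symm
    obtain ⟨ρ', hρ'⟩ := hmap
    refine ⟨M, ρ, ρ', h1, h2, fun i hi => hq0 i ((hρ' i).symm.trans hi), ?_⟩
    have h3 := congrArg (H.fibA i₀) h1
    rw [map_mul, map_pow, hc', ← Polynomial.C_pow] at h3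
    rw [h3, Polynomial.eval_eq_sum_range, map_sum, Polynomial.comp, Polynomial.eval₂_eq_sum_range']
    · refine Finset.sum_congr rfl fun i _ => ?_
      rw [map_mul, map_pow, hq i, hρ']
    · refine Nat.lt_succ_of_le (Polynomial.natDegree_le_iff_coeff_eq_zero.2 fun i hi => ?_)
      have h3 := hq i
      rw [Polynomial.coeff_eq_zero_of_natDegree_lt hi, map_zero] at h3
      rw [hρ']; exact Polynomial.C_eq_zero.1 h3.symm
  have hdeg : 0 < (H.fibA i₀ s).natDegree := by
    obtain ⟨M, ρ, ρ', -, -, -, h⟩ := himg (yA k m r F)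
    have h4 := congrArg Polynomial.natDegree h
    rw [H.fibA_yA, Polynomial.natDegree_C_mul_X _ (pow_ne_zero _ hc'0),
      Polynomial.natDegree_comp] at h4
    exact Nat.pos_of_ne_zero fun h0 => by simp [h0] at h4
  have hP : ∀ G, evB r F G ∈ φ.invariants := by
    intro G
    obtain ⟨M, ρ, ρ', h1, h2, h3, h⟩ := himg (evB r F G)
    have h4 := congrArg Polynomial.natDegree h
    rw [H.fibA_evB, ← map_mul, Polynomial.natDegree_C, Polynomial.natDegree_comp] at h4
    have h5 : ρ'.natDegree = 0 := by
      rcases mul_eq_zero.1 h4.symm with h | h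
      · exact h
      · omega
    have h6 : ρ.natDegree = 0 := by
      refine Nat.le_zero.1 (Polynomial.natDegree_le_iff_coeff_eq_zero.2 fun i hi => h3 i ?_)
      exact Polynomial.coeff_eq_zero_of_natDegree_lt (by omega)
    rw [Polynomial.eq_C_of_natDegree_eq_zero h6, Polynomial.eval_C] at h1
    by_cases h0 : evB r F G = 0
    · rw [h0]; exact zero_mem _
    refine ExpMap.invariants_of_mul (b := c ^ M) (mul_ne_zero h0 (pow_ne_zero _ hc0)) ?_
    rw [mul_comm, h1]; exact h2 0
  refine hx ?_
  simpa [evB] using hP (X (Sum.inl i₀))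

end
end RingA

namespace Slope
variable {k D Γ : Type} [Field k] [CommRing D] [Algebra k D]
    [AddCommGroup Γ] [LinearOrder Γ] [IsOrderedAddMonoid Γ] {S : Slope k D Γ}

theorem HasDeg.of_mul_eq_zero {a b : D} (h : S.HasDeg (a * b) 0) :
    S.HasDeg a 0 ∧ S.HasDeg b 0 := by
  obtain ⟨n, hn⟩ := S.exists_hasDeg (left_ne_zero_of_mul h.ne_zero)
  obtain ⟨l, hl⟩ := S.exists_hasDeg (right_ne_zero_of_mul h.ne_zero)
  have := (hn.mul hl).unique h
  obtain ⟨rfl, rfl⟩ : n = 0 ∧ l = 0 := by omega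
  exact ⟨hn, hl⟩

theorem HasDeg.prod {ι : Type} {s : Finset ι} {a : ι → D} {n : ι → ℕ}
    (h : ∀ i ∈ s, S.HasDeg (a i) (n i)) : S.HasDeg (∏ i ∈ s, a i) (∑ i ∈ s, n i) := by
  induction s using Finset.cons_induction with
  | empty => simpa using S.hasDeg_one
  | cons b s hb ih =>
    rw [Finset.prod_cons, Finset.sum_cons]
    exact (h b (by simp)).mul (ih fun i hi => h i (by simp [hi]))

theorem hasDeg_zero_of_mem {a : D} (h0 : a ≠ 0) (h : a ∈ S.φ.invariants) : S.HasDeg a 0 := by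
  rw [ExpMap.mem_invariants] at h
  refine ⟨by rw [w_zero, ExpMap.co_zero], fun i hi => ?_⟩
  rw [h i hi, w, S.v.map_zero, WithTop.top_add]
  exact lt_top_iff_ne_top.2 (S.ne_top a h0)

end Slope

namespace RingA
section
variable {k : Type} [Field k] {m : ℕ} {r : Fin m → ℕ} {F : MvPolynomial (Fin m ⊕ Fin 2) k}
variable {g : MvPolynomial (Fin m ⊕ Fin 2) k}
variable {Γ : Type} [AddCommGroup Γ] [LinearOrder Γ] [IsOrderedAddMonoid Γ] {w : Fin m → Γ}

variable (r F w) in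
/-- The leading coefficient with respect to the weights `w`. -/
def lc (a : RingA k m r F) : MvPolynomial (Fin 2) k := (hahnA r F w a).leadingCoeff

theorem coeff_hahnA {a : RingA k m r F} {γ : Γ} (h : a ≠ 0 → val r F w a = γ) :
    (hahnA r F w a).coeff γ = lc r F w a := by
  by_cases ha : hahnA r F w a = 0
  · rw [lc, ha]; simp
  · have h' : (hahnA r F w a).orderTop = γ := h (by rintro rfl; simp at ha)
    rw [lc, HahnSeries.leadingCoeff, h']; rfl

theorem lc_mul (a b : RingA k m r F) : lc r F w (a * b) = lc r F w a * lc r F w b := by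
  by_cases h : hahnA r F w a = 0
  · simp [lc, h]
  by_cases h' : hahnA r F w b = 0
  · simp [lc, h']
  rw [lc, map_mul, HahnSeries.leadingCoeff_mul_of_ne_zero, lc, lc]
  exact mul_ne_zero (HahnSeries.leadingCoeff_ne_zero.2 h) (HahnSeries.leadingCoeff_ne_zero.2 h')

theorem lc_evP (p : MvPolynomial (Fin 2) k) : lc r F w (evP r F p) = p := by
  rw [lc, hahnA_evP]; exact HahnSeries.leadingCoeff_of_single

theorem lc_one : lc r F w 1 = 1 := by
  rw [← map_one (evP r F), lc_evP]

theorem lc_pow (a : RingA k m r F) (n : ℕ) : lc r F w (a ^ n) = lc r F w a ^ n := by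
  induction n with
  | zero => rw [pow_zero, pow_zero, lc_one]
  | succ n ih => rw [pow_succ, lc_mul, ih, pow_succ]

theorem lc_xA (i : Fin m) : lc r F w (xA k m r F i) = 1 := by
  have : hahnA r F w (xA k m r F i) = HahnSeries.single (w i) 1 := by
    rw [xA, hahnA_mk]; simp
  rw [lc, this, HahnSeries.leadingCoeff_of_single]

theorem lc_prod (α : Fin m → ℕ) (s : Finset (Fin m)) :
    lc r F w (∏ i ∈ s, xA k m r F i ^ α i) = 1 := by
  induction s using Finset.cons_induction with
  | empty => simpa using lc_one
  | cons a s ha ih => rw [Finset.prod_cons, lc_mul, lc_pow, lc_xA, ih]; simp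

theorem lc_congr {a b : RingA k m r F} (h : val r F w a < val r F w (b - a)) :
    lc r F w b = lc r F w a := by
  have := HahnSeries.leadingCoeff_add_eq_left (x := hahnA r F w a) (y := hahnA r F w (b - a)) h
  rwa [← map_add, add_sub_cancel] at this

theorem Hyp.val_evB_F_sub (H : Hyp r F g) (W : Weight w) :
    0 < val r F w (evB r F F - evP r F (fOf k m F)) := by
  rw [H.evB_F, add_sub_cancel_left, AddValuation.map_mul]
  have h1 := val_prod (r := r) (F := F) w Finset.univ (fun _ => 1)
  simp only [pow_one] at h1
  refine add_pos_of_pos_of_nonneg ?_ (val_evB_nonneg w W.pos g)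
  rw [h1]
  have hpos : 0 < ∑ i, 1 • w i := by
    have : Nonempty (Fin m) := ⟨⟨0, H.hm⟩⟩
    exact Finset.sum_pos (fun i _ => by simpa using W.pos i) Finset.univ_nonempty
  exact_mod_cast hpos

theorem Hyp.lc_yA (H : Hyp r F g) (W : Weight w) : lc r F w (yA k m r F) = fOf k m F := by
  have h := lc_congr (a := evP r F (fOf k m F)) (b := evB r F F) (w := w) (by
    rw [val_evP w H.hf]; exact H.val_evB_F_sub W)
  rwa [← relation, lc_mul, lc_prod, one_mul, lc_evP] at h

theorem Hyp.lc_term (H : Hyp r F g) (W : Weight w) (κ : (Fin m → ℕ) × ℕ)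
    (p : MvPolynomial (Fin 2) k) : lc r F w (term r F κ p) = p * fOf k m F ^ κ.2 := by
  rw [term, lc_mul, lc_mul, lc_evP, lc_prod, lc_pow, H.lc_yA W, one_mul]

/-- The exponents of the monomial with index `κ` after elimination of `y`. -/
def ex (r : Fin m → ℕ) (κ : (Fin m → ℕ) × ℕ) (i : Fin m) : ℤ := (κ.1 i : ℤ) - κ.2 * r i

/-- The weight of an integral exponent vector. -/
def ws (w : Fin m → Γ) : (Fin m → ℤ) →+ Γ where
  toFun β := ∑ i, β i • w i
  map_zero' := by simp
  map_add' := by intro a b; simp [add_smul, Finset.sum_add_distrib]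

theorem wt_eq_ws (κ : (Fin m → ℕ) × ℕ) : wt r w κ = ws w (ex r κ) := rfl

theorem Weight.ws_injective (W : Weight w) : Function.Injective (ws w) :=
  (injective_iff_map_eq_zero _).2 W.inj

theorem ws_single (i : Fin m) : ws w (Pi.single i 1) = w i := by
  change ∑ j, (Pi.single i 1 : Fin m → ℤ) j • w j = w i
  rw [Finset.sum_eq_single i]
  · simp
  · intro j _ hj; simp [hj]
  · simp

variable {S : Slope k (RingA k m r F) Γ}

theorem Hyp.lead (H : Hyp r F g) (W : Weight w) (hv : S.v = val r F w) {a : RingA k m r F} {n : ℕ}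
    (h : S.HasDeg a n) : ∃ κ p, p ≠ 0 ∧ val r F w a = (ws w (ex r κ) : Γ) ∧
      lc r F w a = p * fOf k m F ^ κ.2 ∧ S.HasDeg (term r F κ p) n := by
  obtain ⟨q, rfl⟩ := nf_surjective a
  have hq : q ≠ 0 := by rintro rfl; exact h.ne_zero (map_zero _)
  obtain ⟨κ, hκ, h1, h2, -⟩ := H.exists_min W hq
  refine ⟨κ.1, q κ, Finsupp.mem_support_iff.1 hκ, h1, ?_, (h.congr (by rw [hv]; exact h2)).2⟩
  rw [← H.lc_term W, lc_congr h2]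

theorem evP_ne_zero {p : MvPolynomial (Fin 2) k} (hp : p ≠ 0) : evP r F p ≠ 0 := by
  intro h
  have := val_evP (r := r) (F := F) (fun _ => (0 : ℤ)) hp
  rw [h, AddValuation.map_zero] at this
  exact WithTop.top_ne_zero this

theorem Hyp.xA_ne_zero (H : Hyp r F g) (W : Weight w) (i : Fin m) : xA k m r F i ≠ 0 :=
  H.gen_ne_zero W (Sum.inl i)

theorem hasDeg_of_term {κ : (Fin m → ℕ) × ℕ} {p : MvPolynomial (Fin 2) k}
    (h : S.HasDeg (term r F κ p) 0) :
    S.HasDeg (evP r F p) 0 ∧ (∀ i, κ.1 i ≠ 0 → S.HasDeg (xA k m r F i) 0) ∧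
      (κ.2 ≠ 0 → S.HasDeg (yA k m r F) 0) := by
  obtain ⟨h1, h2⟩ := Slope.HasDeg.of_mul_eq_zero h
  obtain ⟨h2, h3⟩ := h2.of_mul_eq_zero
  refine ⟨h1, fun i hi => ?_, fun hn => ?_⟩
  · rw [← Finset.mul_prod_erase _ _ (Finset.mem_univ i)] at h2
    have := h2.of_mul_eq_zero.1
    obtain ⟨l, hl⟩ := Nat.exists_eq_succ_of_ne_zero hi
    rw [hl, pow_succ] at this
    exact this.of_mul_eq_zero.2
  · obtain ⟨l, hl⟩ := Nat.exists_eq_succ_of_ne_zero hn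
    rw [hl, pow_succ] at h3
    exact h3.of_mul_eq_zero.2

theorem Hyp.expand (H : Hyp r F g) (W : Weight w) (hv : S.v = val r F w) {d : ℕ}
    (hd : S.IsMinDeg d) {s : RingA k m r F} (hs : S.HasDeg s d) {σ : Fin m → ℤ}
    (hσ : val r F w s = (ws w σ : Γ)) :
    ∃ κc pc, pc ≠ 0 ∧ S.HasDeg (term r F κc pc) 0 ∧ ∀ (a : RingA k m r F) (β : Fin m → ℤ), a ≠ 0 →
      val r F w a = (ws w β : Γ) → ∃ (M N : ℕ) (κ : ℕ → (Fin m → ℕ) × ℕ)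
        (p : ℕ → MvPolynomial (Fin 2) k),
        (∀ l, p l = 0 ∨ (S.HasDeg (term r F (κ l) (p l)) 0 ∧
          ex r (κ l) + l • σ = M • ex r κc + β)) ∧
        (pc * fOf k m F ^ κc.2) ^ M * lc r F w a =
          ∑ l ∈ Finset.range N, p l * fOf k m F ^ (κ l).2 * lc r F w s ^ l := by
  classical
  obtain ⟨κc, pc, hpc, hvc, hlc, hdc⟩ := H.lead W hv hs.top
  refine ⟨κc, pc, hpc, hdc, fun a β ha hβ => ?_⟩
  obtain ⟨n, hn⟩ := S.exists_hasDeg ha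
  obtain ⟨e, rfl⟩ := hd.dvd hn
  rw [mul_comm] at hn
  obtain ⟨M, ρ, b, h1, h2, -, h4⟩ := hs.expansion hd e a hn
  rw [hv] at h2 h4
  have hva : val r F w (S.φ.co d s ^ M * a) = (ws w (M • ex r κc + β) : Γ) := by
    rw [AddValuation.map_mul, AddValuation.map_pow, hvc, hβ, map_add, map_nsmul]; rfl
  have hlead : ∀ l, ∃ κ p, (p = 0 ∨ (S.HasDeg (term r F κ p) 0 ∧
      ex r κ + l • σ = M • ex r κc + β)) ∧ lc r F w (ρ.coeff l) = p * fOf k m F ^ κ.2 := by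
    intro l
    rcases h4 l with h | ⟨h, h'⟩
    · refine ⟨0, 0, Or.inl rfl, ?_⟩
      rw [h, lc, map_zero, HahnSeries.leadingCoeff_zero, zero_mul]
    · obtain ⟨κ, p, -, h5, h6, h7⟩ := H.lead W hv h
      refine ⟨κ, p, Or.inr ⟨h7, W.ws_injective ?_⟩, h6⟩
      rw [hva, AddValuation.map_mul, AddValuation.map_pow, h5, hσ] at h'
      rw [map_add, map_nsmul]
      exact_mod_cast h'
  choose κ p hp hlcρ using hlead
  refine ⟨M, ρ.natDegree + 1, κ, p, hp, ?_⟩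
  have hcoeff := congrArg (fun a => (hahnA r F w a).coeff (ws w (M • ex r κc + β))) h1
  rw [coeff_hahnA (fun _ => hva), lc_mul, lc_pow, hlc, map_add, HahnSeries.coeff_add,
    HahnSeries.coeff_eq_zero_of_lt_orderTop (x := hahnA r F w b) (by rw [← hva]; exact h2),
    add_zero, Polynomial.eval_eq_sum_range, map_sum, HahnSeries.coeff_sum] at hcoeff
  rw [hcoeff]
  refine Finset.sum_congr rfl fun l _ => ?_
  rw [coeff_hahnA, lc_mul, lc_pow, hlcρ]
  intro hne
  rcases h4 l with h | ⟨-, h⟩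
  · simp [h] at hne
  · rw [h, hva]

end
end RingA

/-- A factorially closed subalgebra of `k[Z,T]` over which `k[Z,T]` becomes, after inverting
an element, a polynomial ring in one variable. -/
structure PlaneData {k : Type} [Field k] (f : MvPolynomial (Fin 2) k) where
  H : Subalgebra k (MvPolynomial (Fin 2) k)
  s : MvPolynomial (Fin 2) k
  q : MvPolynomial (Fin 2) k
  mem_of_mul : ∀ a b, a * b ≠ 0 → a * b ∈ H → a ∈ H
  transc : ∀ ρ : Polynomial (MvPolynomial (Fin 2) k), (∀ i, ρ.coeff i ∈ H) → ρ.eval s = 0 → ρ = 0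
  q_ne : q ≠ 0
  q_mem : q ∈ H
  q_mul : ∀ j, ∃ ρ : Polynomial (MvPolynomial (Fin 2) k),
    (∀ i, ρ.coeff i ∈ H) ∧ q * X j = ρ.eval s
  f_mem : f ∈ H ∨ s = f

namespace RingA
section
variable {k : Type} [Field k] {m : ℕ} {r : Fin m → ℕ} {F : MvPolynomial (Fin m ⊕ Fin 2) k}
variable {g : MvPolynomial (Fin m ⊕ Fin 2) k}
variable {Γ : Type} [AddCommGroup Γ] [LinearOrder Γ] [IsOrderedAddMonoid Γ] {w : Fin m → Γ}
variable {S : Slope k (RingA k m r F) Γ}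

theorem leAt_evP (hv : S.v = val r F w) {p : MvPolynomial (Fin 2) k} :
    S.LeAt 0 (evP r F p) 0 ↔ (p ≠ 0 → S.HasDeg (evP r F p) 0) := by
  constructor
  · intro h hp
    obtain ⟨n, hn⟩ := S.exists_hasDeg (evP_ne_zero (r := r) (F := F) hp)
    have := hn.le_of_leAt (m := 0) (by rwa [hv, val_evP w hp])
    obtain rfl : n = 0 := by omega
    exact hn
  · intro h
    by_cases hp : p = 0
    · rw [hp, map_zero]
      exact Slope.LeAt.of_lt (by rw [S.v.map_zero]; exact WithTop.coe_lt_top 0) 0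
    · have := (h hp).leAt le_rfl
      rwa [hv, val_evP w hp] at this

/-- The polynomials in `z, t` of degree zero. -/
def invP (S : Slope k (RingA k m r F) Γ) (hv : S.v = val r F w) :
    Subalgebra k (MvPolynomial (Fin 2) k) where
  carrier := {p | S.LeAt 0 (evP r F p) 0}
  mul_mem' := by
    intro a b ha hb
    rw [Set.mem_ofPred_eq, leAt_evP hv] at *
    intro hab
    rw [map_mul]
    exact (ha (left_ne_zero_of_mul hab)).mul (hb (right_ne_zero_of_mul hab))
  add_mem' := by
    intro a b ha hb
    rw [Set.mem_ofPred_eq, map_add]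
    exact Slope.LeAt.add ha hb
  algebraMap_mem' := by
    intro c
    rw [Set.mem_ofPred_eq, leAt_evP hv]
    intro hc
    rw [AlgHom.commutes]
    exact S.hasDeg_algebraMap (by rintro rfl; simp at hc)

theorem mem_invP (hv : S.v = val r F w) {p : MvPolynomial (Fin 2) k} :
    p ∈ invP S hv ↔ (p ≠ 0 → S.HasDeg (evP r F p) 0) := leAt_evP hv

theorem invP_transc (hv : S.v = val r F w) {s : MvPolynomial (Fin 2) k} {n : ℕ} (hn : 0 < n)
    (hs : S.HasDeg (evP r F s) n) (ρ : Polynomial (MvPolynomial (Fin 2) k))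
    (hρ : ∀ i, ρ.coeff i ∈ invP S hv) (h : ρ.eval s = 0) : ρ = 0 := by
  by_contra h0
  have hs0 : s ≠ 0 := by rintro rfl; exact hs.ne_zero (map_zero _)
  have hval : ∀ i, ρ.coeff i ≠ 0 → S.HasDeg (evP r F (ρ.coeff i * s ^ i)) (i * n) := by
    intro i hi
    rw [map_mul, map_pow]
    simpa using ((mem_invP hv).1 (hρ i) hi).mul (hs.pow i)
  have hlc : ρ.coeff ρ.natDegree ≠ 0 := by simpa using h0
  have htop := hval _ hlc
  have hv0 : S.v (evP r F (ρ.coeff ρ.natDegree * s ^ ρ.natDegree)) = 0 := by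
    rw [hv, val_evP w (mul_ne_zero hlc (pow_ne_zero _ hs0))]
  have hsum : evP r F (ρ.coeff ρ.natDegree * s ^ ρ.natDegree) +
      ∑ i ∈ Finset.range ρ.natDegree, evP r F (ρ.coeff i * s ^ i) = 0 := by
    rw [← map_sum, ← map_add, add_comm, ← Finset.sum_range_succ, ← Polynomial.eval_eq_sum_range, h,
      map_zero]
  rcases Nat.eq_zero_or_pos ρ.natDegree with hd | hd
  · rw [hd] at hsum hlc
    simp only [pow_zero, mul_one, Finset.range_zero, Finset.sum_empty, add_zero] at hsum
    exact evP_ne_zero hlc hsum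
  · refine (htop.add_leAt (m := (ρ.natDegree - 1) * n) ?_ ?_ ?_).2.ne_zero hsum
    · rw [hv0, hv]
      rw [← map_sum]
      exact val_evP_nonneg w _
    · exact Nat.mul_lt_mul_of_pos_right (by omega) hn
    · rw [hv0]
      refine Slope.LeAt.sum WithTop.zero_ne_top fun i hi => ?_
      by_cases hi0 : ρ.coeff i = 0
      · rw [hi0, zero_mul, map_zero]
        exact Slope.LeAt.of_lt (by rw [S.v.map_zero]; exact WithTop.coe_lt_top 0) _
      · have := (hval i hi0).leAt
          (Nat.mul_le_mul_right n (show i ≤ ρ.natDegree - 1 by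
            have := Finset.mem_range.1 hi; omega))
        rwa [hv, val_evP w (mul_ne_zero hi0 (pow_ne_zero _ hs0))] at this

/-- Assembling `PlaneData` from the ring of polynomials of degree zero. -/
def planeData (hv : S.v = val r F w) {s : MvPolynomial (Fin 2) k} {n : ℕ} (hn : 0 < n)
    (hs : S.HasDeg (evP r F s) n) (q : MvPolynomial (Fin 2) k) (hq : q ≠ 0) (hq' : q ∈ invP S hv)
    (hqm : ∀ j, ∃ ρ : Polynomial (MvPolynomial (Fin 2) k),
      (∀ i, ρ.coeff i ∈ invP S hv) ∧ q * X j = ρ.eval s)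
    (hf : fOf k m F ∈ invP S hv ∨ s = fOf k m F) : PlaneData (fOf k m F) where
  H := invP S hv
  s := s
  q := q
  mem_of_mul a b hab h := by
    rw [mem_invP hv] at *
    intro _
    have := h hab
    rw [map_mul] at this
    exact this.of_mul_eq_zero.1
  transc := invP_transc hv hn hs
  q_ne := hq
  q_mem := hq'
  q_mul := hqm
  f_mem := hf

/-- Clearing two denominators at once. -/
theorem exists_common {H : Subalgebra k (MvPolynomial (Fin 2) k)} {s : MvPolynomial (Fin 2) k}
    (h : ∀ u : MvPolynomial (Fin 2) k, ∃ q ∈ H, q ≠ 0 ∧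
      ∃ ρ : Polynomial (MvPolynomial (Fin 2) k), (∀ i, ρ.coeff i ∈ H) ∧ q * u = ρ.eval s) :
    ∃ q ∈ H, q ≠ 0 ∧ ∀ j : Fin 2, ∃ ρ : Polynomial (MvPolynomial (Fin 2) k),
      (∀ i, ρ.coeff i ∈ H) ∧ q * X j = ρ.eval s := by
  choose q hq hq0 ρ hρ he using h
  refine ⟨q (X 0) * q (X 1), mul_mem (hq _) (hq _), mul_ne_zero (hq0 _) (hq0 _), fun j => ?_⟩
  have key : ∀ c ∈ H, ∀ j : Fin 2, ∃ ρ : Polynomial (MvPolynomial (Fin 2) k),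
      (∀ i, ρ.coeff i ∈ H) ∧ c * (q (X j) * X j) = ρ.eval s := fun c hc j =>
    ⟨Polynomial.C c * ρ (X j), fun i => by
      rw [Polynomial.coeff_C_mul]; exact mul_mem hc (hρ _ i), by
      rw [Polynomial.eval_mul, Polynomial.eval_C, he]⟩
  fin_cases j
  · obtain ⟨ρ', h1, h2⟩ := key (q (X 1)) (hq _) 0
    exact ⟨ρ', h1, by rw [← h2]; simp only [Fin.zero_eta]; ring⟩
  · obtain ⟨ρ', h1, h2⟩ := key (q (X 0)) (hq _) 1
    exact ⟨ρ', h1, by rw [← h2]; simp only [Fin.mk_one]; ring⟩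

/-- Sums of powers of `s` with coefficients in `H`. -/
theorem exists_poly {H : Subalgebra k (MvPolynomial (Fin 2) k)} (s : MvPolynomial (Fin 2) k)
    (T : Finset ℕ) (c : ℕ → MvPolynomial (Fin 2) k) (e : ℕ → ℕ) (hc : ∀ l, c l ∈ H) :
    ∃ ρ : Polynomial (MvPolynomial (Fin 2) k), (∀ i, ρ.coeff i ∈ H) ∧
      ∑ l ∈ T, c l * s ^ e l = ρ.eval s := by
  refine ⟨∑ l ∈ T, Polynomial.monomial (e l) (c l), fun i => ?_, ?_⟩
  · rw [Polynomial.finsetSum_coeff]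
    refine sum_mem fun l _ => ?_
    rw [Polynomial.coeff_monomial]
    split_ifs
    exacts [hc l, zero_mem _]
  · simp [Polynomial.eval_finsetSum]

theorem val_xA_ws (j : Fin m) :
    val r F w (xA k m r F j) = ((ws w (Pi.single j 1) : Γ) : WithTop Γ) := by
  rw [val_xA, ws_single]

theorem Hyp.fOf_hasDeg (H : Hyp r F g) (W : Weight w) (hv : S.v = val r F w) {n : ℕ}
    (h : S.HasDeg (∏ i, xA k m r F i ^ r i) n) (hy : S.HasDeg (yA k m r F) 0) :
    S.HasDeg (evP r F (fOf k m F)) n := by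
  have h1 := h.mul hy
  rw [relation, add_zero] at h1
  refine (h1.congr ?_).2
  rw [hv, H.val_evB_F W.pos, AddValuation.map_sub_swap]
  exact H.val_evB_F_sub W

theorem Hyp.planeData_of_min_evP (H : Hyp r F g) (W : Weight w) (hv : S.v = val r F w)
    (hy : S.HasDeg (yA k m r F) 0) {d : ℕ} (hd : S.IsMinDeg d) {s : MvPolynomial (Fin 2) k}
    (hs : S.HasDeg (evP r F s) d) : Nonempty (PlaneData (fOf k m F)) := by
  have hs0 : s ≠ 0 := by rintro rfl; exact hs.ne_zero (map_zero _)
  obtain ⟨κc, pc, hpc, hdc, hex⟩ := H.expand W hv hd hs (σ := 0) (by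
    rw [val_evP w hs0, map_zero]; rfl)
  rw [lc_evP] at hex
  have hlc0 : ∀ M, (pc * fOf k m F ^ κc.2) ^ M ≠ 0 := fun M =>
    pow_ne_zero _ (mul_ne_zero hpc (pow_ne_zero _ H.hf))
  have hx : ∀ j, S.HasDeg (xA k m r F j) 0 := by
    intro j
    by_contra hj
    obtain ⟨M, N, κ, p, h1, h2⟩ := hex (xA k m r F j) (Pi.single j 1) (H.xA_ne_zero W j)
      (val_xA_ws j)
    have hne := mul_ne_zero (hlc0 M) (by rw [lc_xA]; exact one_ne_zero :
      lc r F w (xA k m r F j) ≠ 0)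
    rw [h2] at hne
    obtain ⟨l, -, hl⟩ := Finset.exists_ne_zero_of_sum_ne_zero hne
    rcases h1 l with h | ⟨h, h'⟩
    · simp [h] at hl
    have e1 : (κ l).1 j = 0 := by
      by_contra hc; exact hj ((hasDeg_of_term h).2.1 j hc)
    have e2 : κc.1 j = 0 := by
      by_contra hc; exact hj ((hasDeg_of_term hdc).2.1 j hc)
    have h3 := congrFun h' j
    simp only [ex, Pi.add_apply, Pi.smul_apply, e1, e2, Pi.single_eq_same, Pi.zero_apply,
      smul_zero, Nat.cast_zero, zero_sub, add_zero] at h3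
    simp only [nsmul_eq_mul] at h3
    have h4 : (r j : ℤ) ∣ 1 := ⟨M * κc.2 - (κ l).2, by linear_combination -h3⟩
    have h5 := Int.le_of_dvd one_pos h4
    have := H.hr j
    omega
  have hf : fOf k m F ∈ invP S hv := by
    rw [mem_invP]
    intro _
    refine H.fOf_hasDeg W hv ?_ hy
    simpa using Slope.HasDeg.prod (s := Finset.univ) (n := fun _ => 0)
      (fun i _ => by simpa using (hx i).pow (r i))
  have hp : ∀ {κ p}, S.HasDeg (term r F κ p) 0 → p ∈ invP S hv := fun h =>
    (mem_invP hv).2 fun _ => (hasDeg_of_term h).1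
  obtain ⟨q, hq, hq0, hqm⟩ := exists_common (H := invP S hv) (s := s) (fun u => by
    by_cases hu : u = 0
    · exact ⟨1, one_mem _, one_ne_zero, 0, by simp, by simp [hu]⟩
    obtain ⟨M, N, κ, p, h1, h2⟩ := hex (evP r F u) 0 (evP_ne_zero hu) (by
      rw [val_evP w hu, map_zero]; rfl)
    refine ⟨_, pow_mem (mul_mem (hp hdc) (pow_mem hf _)) M, hlc0 M, ?_⟩
    rw [lc_evP] at h2
    rw [h2]
    refine exists_poly s _ (fun l => p l * fOf k m F ^ (κ l).2) (fun l => l) fun l => ?_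
    rcases h1 l with h | ⟨h, -⟩
    · simp [h]
    · exact mul_mem (hp h) (pow_mem hf _))
  exact ⟨planeData hv hd.1 hs q hq0 hq hqm (Or.inl hf)⟩

theorem Hyp.planeData_of_min_xA (H : Hyp r F g) (W : Weight w) (hv : S.v = val r F w)
    (hy : S.HasDeg (yA k m r F) 0) {d : ℕ} (hd : S.IsMinDeg d) {j : Fin m}
    (hs : S.HasDeg (xA k m r F j) d) : Nonempty (PlaneData (fOf k m F)) := by
  obtain ⟨κc, pc, hpc, hdc, hex⟩ := H.expand W hv hd hs (val_xA_ws j)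
  have hj : ¬ S.HasDeg (xA k m r F j) 0 := fun h => hd.1.ne' (hs.unique h)
  have hlc0 : ∀ M, (pc * fOf k m F ^ κc.2) ^ M ≠ 0 := fun M =>
    pow_ne_zero _ (mul_ne_zero hpc (pow_ne_zero _ H.hf))
  have hα : ∀ {i κ p}, ¬ S.HasDeg (xA k m r F i) 0 → S.HasDeg (term r F κ p) 0 → κ.1 i = 0 := by
    intro i κ p hi h
    by_contra hc; exact hi ((hasDeg_of_term h).2.1 i hc)
  have hx : ∀ i, i ≠ j → S.HasDeg (xA k m r F i) 0 := by
    intro i hij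
    by_contra hi
    obtain ⟨M, N, κ, p, h1, h2⟩ := hex (xA k m r F i) (Pi.single i 1) (H.xA_ne_zero W i)
      (val_xA_ws i)
    have hne := mul_ne_zero (hlc0 M) (by rw [lc_xA]; exact one_ne_zero :
      lc r F w (xA k m r F i) ≠ 0)
    rw [h2] at hne
    obtain ⟨l, -, hl⟩ := Finset.exists_ne_zero_of_sum_ne_zero hne
    rcases h1 l with h | ⟨h, h'⟩
    · simp [h] at hl
    have h3 := congrFun h' i
    simp only [ex, Pi.add_apply, Pi.smul_apply, hα hi h, hα hi hdc, Pi.single_eq_same,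
      Pi.single_eq_of_ne hij, smul_zero, Nat.cast_zero, zero_sub, add_zero] at h3
    simp only [nsmul_eq_mul] at h3
    have h4 : (r i : ℤ) ∣ 1 := ⟨M * κc.2 - (κ l).2, by linear_combination -h3⟩
    have h5 := Int.le_of_dvd one_pos h4
    have := H.hr i
    omega
  have hrj : 0 < r j := by have := H.hr j; omega
  have hfdeg : S.HasDeg (evP r F (fOf k m F)) (r j * d) := by
    refine H.fOf_hasDeg W hv ?_ hy
    have := Slope.HasDeg.prod (S := S) (s := Finset.univ) (a := fun i => xA k m r F i ^ r i)
      (n := fun i => if i = j then r j * d else 0) (fun i _ => by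
        split_ifs with hi
        · subst hi; exact hs.pow _
        · simpa using (hx i hi).pow (r i))
    simpa using this
  have hp : ∀ {κ p}, S.HasDeg (term r F κ p) 0 → p ∈ invP S hv := fun h =>
    (mem_invP hv).2 fun _ => (hasDeg_of_term h).1
  obtain ⟨q, hq, hq0, hqm⟩ := exists_common (H := invP S hv) (s := fOf k m F) (fun u => by
    by_cases hu : u = 0
    · exact ⟨1, one_mem _, one_ne_zero, 0, by simp, by simp [hu]⟩
    obtain ⟨M, N, κ, p, h1, h2⟩ := hex (evP r F u) 0 (evP_ne_zero hu) (by
      rw [val_evP w hu, map_zero]; rfl)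
    refine ⟨_, pow_mem (hp hdc) M, pow_ne_zero _ hpc, ?_⟩
    rw [lc_evP, lc_xA] at h2
    have hnl : ∀ l, ∃ p' ∈ invP S hv, ∃ e, p l * fOf k m F ^ (κ l).2 * 1 ^ l =
        fOf k m F ^ (M * κc.2) * (p' * fOf k m F ^ e) := by
      intro l
      rcases h1 l with h | ⟨h, h'⟩
      · exact ⟨0, zero_mem _, 0, by simp [h]⟩
      have h3 := congrFun h' j
      simp only [ex, Pi.add_apply, Pi.smul_apply, hα hj h, hα hj hdc, Pi.single_eq_same,
        Pi.zero_apply, Nat.cast_zero, zero_sub, add_zero] at h3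
      simp only [nsmul_eq_mul, mul_one] at h3
      have h4 : M * κc.2 ≤ (κ l).2 := by
        by_contra hlt
        push Not at hlt
        have h5 : ((κ l).2 : ℤ) * r j < (M * κc.2 : ℤ) * r j := by
          have h6 : ((κ l).2 : ℤ) < (M * κc.2 : ℤ) := by exact_mod_cast hlt
          exact mul_lt_mul_of_pos_right h6 (by exact_mod_cast hrj)
        have : (0 : ℤ) ≤ l := by positivity
        linarith
      obtain ⟨e, he⟩ := Nat.exists_eq_add_of_le h4
      exact ⟨p l, hp h, e, by rw [he, pow_add]; ring⟩
    choose p' hp' e he using hnl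
    obtain ⟨ρ, h3, h4⟩ := exists_poly (fOf k m F) (Finset.range N) p' e hp'
    refine ⟨ρ, h3, ?_⟩
    rw [← h4]
    refine mul_left_cancel₀ (pow_ne_zero (M * κc.2) H.hf) ?_
    rw [Finset.mul_sum, ← Finset.sum_congr rfl fun l _ => he l, ← h2]
    ring)
  exact ⟨planeData hv (Nat.mul_pos hrj hd.1) hfdeg q hq0 hq hqm (Or.inr rfl)⟩

theorem Hyp.exists_planeData (H : Hyp r F g) (W : Weight w) (hv : S.v = val r F w)
    (hy : S.HasDeg (yA k m r F) 0) {a : RingA k m r F} {n : ℕ} (ha : S.HasDeg a n) (hn : 0 < n) :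
    Nonempty (PlaneData (fOf k m F)) := by
  obtain ⟨d, hd⟩ := Slope.exists_isMinDeg ha hn
  by_cases hP : ∃ p, S.HasDeg (evP r F p) d
  · obtain ⟨p, hp⟩ := hP
    exact H.planeData_of_min_evP W hv hy hd hp
  by_cases hX : ∃ j, S.HasDeg (xA k m r F j) d
  · obtain ⟨j, hj⟩ := hX
    exact H.planeData_of_min_xA W hv hy hd hj
  exfalso
  push Not at hP hX
  obtain ⟨b, hb⟩ := hd.2.1
  obtain ⟨κ, p, hp, -, -, h⟩ := H.lead W hv hb
  obtain ⟨e, he⟩ := S.exists_hasDeg (evP_ne_zero (r := r) (F := F) hp)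
  choose ε hε using fun i => S.exists_hasDeg (H.xA_ne_zero W i)
  have h1 := (he.mul ((Slope.HasDeg.prod (s := Finset.univ) fun i _ => (hε i).pow (κ.1 i)).mul
    (hy.pow κ.2))).unique h
  rw [mul_zero, add_zero] at h1
  have hlt : ∀ {c l}, S.HasDeg c l → l ≠ d → l = 0 ∨ d < l := by
    intro c l hc hl
    rcases Nat.eq_zero_or_pos l with h | h
    · exact Or.inl h
    · exact Or.inr (lt_of_le_of_ne (hd.2.2 c l hc h) hl.symm)
  rcases hlt he (fun h => hP p (h ▸ he)) with h0 | h0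
  · rw [h0, zero_add] at h1
    have hsum : ∑ i, κ.1 i * ε i ≠ 0 := by rw [h1]; exact hd.1.ne'
    obtain ⟨i, -, hi⟩ := Finset.exists_ne_zero_of_sum_ne_zero hsum
    have h2 : κ.1 i * ε i ≤ d := h1 ▸ Finset.single_le_sum
      (f := fun i => κ.1 i * ε i) (fun _ _ => Nat.zero_le _) (Finset.mem_univ i)
    have h3 : 1 ≤ κ.1 i := Nat.one_le_iff_ne_zero.2 (left_ne_zero_of_mul hi)
    rcases hlt (hε i) (fun h => hX i (h ▸ hε i)) with h4 | h4
    · simp [h4] at hi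
    · nlinarith
  · omega

end
end RingA

namespace RingA
section
variable {k : Type} [Field k] {m : ℕ} {r : Fin m → ℕ} {F : MvPolynomial (Fin m ⊕ Fin 2) k}
variable {g : MvPolynomial (Fin m ⊕ Fin 2) k}

/-- Lexicographic weights in which the variable `σ.symm 0` dominates. -/
def lexWeight (σ : Equiv.Perm (Fin m)) (i : Fin m) : Lex (Fin m → ℚ) := toLex (Pi.single (σ i) 1)

theorem ws_lexWeight (σ : Equiv.Perm (Fin m)) (β : Fin m → ℤ) (i : Fin m) :
    ofLex (ws (lexWeight σ) β) (σ i) = β i := by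
  have h : ∀ s : Finset (Fin m), ofLex (∑ j ∈ s, β j • lexWeight σ j) (σ i) =
      ∑ j ∈ s, if j = i then (β j : ℚ) else 0 := by
    classical
    intro s
    induction s using Finset.induction_on with
    | empty => rfl
    | insert a s ha ih =>
      rw [Finset.sum_insert ha, Finset.sum_insert ha, ← ih]
      change ofLex (β a • lexWeight σ a) (σ i) + _ = _
      congr 1
      change β a • (Pi.single (σ a) (1 : ℚ) : Fin m → ℚ) (σ i) = _
      by_cases hai : a = i
      · simp [hai]
      · rw [Pi.single_eq_of_ne (fun h => hai (σ.injective h).symm)]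
        simp [hai]
  have := h Finset.univ
  simpa [ws] using this

theorem weight_lexWeight (σ : Equiv.Perm (Fin m)) : Weight (lexWeight σ) where
  pos i := by
    refine ⟨σ i, fun j hj => ?_, ?_⟩
    · change (0 : ℚ) = (Pi.single (σ i) (1 : ℚ) : Fin m → ℚ) j
      rw [Pi.single_eq_of_ne hj.ne]
    · change (0 : ℚ) < (Pi.single (σ i) (1 : ℚ) : Fin m → ℚ) (σ i)
      simp
  inj β h := by
    funext i
    have h1 := ws_lexWeight σ β i
    rw [show ws (lexWeight σ) β = 0 from h] at h1
    have : (0 : ℚ) = β i := h1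
    exact_mod_cast this.symm

theorem lex_apply_le {a b : Lex (Fin m → ℚ)} (i : Fin m) (hi : i.val = 0) (h : a ≤ b) :
    ofLex a i ≤ ofLex b i := by
  rcases h.eq_or_lt with rfl | ⟨j, h1, h2⟩
  · exact le_rfl
  · by_cases hj : j = i
    · subst hj; exact h2.le
    · exact (h1 i (by
        change i < j
        rw [Fin.lt_def, hi]
        exact Nat.pos_of_ne_zero fun h => hj (Fin.ext (h.trans hi.symm)))).le

/-- A trivial Makar-Limanov invariant forces the curve `f` to be prime-compatible plane data. -/
theorem Hyp.exists_planeData_of_ml [IsDomain (RingA k m r F)] (H : Hyp r F g)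
    (hp : Prime (fOf k m F)) (hml : MakarLimanov k (RingA k m r F) = ⊥) :
    Nonempty (PlaneData (fOf k m F)) := by
  let z₀ : Fin m := ⟨0, H.hm⟩
  have W1 := weight_lexWeight (Equiv.refl (Fin m))
  obtain ⟨φ, hφ⟩ : ∃ φ : ExpMap k (RingA k m r F), xA k m r F z₀ ∉ φ.invariants := by
    by_contra hcon
    push Not at hcon
    have h1 : xA k m r F z₀ ∈ MakarLimanov k (RingA k m r F) := by
      rw [MakarLimanov, Algebra.mem_iInf]; exact hcon
    rw [hml, Algebra.mem_bot] at h1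
    obtain ⟨c, hc⟩ := h1
    have h2 := val_xA (r := r) (F := F) (lexWeight (Equiv.refl (Fin m))) z₀
    have hc0 : c ≠ 0 := by
      rintro rfl
      exact H.xA_ne_zero W1 z₀ (by rw [← hc, map_zero])
    rw [← hc, val_algebraMap _ hc0] at h2
    have h3 := W1.pos z₀
    rw [← WithTop.coe_zero, WithTop.coe_inj] at h2
    exact h3.ne h2
  obtain ⟨a, ha, haB⟩ := H.exists_invariant_not_mem hp hφ
  obtain ⟨q, rfl⟩ := nf_surjective a
  obtain ⟨κ, hκ, hκ2⟩ : ∃ κ ∈ q.support, κ.1.2 ≠ 0 := by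
    by_contra hcon
    push Not at hcon
    refine haB ?_
    rw [nf_apply]
    refine sum_mem fun κ hκ => ?_
    rw [term, hcon κ hκ, pow_zero, mul_one]
    have hx : ∀ i, xA k m r F i ∈ (evB r F).range := fun i => ⟨X (Sum.inl i), by simp [evB]⟩
    exact mul_mem ⟨rename Sum.inr (q κ), evB_rename_inr _⟩
      (prod_mem fun i _ => pow_mem (hx i) _)
  obtain ⟨j₀, hj₀⟩ : ∃ i, κ.1.1 i < r i := κ.2.resolve_left hκ2
  let σ := Equiv.swap j₀ z₀
  have W := weight_lexWeight σ
  have hσ : σ j₀ = z₀ := Equiv.swap_apply_left _ _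
  have hq : q ≠ 0 := by rintro rfl; simp at hκ
  obtain ⟨κ', hκ', hval, hlt, hmin⟩ := H.exists_min W hq
  have h1 := lex_apply_le z₀ rfl (hmin κ hκ)
  rw [wt_eq_ws, wt_eq_ws, ← hσ, ws_lexWeight, ws_lexWeight] at h1
  have h2 : ex r κ'.1 j₀ ≤ ex r κ.1 j₀ := by exact_mod_cast h1
  have h3 : κ'.1.2 ≠ 0 := by
    intro h0
    have h4 : (r j₀ : ℤ) ≤ κ.1.2 * r j₀ := by
      have : 1 ≤ κ.1.2 := Nat.one_le_iff_ne_zero.2 hκ2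
      exact_mod_cast Nat.le_mul_of_pos_left _ this
    have h5 : (κ.1.1 j₀ : ℤ) < r j₀ := by exact_mod_cast hj₀
    simp only [ex, h0] at h2
    simp only [Nat.cast_zero, zero_mul, sub_zero] at h2
    omega
  obtain ⟨S, hSφ, hSv, s, n, hn, hs⟩ := H.exists_slope W φ ⟨Sum.inl z₀, hφ⟩
  have ha0 : nf r F q ≠ 0 := by
    intro h0; exact haB (h0 ▸ zero_mem _)
  have hd := Slope.hasDeg_zero_of_mem ha0 (by rwa [hSφ] : nf r F q ∈ S.φ.invariants)
  have hd' := (hd.congr (by rw [hSv]; exact hlt)).2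
  exact H.exists_planeData W hSv ((hasDeg_of_term hd').2.2 h3) hs hn

end
end RingA

namespace Push
section
variable {k L : Type} [Field k] [Field L] [Algebra k L]

theorem exists_dual {c : L} (hc : c ≠ 0) : ∃ ρ : L →ₗ[k] k, ρ c = 1 := by
  obtain ⟨ρ, hρ⟩ := LinearMap.exists_leftInverse_of_injective (Algebra.linearMap k L)
    (LinearMap.ker_eq_bot.2 (algebraMap k L).injective)
  have h1 : ρ 1 = 1 := by simpa using LinearMap.congr_fun hρ (1 : k)
  exact ⟨ρ ∘ₗ LinearMap.mulLeft k c⁻¹, by simp [hc, h1]⟩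

/-- Applying a linear functional to the coefficients of a polynomial. -/
def pol (ρ : L →ₗ[k] k) (p : Polynomial L) : Polynomial k :=
  ∑ i ∈ p.support, Polynomial.monomial i (ρ (p.coeff i))

theorem coeff_pol (ρ : L →ₗ[k] k) (p : Polynomial L) (i : ℕ) :
    (pol ρ p).coeff i = ρ (p.coeff i) := by
  rw [pol, Polynomial.finsetSum_coeff]
  simp only [Polynomial.coeff_monomial]
  rw [Finset.sum_ite_eq' p.support i]
  split_ifs with h
  · rfl
  · rw [Polynomial.notMem_support_iff.1 h, map_zero]

theorem pol_ne_zero {ρ : L →ₗ[k] k} (hρ : ρ 1 = 1) {p : Polynomial L} (hp : p.Monic) :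
    pol ρ p ≠ 0 := by
  intro h
  have := coeff_pol ρ p p.natDegree
  rw [h, hp.coeff_natDegree, hρ, Polynomial.coeff_zero] at this
  exact zero_ne_one this

variable {σ : Type}

/-- Applying a linear functional to the coefficients of a multivariate polynomial. -/
def mv (ρ : L →ₗ[k] k) (p : MvPolynomial σ L) : MvPolynomial σ k :=
  ∑ d ∈ p.support, monomial d (ρ (p.coeff d))

theorem coeff_mv (ρ : L →ₗ[k] k) (p : MvPolynomial σ L) (d : σ →₀ ℕ) :
    (mv ρ p).coeff d = ρ (p.coeff d) := by
  classical
  rw [mv, coeff_sum]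
  simp only [coeff_monomial]
  rw [Finset.sum_ite_eq' p.support d]
  split_ifs with h
  · rfl
  · rw [notMem_support_iff.1 h, map_zero]

theorem mv_add (ρ : L →ₗ[k] k) (p q : MvPolynomial σ L) : mv ρ (p + q) = mv ρ p + mv ρ q := by
  ext d; simp [coeff_mv]

theorem mv_sub (ρ : L →ₗ[k] k) (p q : MvPolynomial σ L) : mv ρ (p - q) = mv ρ p - mv ρ q := by
  ext d; simp [coeff_mv]

theorem mv_zero (ρ : L →ₗ[k] k) : mv ρ (0 : MvPolynomial σ L) = 0 := by
  ext d; simp [coeff_mv]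

theorem mv_sum {ι : Type} (ρ : L →ₗ[k] k) (s : Finset ι) (p : ι → MvPolynomial σ L) :
    mv ρ (∑ i ∈ s, p i) = ∑ i ∈ s, mv ρ (p i) :=
  map_sum (⟨⟨mv ρ, mv_zero ρ⟩, mv_add ρ⟩ : MvPolynomial σ L →+ MvPolynomial σ k) p s

/-- Extension of scalars. -/
abbrev up (L : Type) [Field L] [Algebra k L] : MvPolynomial σ k →+* MvPolynomial σ L :=
  MvPolynomial.map (algebraMap k L)

theorem mv_up_mul (ρ : L →ₗ[k] k) (p : MvPolynomial σ k) (q : MvPolynomial σ L) :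
    mv ρ (up L p * q) = p * mv ρ q := by
  classical
  ext d
  rw [coeff_mv, coeff_mul, coeff_mul, map_sum]
  refine Finset.sum_congr rfl fun x _ => ?_
  rw [coeff_map, coeff_mv, ← Algebra.smul_def, map_smul, smul_eq_mul]

theorem mv_C_mul_up (ρ : L →ₗ[k] k) (c : L) (p : MvPolynomial σ k) :
    mv ρ (C c * up L p) = C (ρ c) * p := by
  ext d
  rw [coeff_mv, coeff_C_mul, coeff_C_mul, coeff_map, mul_comm c, ← Algebra.smul_def, map_smul,
    smul_eq_mul, mul_comm]

theorem mv_up {ρ : L →ₗ[k] k} (hρ : ρ 1 = 1) (p : MvPolynomial σ k) : mv ρ (up L p) = p := by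
  have := mv_C_mul_up ρ 1 p
  rwa [hρ, C_1, C_1, one_mul, one_mul] at this

theorem mv_aeval_mul (ρ : L →ₗ[k] k) (p : Polynomial L) (h a : MvPolynomial σ k) :
    mv ρ (Polynomial.aeval (up L h) p * up L a) = Polynomial.aeval h (pol ρ p) * a := by
  rw [Polynomial.aeval_eq_sum_range' (n := p.natDegree + 1) (Nat.lt_succ_self _),
    Polynomial.aeval_eq_sum_range' (n := p.natDegree + 1), Finset.sum_mul, Finset.sum_mul, mv_sum]
  · refine Finset.sum_congr rfl fun i _ => ?_
    rw [coeff_pol, smul_eq_C_mul, smul_eq_C_mul, mul_assoc, mul_assoc, ← map_pow, ← map_mul,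
      mv_C_mul_up]
  · refine Nat.lt_succ_of_le (Polynomial.natDegree_le_iff_coeff_eq_zero.2 fun i hi => ?_)
    rw [coeff_pol, Polynomial.coeff_eq_zero_of_natDegree_lt hi, map_zero]

theorem mv_aeval (ρ : L →ₗ[k] k) (p : Polynomial L) (h : MvPolynomial σ k) :
    mv ρ (Polynomial.aeval (up L h) p) = Polynomial.aeval h (pol ρ p) := by
  have := mv_aeval_mul ρ p h 1
  rwa [map_one, mul_one, mul_one] at this

theorem eq_zero_of_mv {p : MvPolynomial σ L} (h : ∀ ρ : L →ₗ[k] k, mv ρ p = 0) : p = 0 := by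
  ext d
  by_contra hd
  obtain ⟨ρ, hρ⟩ := exists_dual (k := k) hd
  have := coeff_mv ρ p d
  rw [h ρ, hρ, coeff_zero] at this
  exact zero_ne_one this

theorem totalDegree_mv_le (ρ : L →ₗ[k] k) (p : MvPolynomial σ L) :
    (mv ρ p).totalDegree ≤ p.totalDegree := by
  refine Finset.sup_mono fun d hd => ?_
  rw [mem_support_iff, coeff_mv] at hd
  rw [mem_support_iff]
  intro h
  exact hd (by rw [h, map_zero])

theorem exists_totalDegree_mv {p : MvPolynomial σ L} (hp : p ≠ 0) :
    ∃ ρ : L →ₗ[k] k, mv ρ p ≠ 0 ∧ (mv ρ p).totalDegree = p.totalDegree := by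
  obtain ⟨d, hd, hd'⟩ := Finset.exists_mem_eq_sup p.support (support_nonempty.2 hp)
    fun s : σ →₀ ℕ => s.sum fun _ e => e
  obtain ⟨ρ, hρ⟩ := exists_dual (k := k) (mem_support_iff.1 hd)
  have hd2 : d ∈ (mv ρ p).support := by
    rw [mem_support_iff, coeff_mv, hρ]; exact one_ne_zero
  refine ⟨ρ, fun h => by simp [h] at hd2, le_antisymm (totalDegree_mv_le ρ p) ?_⟩
  rw [totalDegree, hd']
  exact le_totalDegree hd2

theorem totalDegree_up (p : MvPolynomial σ k) : (up L p).totalDegree = p.totalDegree :=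
  by
  rw [totalDegree, support_map_of_injective p (algebraMap k L).injective, totalDegree]

theorem up_injective : Function.Injective (up L : MvPolynomial σ k →+* MvPolynomial σ L) :=
  map_injective _ (algebraMap k L).injective

/-- The subalgebra obtained from `B` by extension of scalars. -/
def base (L : Type) [Field L] [Algebra k L] (B : Subalgebra k (MvPolynomial σ k)) :
    Subalgebra L (MvPolynomial σ L) :=
  Algebra.adjoin L (up L '' (B : Set (MvPolynomial σ k)))

theorem up_mem_base {B : Subalgebra k (MvPolynomial σ k)} {b : MvPolynomial σ k} (hb : b ∈ B) :
    up L b ∈ base L B := Algebra.subset_adjoin ⟨b, hb, rfl⟩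

theorem mv_mem {B : Subalgebra k (MvPolynomial σ k)} (ρ : L →ₗ[k] k) {a : MvPolynomial σ L}
    (ha : a ∈ base L B) : mv ρ a ∈ B := by
  have h1 : a ∈ Submodule.span L (up L '' (B : Set (MvPolynomial σ k))) := by
    have h2 : (up L '' (B : Set (MvPolynomial σ k))) =
        ((B.toSubmonoid.map (up (σ := σ) L).toMonoidHom : Submonoid (MvPolynomial σ L)) :
          Set (MvPolynomial σ L)) := rfl
    have h3 : a ∈ Subalgebra.toSubmodule (base L B) := ha
    rw [base, Algebra.adjoin_eq_span, h2, Submonoid.closure_eq] at h3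
    rw [h2]; exact h3
  clear ha
  induction h1 using Submodule.span_induction generalizing ρ with
  | mem x h =>
    obtain ⟨b, hb, rfl⟩ := h
    have := mv_C_mul_up ρ 1 b
    rw [C_1, one_mul] at this
    rw [this]
    exact mul_mem (B.algebraMap_mem _) hb
  | zero => rw [mv_zero]; exact zero_mem _
  | add x y hx hy ihx ihy => rw [mv_add]; exact add_mem (ihx ρ) (ihy ρ)
  | smul c x hx ih =>
    have : mv ρ (c • x) = mv (ρ ∘ₗ LinearMap.mulLeft k c) x := by
      ext d; simp [coeff_mv]
    rw [this]
    exact ih _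

theorem mem_of_up_mem_base {B : Subalgebra k (MvPolynomial σ k)} {b : MvPolynomial σ k}
    (h : up L b ∈ base L B) : b ∈ B := by
  obtain ⟨ρ, hρ⟩ := exists_dual (k := k) (one_ne_zero (α := L))
  have := mv_mem ρ h
  rwa [mv_up hρ] at this

end
end Push

namespace PlaneData
section
open Push
variable {k L : Type} [Field k] [Field L] [Algebra k L] {f : MvPolynomial (Fin 2) k}
variable (D : PlaneData f)

theorem base_transc {A : Polynomial (base L D.H)} (h : Polynomial.aeval (up L D.s) A = 0) :
    A = 0 := by
  have key : ∀ ρ : L →ₗ[k] k, ∀ i, mv ρ (A.coeff i : MvPolynomial (Fin 2) L) = 0 := by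
    intro ρ i
    let B : Polynomial (MvPolynomial (Fin 2) k) :=
      ∑ j ∈ Finset.range (A.natDegree + 1),
        Polynomial.monomial j (mv ρ (A.coeff j : MvPolynomial (Fin 2) L))
    have hB : ∀ j, B.coeff j = mv ρ (A.coeff j : MvPolynomial (Fin 2) L) := by
      intro j
      simp only [B, Polynomial.finsetSum_coeff, Polynomial.coeff_monomial]
      rw [Finset.sum_ite_eq' _ j]
      split_ifs with hj
      · rfl
      · rw [Polynomial.coeff_eq_zero_of_natDegree_lt (by simpa using hj), ZeroMemClass.coe_zero,
          mv_zero]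
    have hB0 : B = 0 := by
      refine D.transc B (fun j => by rw [hB]; exact mv_mem ρ (A.coeff j).2) ?_
      have h1 := congrArg (mv ρ) h
      rw [Polynomial.aeval_eq_sum_range, mv_sum, mv_zero] at h1
      simp only [B, Polynomial.eval_finsetSum, Polynomial.eval_monomial]
      rw [← h1]
      refine Finset.sum_congr rfl fun j _ => ?_
      rw [Subalgebra.smul_def, smul_eq_mul, ← map_pow, mul_comm _ (up L _), mv_up_mul, mul_comm]
    rw [← hB, hB0, Polynomial.coeff_zero]
  ext1 i
  rw [Polynomial.coeff_zero]
  exact Subtype.ext (eq_zero_of_mv fun ρ => key ρ i)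

theorem aeval_injective {R S : Type} [CommRing R] [CommRing S] [Algebra R S] {s : S}
    (h : ∀ A : Polynomial R, Polynomial.aeval s A = 0 → A = 0) :
    Function.Injective (Polynomial.aeval (R := R) s) :=
  (injective_iff_map_eq_zero _).2 h

theorem eq_algebraMap_of_mul {R S : Type} [CommRing R] [IsDomain R] [CommRing S] [Algebra R S]
    {s : S} (h : ∀ A : Polynomial R, Polynomial.aeval s A = 0 → A = 0) {A B : Polynomial R} {c : R}
    (hAB : Polynomial.aeval s A * Polynomial.aeval s B = algebraMap R S c)
    (h0 : Polynomial.aeval s A * Polynomial.aeval s B ≠ 0) :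
    ∃ c', Polynomial.aeval s A = algebraMap R S c' := by
  have h2 : A * B = Polynomial.C c := aeval_injective h (by
    rw [map_mul, hAB, Polynomial.aeval_C])
  have h3 : A ≠ 0 := by rintro rfl; simp at h0
  have h4 : B ≠ 0 := by rintro rfl; simp at h0
  have h5 := congrArg Polynomial.natDegree h2
  rw [Polynomial.natDegree_mul h3 h4, Polynomial.natDegree_C] at h5
  refine ⟨A.coeff 0, ?_⟩
  rw [← Polynomial.aeval_C (A := S),
    ← Polynomial.eq_C_of_natDegree_eq_zero (show A.natDegree = 0 by omega)]

theorem base_exists (a : MvPolynomial (Fin 2) L) :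
    ∃ N : ℕ, ∃ A : Polynomial (base L D.H),
      up L D.q ^ N * a = Polynomial.aeval (up L D.s) A := by
  let Q : base L D.H := ⟨up L D.q, up_mem_base D.q_mem⟩
  have hQ : ∀ N : ℕ, Polynomial.aeval (up L D.s) (Polynomial.C (Q ^ N)) = up L D.q ^ N := by
    intro N; rw [Polynomial.aeval_C, map_pow]; rfl
  induction a using MvPolynomial.induction_on with
  | C c => exact ⟨0, Polynomial.C (algebraMap L _ c), by
      rw [Polynomial.aeval_C, pow_zero, one_mul]; rfl⟩
  | add a b ha hb =>
    obtain ⟨N, A, hA⟩ := ha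
    obtain ⟨M, B, hB⟩ := hb
    refine ⟨N + M, Polynomial.C (Q ^ M) * A + Polynomial.C (Q ^ N) * B, ?_⟩
    rw [map_add, map_mul, map_mul, hQ, hQ, ← hA, ← hB]
    ring
  | mul_X a j ha =>
    obtain ⟨N, A, hA⟩ := ha
    obtain ⟨ρ, hρ, hρ'⟩ := D.q_mul j
    refine ⟨N + 1, A * ∑ i ∈ Finset.range (ρ.natDegree + 1),
      Polynomial.monomial i (⟨up L (ρ.coeff i), up_mem_base (hρ i)⟩ : base L D.H), ?_⟩
    rw [map_mul, ← hA, map_sum]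
    have h1 : up L D.q * X j = ∑ i ∈ Finset.range (ρ.natDegree + 1),
        up L (ρ.coeff i) * up L D.s ^ i := by
      rw [← map_X (algebraMap k L), ← map_mul, hρ', Polynomial.eval_eq_sum_range, map_sum]
      simp only [map_mul, map_pow]
    simp only [Polynomial.aeval_monomial]
    rw [pow_succ]
    change _ = up L D.q ^ N * a * ∑ i ∈ Finset.range (ρ.natDegree + 1),
        up L (ρ.coeff i) * up L D.s ^ i
    rw [← h1]; ring

theorem base_factor {a b : MvPolynomial (Fin 2) L} (h0 : a * b ≠ 0) (h : a * b ∈ base L D.H)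
    (ρ : L →ₗ[k] k) (hρ : mv ρ a ≠ 0) : mv ρ a ∈ D.H := by
  obtain ⟨N, A, hA⟩ := D.base_exists a
  obtain ⟨M, B, hB⟩ := D.base_exists b
  have hq0 : up L D.q ≠ 0 := fun h => D.q_ne (up_injective (h.trans (map_zero _).symm))
  have h7 : up L D.q ^ N * a ∈ base L D.H := by
    obtain ⟨c, hc⟩ := eq_algebraMap_of_mul (s := up L D.s) (fun A hA => D.base_transc hA)
      (A := A) (B := B)
      (c := ⟨up L D.q ^ (N + M) * (a * b), mul_mem (pow_mem (up_mem_base D.q_mem) _) h⟩) (by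
        rw [← hA, ← hB]
        change _ = up L D.q ^ (N + M) * (a * b)
        ring) (by
        rw [← hA, ← hB, mul_mul_mul_comm]
        exact mul_ne_zero (mul_ne_zero (pow_ne_zero _ hq0) (pow_ne_zero _ hq0)) h0)
    rw [hA, hc]
    exact c.2
  have h8 := mv_mem ρ h7
  rw [← map_pow, mv_up_mul] at h8
  refine D.mem_of_mul (mv ρ a) (D.q ^ N) (mul_ne_zero hρ (pow_ne_zero _ D.q_ne)) ?_
  rwa [mul_comm]

theorem totalDegree_eq_zero_iff {σ : Type} {K : Type} [Field K] {p : MvPolynomial σ K} :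
    p.totalDegree = 0 ↔ ∃ c, p = C c := by
  constructor
  · intro h; exact ⟨_, totalDegree_eq_zero_iff_eq_C.1 h⟩
  · rintro ⟨c, rfl⟩; exact totalDegree_C c

theorem not_surjective_aeval {K : Type} [Field K] (s : MvPolynomial (Fin 2) K) :
    ¬ Function.Surjective (Polynomial.aeval (R := K) s) := by
  intro h
  have h1 := ringKrullDim_le_of_surjective (Polynomial.aeval (R := K) s).toRingHom h
  rw [Polynomial.ringKrullDim_of_isNoetherianRing, MvPolynomial.ringKrullDim_of_isNoetherianRing,
    ringKrullDim_eq_zero_of_field] at h1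
  norm_num at h1

theorem exists_nonconst : ∃ h ∈ D.H, 0 < h.totalDegree := by
  by_contra hcon
  push Not at hcon
  have hc : ∀ a ∈ D.H, ∃ c, a = C c := fun a ha =>
    totalDegree_eq_zero_iff.1 (Nat.le_zero.1 (hcon a ha))
  obtain ⟨c, hq⟩ := hc _ D.q_mem
  have hc0 : c ≠ 0 := by rintro rfl; exact D.q_ne (by rw [hq, C_0])
  refine not_surjective_aeval D.s ?_
  rw [← AlgHom.range_eq_top, eq_top_iff, ← MvPolynomial.adjoin_range_X, Algebra.adjoin_le_iff]
  rintro _ ⟨j, rfl⟩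
  obtain ⟨ρ, hρ, hρ'⟩ := D.q_mul j
  have hX : X j = C c⁻¹ * ρ.eval D.s := by
    rw [← hρ', hq, ← mul_assoc, ← C_mul, inv_mul_cancel₀ hc0, C_1, one_mul]
  rw [SetLike.mem_coe, hX, Polynomial.eval_eq_sum_range]
  refine mul_mem (Subalgebra.algebraMap_mem _ _) (sum_mem fun i _ => mul_mem ?_ (pow_mem ?_ _))
  · obtain ⟨d, hd⟩ := hc _ (hρ i)
    rw [hd]; exact Subalgebra.algebraMap_mem _ _
  · exact ⟨Polynomial.X, Polynomial.aeval_X _⟩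

/-- A nonconstant element of minimal degree. -/
def IsGen (h : MvPolynomial (Fin 2) k) : Prop :=
  h ∈ D.H ∧ 0 < h.totalDegree ∧ ∀ a ∈ D.H, 0 < a.totalDegree → h.totalDegree ≤ a.totalDegree

theorem exists_isGen : ∃ h, D.IsGen h := by
  obtain ⟨h, ⟨h1, h2⟩, h3⟩ := WellFounded.has_min
    (measure fun p : MvPolynomial (Fin 2) k => p.totalDegree).wf
    {p | p ∈ D.H ∧ 0 < p.totalDegree} D.exists_nonconst
  exact ⟨h, h1, h2, fun a ha ha' => not_lt.1 (h3 a ⟨ha, ha'⟩)⟩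

variable {D} {h : MvPolynomial (Fin 2) k}

theorem totalDegree_sub_C {σ K : Type} [Field K] (p : MvPolynomial σ K) (c : K) :
    (p - C c).totalDegree = p.totalDegree := by
  refine le_antisymm ?_ ?_
  · refine (totalDegree_sub _ _).trans ?_
    rw [totalDegree_C]; simp
  · have := totalDegree_add (p - C c) (C c)
    rw [sub_add_cancel, totalDegree_C] at this
    simpa using this

theorem IsGen.prime (hh : D.IsGen h) (α : L) : Prime (up L h - C α) := by
  have hdeg : (up L h - C α).totalDegree = h.totalDegree := by
    rw [totalDegree_sub_C, totalDegree_up]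
  have hne : up L h - C α ≠ 0 := by
    intro h0
    rw [h0, totalDegree_zero] at hdeg
    exact hh.2.1.ne hdeg
  have hmem : up L h - C α ∈ base L D.H :=
    sub_mem (up_mem_base hh.1) ((base L D.H).algebraMap_mem α)
  have hle : ∀ a b, up L h - C α = a * b → a.totalDegree = 0 ∨ h.totalDegree ≤ a.totalDegree := by
    intro a b hab
    by_cases ha : a.totalDegree = 0
    · exact Or.inl ha
    right
    have ha0 : a ≠ 0 := by rintro rfl; exact ha totalDegree_zero
    obtain ⟨ρ, h1, h2⟩ := exists_totalDegree_mv (k := k) ha0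
    rw [hab] at hne hmem
    rw [← h2]
    exact hh.2.2 _ (D.base_factor hne hmem ρ h1) (by omega)
  have hunit : ∀ a b, up L h - C α = a * b → a.totalDegree = 0 → IsUnit a := by
    intro a b hab ha
    obtain ⟨c, rfl⟩ := totalDegree_eq_zero_iff.1 ha
    have : c ≠ 0 := by rintro rfl; rw [C_0, zero_mul] at hab; exact hne hab
    exact (Ne.isUnit this).map C
  rw [← UniqueFactorizationMonoid.irreducible_iff_prime]
  refine ⟨fun hu => ?_, fun a b hab => ?_⟩
  · rw [MvPolynomial.isUnit_iff_totalDegree_of_isReduced] at hu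
    have := hh.2.1
    omega
  · have hba : up L h - C α = b * a := by rw [hab, mul_comm]
    rcases hle a b hab with h1 | h1
    · exact Or.inl (hunit a b hab h1)
    rcases hle b a hba with h2 | h2
    · exact Or.inr (hunit b a hba h2)
    rw [hab] at hne hdeg
    rw [totalDegree_mul_of_isDomain (left_ne_zero_of_mul hne) (right_ne_zero_of_mul hne)] at hdeg
    have := hh.2.1
    omega

end
end PlaneData

/-- Nonzero polynomials over an algebraically closed field are products of linear factors. -/
theorem IsAlgClosed.polynomial_induction {L : Type} [Field L] [IsAlgClosed L]
    {motive : ∀ Q : Polynomial L, Q ≠ 0 → Prop}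
    (C : ∀ c (hc : c ≠ 0), motive (Polynomial.C c) (Polynomial.C_ne_zero.2 hc))
    (mul : ∀ α Q (hQ : Q ≠ 0), motive Q hQ →
      motive ((Polynomial.X - Polynomial.C α) * Q) (mul_ne_zero (Polynomial.X_sub_C_ne_zero α) hQ))
    (Q : Polynomial L) (hQ : Q ≠ 0) : motive Q hQ := by
  induction hn : Q.natDegree generalizing Q with
  | zero =>
    obtain ⟨c, rfl⟩ : ∃ c, Q = Polynomial.C c := ⟨_, Polynomial.eq_C_of_natDegree_eq_zero hn⟩
    exact C c (Polynomial.C_ne_zero.1 hQ)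
  | succ n ih =>
    obtain ⟨α, hα⟩ := IsAlgClosed.exists_root Q (by
      intro h
      rw [Polynomial.degree_eq_natDegree hQ, hn] at h
      exact absurd h (by norm_cast))
    obtain ⟨Q', rfl⟩ := Polynomial.dvd_iff_isRoot.2 hα
    have hQ' := right_ne_zero_of_mul hQ
    rw [Polynomial.natDegree_mul (Polynomial.X_sub_C_ne_zero α) hQ',
      Polynomial.natDegree_X_sub_C] at hn
    exact mul α Q' hQ' (ih Q' hQ' (by omega))

namespace PlaneData
section
open Push
variable {k L : Type} [Field k] [Field L] [Algebra k L] {f : MvPolynomial (Fin 2) k}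
variable {D : PlaneData f} {h : MvPolynomial (Fin 2) k}

theorem up_aeval {σ : Type} (h : MvPolynomial σ k) (Q : Polynomial k) :
    up L (Polynomial.aeval h Q) = Polynomial.aeval (up L h) (Q.map (algebraMap k L)) := by
  rw [Polynomial.aeval_def, Polynomial.hom_eval₂, Polynomial.aeval_def, Polynomial.eval₂_map]
  congr 1
  ext c
  simp [algebraMap_eq]

theorem mem_adjoin_aeval {K S : Type} [CommRing K] [CommRing S] [Algebra K S] {x : S} {B : Set S}
    (hx : x ∈ B) (Q : Polynomial K) : Polynomial.aeval x Q ∈ Algebra.adjoin K B :=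
  Algebra.adjoin_mono (Set.singleton_subset_iff.2 hx) (Polynomial.aeval_mem_adjoin_singleton K x)

theorem transcendental_of_totalDegree {σ : Type} {h : MvPolynomial σ k} (hd : 0 < h.totalDegree) :
    Transcendental k h := by
  intro ha
  have hne : h ≠ 0 := by rintro rfl; simp at hd
  obtain ⟨c, hc, hdvd⟩ := ha.exists_nonzero_dvd (mem_nonZeroDivisors_of_ne_zero hne)
  have hu : IsUnit h := isUnit_of_dvd_unit hdvd ((Ne.isUnit hc).map _)
  rw [MvPolynomial.isUnit_iff_totalDegree_of_isReduced] at hu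
  omega

theorem IsGen.isAlgebraic (hh : D.IsGen h) {a : MvPolynomial (Fin 2) k} (ha : a ∈ D.H) :
    IsAlgebraic (Algebra.adjoin k {h}) a := by
  by_contra hcon
  have h1 : AlgebraicIndependent k (fun _ : Unit => h) :=
    algebraicIndependent_unique_type_iff.2 (transcendental_of_totalDegree hh.2.1)
  have h2 := (AlgebraicIndependent.option_iff (a := a)).2 ⟨h1, by rwa [Set.range_const]⟩
  have h3 := (AlgebraicIndependent.option_iff (a := D.s)).2 ⟨h2, by
    rw [transcendental_iff]
    intro A hA
    have hle : Algebra.adjoin k (Set.range fun o : Option Unit => o.elim a fun _ => h) ≤ D.H := by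
      rw [Algebra.adjoin_le_iff]
      rintro _ ⟨o, rfl⟩
      cases o with
      | none => exact ha
      | some _ => exact hh.1
    have hB := D.transc (A.map (algebraMap _ _)) (fun i => by
      rw [Polynomial.coeff_map]; exact hle (A.coeff i).2) (by
      rwa [Polynomial.eval_map_algebraMap])
    rw [Polynomial.map_eq_zero_iff Subtype.val_injective] at hB
    exact hB⟩
  have h4 := h3.cardinalMk_le_trdeg
  rw [MvPolynomial.trdeg_of_isDomain] at h4
  simp at h4
  norm_num at h4

theorem IsGen.mem_of_dvd [IsAlgClosed L] (hh : D.IsGen h) {Q : Polynomial L} (hQ : Q ≠ 0) :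
    ∀ {d : MvPolynomial (Fin 2) L}, d ∣ Polynomial.aeval (up L h) Q →
      d ∈ Algebra.adjoin L {up L h} := by
  induction Q, hQ using IsAlgClosed.polynomial_induction with
  | C c hc =>
    intro d hd
    rw [Polynomial.aeval_C] at hd
    have hu := isUnit_of_dvd_unit hd ((Ne.isUnit hc).map _)
    rw [MvPolynomial.isUnit_iff_totalDegree_of_isReduced] at hu
    obtain ⟨c', rfl⟩ := totalDegree_eq_zero_iff.1 hu.2
    exact Subalgebra.algebraMap_mem _ _
  | mul α Q hQ ih =>
    rintro d ⟨e, he⟩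
    have hp := hh.prime α
    rw [map_mul, map_sub, Polynomial.aeval_X, Polynomial.aeval_C, algebraMap_eq] at he
    rcases hp.dvd_or_dvd (⟨_, he.symm⟩ : up L h - C α ∣ d * e) with ⟨d', rfl⟩ | ⟨e', rfl⟩
    · refine mul_mem (sub_mem (Algebra.subset_adjoin rfl) (Subalgebra.algebraMap_mem _ α)) (ih ?_)
      rw [mul_assoc] at he
      exact ⟨e, mul_left_cancel₀ hp.ne_zero he⟩
    · refine ih ⟨e', mul_left_cancel₀ hp.ne_zero (he.trans (by ring))⟩

theorem adjoin_le_base {B : Set (MvPolynomial (Fin 2) k)} :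
    Algebra.adjoin L (up L '' B) ≤ base L (Algebra.adjoin k B) := by
  rw [Algebra.adjoin_le_iff]
  rintro _ ⟨b, hb, rfl⟩
  exact up_mem_base (Algebra.subset_adjoin hb)

theorem IsGen.mem_iff (hh : D.IsGen h) {a : MvPolynomial (Fin 2) k} (ha : a ∈ D.H) :
    ∃ Q : Polynomial k, a = Polynomial.aeval h Q := by
  by_cases h0 : a = 0
  · exact ⟨0, by rw [h0, map_zero]⟩
  obtain ⟨⟨d, hd⟩, hd0, hdvd⟩ := (hh.isAlgebraic ha).exists_nonzero_dvd
    (mem_nonZeroDivisors_of_ne_zero h0)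
  rw [Algebra.adjoin_singleton_eq_range_aeval] at hd
  obtain ⟨Q, rfl⟩ := hd
  have hQ : Q ≠ 0 := by rintro rfl; exact hd0 (Subtype.ext (map_zero _))
  have h1 := hh.mem_of_dvd (L := AlgebraicClosure k)
    ((Polynomial.map_ne_zero_iff (algebraMap k (AlgebraicClosure k)).injective).2 hQ)
    (d := up _ a) (by rw [← up_aeval]; exact map_dvd _ hdvd)
  have h2 := mem_of_up_mem_base (adjoin_le_base (B := {h}) (by rwa [Set.image_singleton]))
  rw [Algebra.adjoin_singleton_eq_range_aeval] at h2
  obtain ⟨R, hR⟩ := h2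
  exact ⟨R, hR.symm⟩

theorem IsGen.s_indep (hh : D.IsGen h) {v w : Polynomial k}
    (e : Polynomial.aeval h v * D.s + Polynomial.aeval h w = 0) : v = 0 := by
  have hm : ∀ Q : Polynomial k, Polynomial.aeval h Q ∈ D.H := fun Q => by
    have := mem_adjoin_aeval (Set.mem_singleton h) Q
    exact Algebra.adjoin_le (Set.singleton_subset_iff.2 hh.1) this
  have h1 := D.transc (Polynomial.C (Polynomial.aeval h v) * Polynomial.X +
    Polynomial.C (Polynomial.aeval h w)) (fun i => by
      rw [Polynomial.coeff_add, Polynomial.coeff_C_mul, Polynomial.coeff_X, Polynomial.coeff_C]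
      refine add_mem (mul_mem (hm _) ?_) ?_
      · split_ifs
        exacts [one_mem _, zero_mem _]
      · split_ifs
        exacts [hm _, zero_mem _]) (by simpa using e)
  have h2 := congrArg (fun p => Polynomial.coeff p 1) h1
  simp only [Polynomial.coeff_add, Polynomial.coeff_C_mul, Polynomial.coeff_X_one, mul_one,
    Polynomial.coeff_C_succ, add_zero, Polynomial.coeff_zero] at h2
  exact (transcendental_iff.1 (transcendental_of_totalDegree hh.2.1)) _ h2

/-- Elements related to `s` by a linear relation over `k[h]`. -/
def InT (D : PlaneData f) (h T : MvPolynomial (Fin 2) k) : Prop :=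
  ∃ u v w : Polynomial k, u ≠ 0 ∧ v ≠ 0 ∧
    Polynomial.aeval h u * T = Polynomial.aeval h v * D.s + Polynomial.aeval h w

/-- An element of `InT` of minimal degree. -/
def IsMinT (D : PlaneData f) (h T : MvPolynomial (Fin 2) k) : Prop :=
  D.InT h T ∧ ∀ T', D.InT h T' → T.totalDegree ≤ T'.totalDegree

theorem exists_isMinT (D : PlaneData f) (h : MvPolynomial (Fin 2) k) : ∃ T, D.IsMinT h T := by
  obtain ⟨T, h1, h3⟩ := WellFounded.has_min
    (measure fun p : MvPolynomial (Fin 2) k => p.totalDegree).wf {T | D.InT h T}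
    ⟨D.s, 1, 1, 0, one_ne_zero, one_ne_zero, by simp⟩
  exact ⟨T, h1, fun a ha => not_lt.1 (h3 a ha)⟩

theorem IsGen.not_dvd [Algebra.IsAlgebraic k L] (hh : D.IsGen h) {T : MvPolynomial (Fin 2) k}
    (hT : D.IsMinT h T) (α β : L) : ¬ (up L h - C α) ∣ (up L T - C β) := by
  rintro ⟨T₂, hT₂⟩
  obtain ⟨⟨u, v, w, hu, hv, huv⟩, hmin⟩ := hT
  have hα : IsIntegral k α := Algebra.IsIntegral.isIntegral α
  obtain ⟨ν, hν⟩ := Polynomial.dvd_iff_isRoot.2 (show ((minpoly k α).map (algebraMap k L)).IsRoot α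
    by rw [Polynomial.IsRoot, Polynomial.eval_map_algebraMap]; exact minpoly.aeval k α)
  have hνm : ν.Monic := (Polynomial.monic_X_sub_C α).of_mul_monic_left
    (hν ▸ (minpoly.monic hα).map _)
  obtain ⟨ρ, hρ⟩ := exists_dual (k := k) (one_ne_zero (α := L))
  have h1 : Polynomial.aeval (up L h) ν * up L T - Polynomial.aeval (up L h) (Polynomial.C β * ν) =
      up L (Polynomial.aeval h (minpoly k α)) * T₂ := by
    rw [up_aeval, hν, map_mul, map_mul, map_sub, Polynomial.aeval_X, Polynomial.aeval_C,
      Polynomial.aeval_C, algebraMap_eq]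
    linear_combination Polynomial.aeval (up L h) ν * hT₂
  have h2 := congrArg (mv ρ) h1
  rw [mv_sub, mv_aeval_mul, mv_aeval, mv_up_mul] at h2
  have h3 : Polynomial.aeval h (u * minpoly k α) * mv ρ T₂ =
      Polynomial.aeval h (pol ρ ν * v) * D.s +
        Polynomial.aeval h (pol ρ ν * w - u * pol ρ (Polynomial.C β * ν)) := by
    simp only [map_mul, map_sub]
    linear_combination -Polynomial.aeval h u * h2 + Polynomial.aeval h (pol ρ ν) * huv
  have hv' : pol ρ ν * v ≠ 0 := mul_ne_zero (pol_ne_zero hρ hνm) hv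
  by_cases h0 : T₂ = 0
  · rw [h0, mv_zero, mul_zero] at h3
    exact hv' (hh.s_indep h3.symm)
  · have h4 := hmin (mv ρ T₂) ⟨_, _, _, mul_ne_zero hu (minpoly.ne_zero hα), hv', h3⟩
    have h5 := totalDegree_mv_le ρ T₂
    have h6 := congrArg totalDegree hT₂
    rw [totalDegree_mul_of_isDomain (hh.prime α).ne_zero h0, totalDegree_sub_C, totalDegree_sub_C,
      totalDegree_up, totalDegree_up] at h6
    have := hh.2.1
    omega

theorem IsGen.not_dvd_aeval [IsAlgClosed L] [Algebra.IsAlgebraic k L] (hh : D.IsGen h)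
    {T : MvPolynomial (Fin 2) k} (hT : D.IsMinT h T) (α : L) {c : Polynomial L} (hc : c ≠ 0) :
    ¬ (up L h - C α) ∣ Polynomial.aeval (up L T) c := by
  induction c, hc using IsAlgClosed.polynomial_induction with
  | C c hc =>
    intro hd
    rw [Polynomial.aeval_C] at hd
    exact (hh.prime α).not_isUnit (isUnit_of_dvd_unit hd ((Ne.isUnit hc).map _))
  | mul β Q hQ ih =>
    intro hd
    rw [map_mul, map_sub, Polynomial.aeval_X, Polynomial.aeval_C] at hd
    rcases (hh.prime α).dvd_or_dvd hd with h1 | h1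
    · exact hh.not_dvd hT α β h1
    · exact ih h1

theorem IsGen.mem_adjoin_of_mul [IsAlgClosed L] [Algebra.IsAlgebraic k L] (hh : D.IsGen h)
    {T : MvPolynomial (Fin 2) k} (hT : D.IsMinT h T) {Q : Polynomial L} (hQ : Q ≠ 0) :
    ∀ {a}, Polynomial.aeval (up L h) Q * a ∈ Algebra.adjoin L {up L h, up L T} →
      a ∈ Algebra.adjoin L {up L h, up L T} := by
  induction Q, hQ using IsAlgClosed.polynomial_induction with
  | C c hc =>
    intro a ha
    rw [Polynomial.aeval_C] at ha
    have := mul_mem (Subalgebra.algebraMap_mem (Algebra.adjoin L {up L h, up L T}) c⁻¹) ha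
    rwa [← mul_assoc, ← map_mul, inv_mul_cancel₀ hc, map_one, one_mul] at this
  | mul α Q hQ ih =>
    intro a ha
    refine ih ?_
    rw [map_mul, mul_assoc] at ha
    generalize Polynomial.aeval (up L h) Q * a = a' at ha
    rw [map_sub, Polynomial.aeval_X, Polynomial.aeval_C, algebraMap_eq] at ha
    have hT' : ∀ c : Polynomial L,
        Polynomial.aeval (up L T) c ∈ Algebra.adjoin L {up L h, up L T} := fun c =>
      mem_adjoin_aeval (by simp) c
    have hp : up L h - C α ∈ Algebra.adjoin L {up L h, up L T} :=
      sub_mem (Algebra.subset_adjoin (by simp)) (Subalgebra.algebraMap_mem _ α)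
    have key : ∀ b ∈ Algebra.adjoin L {up L h, up L T}, ∃ c : Polynomial L, ∃ b' ∈ Algebra.adjoin L
        {up L h, up L T}, b = Polynomial.aeval (up L T) c + (up L h - C α) * b' := by
      intro b hb
      induction hb using Algebra.adjoin_induction with
      | mem x hx =>
        rcases hx with rfl | rfl
        · refine ⟨Polynomial.C α, 1, one_mem _, ?_⟩
          rw [Polynomial.aeval_C, algebraMap_eq]; ring
        · exact ⟨Polynomial.X, 0, zero_mem _, by rw [Polynomial.aeval_X]; ring⟩
      | algebraMap c => exact ⟨Polynomial.C c, 0, zero_mem _, by rw [Polynomial.aeval_C]; ring⟩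
      | add x y _ _ hx hy =>
        obtain ⟨c, b, hb, rfl⟩ := hx
        obtain ⟨d, b', hb', rfl⟩ := hy
        exact ⟨c + d, b + b', add_mem hb hb', by rw [map_add]; ring⟩
      | mul x y _ _ hx hy =>
        obtain ⟨c, b, hb, rfl⟩ := hx
        obtain ⟨d, b', hb', rfl⟩ := hy
        exact ⟨c * d, Polynomial.aeval (up L T) c * b' + b * Polynomial.aeval (up L T) d +
          (up L h - C α) * (b * b'), add_mem (add_mem (mul_mem (hT' _) hb') (mul_mem hb (hT' _)))
            (mul_mem hp (mul_mem hb hb')), by rw [map_mul]; ring⟩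
    obtain ⟨c, b', hb', e⟩ := key _ ha
    have hc : c = 0 := by
      by_contra hc
      exact hh.not_dvd_aeval hT α hc ⟨a' - b', by linear_combination -e⟩
    rw [hc, map_zero, zero_add] at e
    rwa [mul_left_cancel₀ (hh.prime α).ne_zero e]

theorem IsGen.linear_of_mul [IsAlgClosed L] [Algebra.IsAlgebraic k L] (hh : D.IsGen h)
    {T : MvPolynomial (Fin 2) k} (hT : D.IsMinT h T) {Q : Polynomial L} (hQ : Q ≠ 0) :
    ∀ {a}, (∃ a₀ a₁ : Polynomial L, Polynomial.aeval (up L h) Q * a =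
        Polynomial.aeval (up L h) a₀ + Polynomial.aeval (up L h) a₁ * up L T) →
      ∃ a₀ a₁ : Polynomial L,
        a = Polynomial.aeval (up L h) a₀ + Polynomial.aeval (up L h) a₁ * up L T := by
  induction Q, hQ using IsAlgClosed.polynomial_induction with
  | C c hc =>
    rintro a ⟨a₀, a₁, e⟩
    refine ⟨Polynomial.C c⁻¹ * a₀, Polynomial.C c⁻¹ * a₁, ?_⟩
    rw [map_mul, map_mul, mul_assoc, ← mul_add, ← e, Polynomial.aeval_C, Polynomial.aeval_C,
      ← mul_assoc, ← map_mul, inv_mul_cancel₀ hc, map_one, one_mul]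
  | mul α Q hQ ih =>
    rintro a ⟨a₀, a₁, e⟩
    refine ih ?_
    rw [map_mul, mul_assoc] at e
    generalize Polynomial.aeval (up L h) Q * a = a' at e
    have hdiv : ∀ p : Polynomial L, ∃ p', p = Polynomial.C (p.eval α) +
        (Polynomial.X - Polynomial.C α) * p' := fun p => by
      obtain ⟨p', hp'⟩ := Polynomial.X_sub_C_dvd_sub_C_eval (a := α) (p := p)
      exact ⟨p', by rw [← hp']; ring⟩
    obtain ⟨b₀, h0⟩ := hdiv a₀
    obtain ⟨b₁, h1⟩ := hdiv a₁
    generalize a₀.eval α = c₀ at h0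
    generalize a₁.eval α = c₁ at h1
    have hc : Polynomial.C c₀ + Polynomial.C c₁ * Polynomial.X = 0 := by
      by_contra hc
      refine hh.not_dvd_aeval hT α hc ⟨a' - Polynomial.aeval (up L h) b₀ -
        Polynomial.aeval (up L h) b₁ * up L T, ?_⟩
      rw [h0, h1] at e
      simp only [map_mul, map_sub, map_add, Polynomial.aeval_X, Polynomial.aeval_C,
        algebraMap_eq] at e ⊢
      linear_combination -e
    have hc0 : c₀ = 0 := by simpa using congrArg (fun p => Polynomial.coeff p 0) hc
    have hc1 : c₁ = 0 := by simpa using congrArg (fun p => Polynomial.coeff p 1) hc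
    refine ⟨b₀, b₁, ?_⟩
    have hp := (hh.prime α).ne_zero
    refine mul_left_cancel₀ hp ?_
    rw [h0, h1, hc0, hc1] at e
    simp only [map_mul, map_sub, Polynomial.aeval_X, Polynomial.aeval_C, map_zero, zero_add,
      algebraMap_eq] at e
    linear_combination e

/-- Plane data provides coordinates of the plane in which `f` has degree at most one in the
second coordinate. -/
theorem exists_coords (D : PlaneData f) : ∃ h T, Algebra.adjoin k {h, T} = ⊤ ∧
    ((∃ R : Polynomial k, f = Polynomial.aeval h R) ∨
      ∃ a₀ a₁ : Polynomial k, a₁ ≠ 0 ∧ f = Polynomial.aeval h a₀ + Polynomial.aeval h a₁ * T) := by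
  obtain ⟨h, hh⟩ := D.exists_isGen
  obtain ⟨T, hT⟩ := D.exists_isMinT h
  have hT' := hT
  obtain ⟨⟨u, v, w, hu, hv, huv⟩, -⟩ := hT'
  let L := AlgebraicClosure k
  have hinj := (algebraMap k L).injective
  refine ⟨h, T, ?_, ?_⟩
  · rw [eq_top_iff, ← MvPolynomial.adjoin_range_X, Algebra.adjoin_le_iff]
    rintro _ ⟨j, rfl⟩
    obtain ⟨ρ, hρ, hρ'⟩ := D.q_mul j
    obtain ⟨Q, hQ⟩ := hh.mem_iff D.q_mem
    have hQ0 : Q ≠ 0 := by rintro rfl; exact D.q_ne (by rw [hQ, map_zero])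
    have hmem : ∀ P : Polynomial k, Polynomial.aeval h P ∈ Algebra.adjoin k {h, T} := fun P =>
      mem_adjoin_aeval (by simp) P
    have hTm : T ∈ Algebra.adjoin k {h, T} := Algebra.subset_adjoin (by simp)
    have hvs : Polynomial.aeval h v * D.s ∈ Algebra.adjoin k {h, T} := by
      rw [eq_sub_of_add_eq huv.symm]
      exact sub_mem (mul_mem (hmem _) hTm) (hmem _)
    have h1 : Polynomial.aeval h (v ^ ρ.natDegree * Q) * X j ∈ Algebra.adjoin k {h, T} := by
      rw [map_mul, ← hQ, mul_assoc, hρ', Polynomial.eval_eq_sum_range, Finset.mul_sum]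
      refine sum_mem fun i hi => ?_
      obtain ⟨l, hl⟩ := Nat.exists_eq_add_of_le (Nat.lt_succ_iff.1 (Finset.mem_range.1 hi))
      obtain ⟨P, hP⟩ := hh.mem_iff (hρ i)
      have : Polynomial.aeval h (v ^ ρ.natDegree) * (ρ.coeff i * D.s ^ i) =
          Polynomial.aeval h P * Polynomial.aeval h v ^ l * (Polynomial.aeval h v * D.s) ^ i := by
        rw [hl, hP, map_pow]; ring
      rw [this]
      exact mul_mem (mul_mem (hmem _) (pow_mem (hmem _) _)) (pow_mem hvs _)
    have hle : base L (Algebra.adjoin k {h, T}) ≤ Algebra.adjoin L {up L h, up L T} := by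
      rw [base, Algebra.adjoin_le_iff]
      rintro _ ⟨b, hb, rfl⟩
      have hb' : b ∈ Algebra.adjoin k {h, T} := hb
      rw [SetLike.mem_coe]
      induction hb' using Algebra.adjoin_induction with
      | mem x hx =>
        rcases hx with rfl | rfl
        · exact Algebra.subset_adjoin (by simp)
        · exact Algebra.subset_adjoin (by simp)
      | algebraMap c =>
        rw [algebraMap_eq, map_C]; exact Subalgebra.algebraMap_mem _ _
      | add x y hx hy ihx ihy => rw [map_add]; exact add_mem (ihx hx) (ihy hy)
      | mul x y hx hy ihx ihy => rw [map_mul]; exact mul_mem (ihx hx) (ihy hy)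
    have h2 := hle (up_mem_base h1)
    rw [map_mul, up_aeval] at h2
    have h3 := hh.mem_adjoin_of_mul hT ((Polynomial.map_ne_zero_iff hinj).2
      (mul_ne_zero (pow_ne_zero _ hv) hQ0)) h2
    refine mem_of_up_mem_base (adjoin_le_base (B := {h, T}) ?_) (L := L)
    rwa [Set.image_pair]
  · rcases D.f_mem with hf | hf
    · exact Or.inl (hh.mem_iff hf)
    right
    obtain ⟨a₀, a₁, e⟩ := hh.linear_of_mul (L := L) hT ((Polynomial.map_ne_zero_iff hinj).2 hv)
      (a := up L D.s) ⟨-w.map (algebraMap k L), u.map (algebraMap k L), by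
        rw [map_neg, ← up_aeval, ← up_aeval, ← up_aeval, ← map_mul, ← map_mul, huv, map_add]
        ring⟩
    obtain ⟨ρ, hρ⟩ := exists_dual (k := k) (one_ne_zero (α := L))
    have e' := congrArg (mv ρ) e
    rw [mv_add, mv_up hρ, mv_aeval, mv_aeval_mul] at e'
    by_cases h0 : pol ρ a₁ = 0
    · rw [h0, map_zero, zero_mul, add_zero] at e'
      exfalso
      have := hh.s_indep (v := 1) (w := -pol ρ a₀) (by rw [e', map_neg, map_one]; ring)
      exact one_ne_zero this
    · exact ⟨_, _, h0, by rw [← e', hf]⟩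

end
end PlaneData

/-- Polynomial identities witnessing an isomorphism `S[σ] / (G) ≅ S[ι]`. -/
structure PolyIso {S σ : Type} [CommRing S] (ι : Type) (G : MvPolynomial σ S) where
  /-- The images of the variables of `S[σ]`. -/
  P : σ → MvPolynomial ι S
  /-- Representatives of the images of the variables of `S[ι]`. -/
  Q : ι → MvPolynomial σ S
  /-- The cofactors of the relations. -/
  H : σ → MvPolynomial σ S
  aeval_G : aeval P G = 0
  aeval_Q : ∀ j, aeval P (Q j) = X j
  aeval_P : ∀ s, aeval Q (P s) = X s + H s * G

namespace PolyIso
section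
variable {S S' σ ι : Type} [CommRing S] [CommRing S'] {G : MvPolynomial σ S}

theorem aeval_map (φ : S →+* S') (v : σ → MvPolynomial ι S) (p : MvPolynomial σ S) :
    aeval (fun s => map φ (v s)) (map φ p) = map φ (aeval v p) := by
  induction p using MvPolynomial.induction_on with
  | C c => simp
  | add p q hp hq => simp only [map_add, hp, hq]
  | mul_X p i hp => simp only [map_mul, hp, map_X, aeval_X]

/-- Base change of polynomial identities. -/
def map (φ : S →+* S') (I : PolyIso ι G) : PolyIso ι (MvPolynomial.map φ G) where
  P s := MvPolynomial.map φ (I.P s)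
  Q j := MvPolynomial.map φ (I.Q j)
  H s := MvPolynomial.map φ (I.H s)
  aeval_G := by rw [aeval_map, I.aeval_G, map_zero]
  aeval_Q j := by rw [aeval_map, I.aeval_Q, map_X]
  aeval_P s := by rw [aeval_map, I.aeval_P, map_add, map_mul, map_X]

theorem dvd_sub (I : PolyIso ι G) (a : MvPolynomial σ S) :
    G ∣ aeval I.Q (aeval I.P a) - a := by
  induction a using MvPolynomial.induction_on with
  | C c => simp
  | add p q hp hq =>
    have := dvd_add hp hq
    rwa [map_add, map_add, add_sub_add_comm]
  | mul_X p i hp =>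
    rw [map_mul, map_mul, aeval_X, I.aeval_P]
    obtain ⟨c, hc⟩ := hp
    exact ⟨c * X i + aeval I.Q (aeval I.P p) * I.H i, by linear_combination (X i) * hc⟩

theorem aeval_eq_zero_iff (I : PolyIso ι G) {a : MvPolynomial σ S} : aeval I.P a = 0 ↔ G ∣ a := by
  constructor
  · intro h
    have := I.dvd_sub a
    rwa [h, map_zero, zero_sub, dvd_neg] at this
  · rintro ⟨c, rfl⟩
    rw [map_mul, I.aeval_G, zero_mul]

theorem aeval_surjective (I : PolyIso ι G) : Function.Surjective (aeval I.P : _ →ₐ[S] _) := by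
  intro b
  refine ⟨aeval I.Q b, ?_⟩
  induction b using MvPolynomial.induction_on with
  | C c => simp
  | add p q hp hq => rw [map_add, map_add, hp, hq]
  | mul_X p i hp => rw [map_mul, map_mul, hp, aeval_X, I.aeval_Q]

theorem aeval_dvd_iff (I : PolyIso ι G) {a b : MvPolynomial σ S} :
    aeval I.P a ∣ aeval I.P b ↔ ∃ c, G ∣ b - a * c := by
  constructor
  · rintro ⟨c, hc⟩
    obtain ⟨c, rfl⟩ := I.aeval_surjective c
    exact ⟨c, by rw [← I.aeval_eq_zero_iff, map_sub, map_mul, hc, sub_self]⟩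
  · rintro ⟨c, hc⟩
    rw [← I.aeval_eq_zero_iff, map_sub, map_mul, sub_eq_zero] at hc
    exact ⟨_, hc⟩

theorem eval_comp (w : ι → S) (v : σ → MvPolynomial ι S) (p : MvPolynomial σ S) :
    eval (fun s => eval w (v s)) p = eval w (aeval v p) := by
  induction p using MvPolynomial.induction_on with
  | C c => simp
  | add p q hp hq => simp only [map_add, hp, hq]
  | mul_X p i hp => simp only [map_mul, hp, eval_X, aeval_X]

/-- The bijection on points. -/
def points (I : PolyIso ι G) : {p : σ → S // eval p G = 0} ≃ (ι → S) where
  toFun p j := eval p.1 (I.Q j)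
  invFun v := ⟨fun s => eval v (I.P s), by rw [eval_comp, I.aeval_G, map_zero]⟩
  left_inv p := Subtype.ext (funext fun s => by
    change eval _ (I.P s) = p.1 s
    rw [eval_comp, I.aeval_P, map_add, map_mul, p.2, mul_zero, add_zero, eval_X])
  right_inv v := funext fun j => by
    change eval _ (I.Q j) = v j
    rw [eval_comp, I.aeval_Q, eval_X]

/-- An isomorphism with a quotient by a principal ideal yields polynomial identities. -/
theorem nonempty_of_equiv {W : Type} [CommRing W] [Algebra S W] (ω : MvPolynomial σ S →ₐ[S] W)
    (hω : Function.Surjective ω) (hG : ∀ a, ω a = 0 ↔ G ∣ a) (e : W ≃ₐ[S] MvPolynomial ι S) :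
    Nonempty (PolyIso ι G) := by
  choose Q hQ using fun j => hω (e.symm (X j))
  have hP : ∀ a, aeval (fun s => e (ω (X s))) a = e (ω a) := fun a => by
    have : aeval (fun s => e (ω (X s))) = (e : W →ₐ[S] _).comp ω := by ext; simp
    rw [this]; rfl
  have hQ' : ∀ b, ω (aeval Q b) = e.symm b := fun b => by
    have : ω.comp (aeval Q) = (e.symm : _ →ₐ[S] W) := by ext; simp [hQ]
    exact DFunLike.congr_fun this b
  have h : ∀ s, ∃ c, aeval Q (e (ω (X s))) - X s = G * c := fun s => by
    refine (hG _).1 ?_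
    rw [map_sub, hQ', e.symm_apply_apply, sub_self]
  choose H hH using h
  exact ⟨⟨_, Q, H, by rw [hP, (hG G).2 dvd_rfl, map_zero], fun j => by
    rw [hP, hQ, e.apply_symm_apply], fun s => by linear_combination hH s⟩⟩

end
end PolyIso

namespace RingA
section
variable {k : Type} [CommRing k] {m : ℕ} {r : Fin m → ℕ} {F : MvPolynomial (Fin m ⊕ Fin 2) k}

/-- The equation of `A` in a polynomial ring with `l` further variables. -/
def stG (k : Type) [CommRing k] (l m : ℕ) (r : Fin m → ℕ) (F : MvPolynomial (Fin m ⊕ Fin 2) k) :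
    MvPolynomial (Fin l ⊕ (Fin m ⊕ Fin 3)) k := rename Sum.inr (relG k m r F)

theorem map_stG {k' : Type} [CommRing k'] (φ : k →+* k') (l : ℕ) :
    map φ (stG k l m r F) = stG k' l m r (map φ F) := by
  simp [stG, relG, incl, map_rename]

/-- The presentation of `A^{[l]}`. -/
def stMk (l : ℕ) : MvPolynomial (Fin l ⊕ (Fin m ⊕ Fin 3)) k →ₐ[k]
    MvPolynomial (Fin l) (RingA k m r F) :=
  aeval (Sum.elim X fun s => C (Ideal.Quotient.mk _ (X s)))

theorem stMk_rename (l : ℕ) (p : BigP k m) :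
    stMk (r := r) (F := F) l (rename Sum.inr p) = C (Ideal.Quotient.mk _ p) := by
  rw [stMk, aeval_rename]
  induction p using MvPolynomial.induction_on with
  | C c => rw [algHom_C]; rfl
  | add p q hp hq => simp only [map_add, hp, hq]
  | mul_X p i hp => simp only [map_mul, hp, aeval_X]; rfl

theorem stMk_surjective (l : ℕ) : Function.Surjective (stMk (r := r) (F := F) (k := k) l) := by
  intro b
  induction b using MvPolynomial.induction_on with
  | C c =>
    obtain ⟨c, rfl⟩ := Ideal.Quotient.mk_surjective c
    exact ⟨_, stMk_rename l c⟩
  | add p q hp hq =>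
    obtain ⟨a, rfl⟩ := hp
    obtain ⟨b, rfl⟩ := hq
    exact ⟨a + b, map_add _ _ _⟩
  | mul_X p i hp =>
    obtain ⟨a, rfl⟩ := hp
    exact ⟨a * X (Sum.inl i), by rw [map_mul]; simp [stMk]⟩

theorem stMk_eq_zero_iff (l : ℕ) (a : MvPolynomial (Fin l ⊕ (Fin m ⊕ Fin 3)) k) :
    stMk (r := r) (F := F) l a = 0 ↔ stG k l m r F ∣ a := by
  constructor
  · intro h
    let Φ : BigP k m →+* MvPolynomial (Fin l ⊕ (Fin m ⊕ Fin 3)) k ⧸ Ideal.span {stG k l m r F} :=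
      (Ideal.Quotient.mk _).comp (rename Sum.inr : BigP k m →ₐ[k] _).toRingHom
    have hΦ : ∀ p ∈ Ideal.span {relG k m r F}, Φ p = 0 := by
      intro p hp
      obtain ⟨q, rfl⟩ := Ideal.mem_span_singleton.1 hp
      have : Φ (relG k m r F) = 0 :=
        Ideal.Quotient.eq_zero_iff_mem.2 (Ideal.mem_span_singleton_self _)
      rw [map_mul, this, zero_mul]
    let Ψ : MvPolynomial (Fin l) (RingA k m r F) →+* _ :=
      eval₂Hom (Ideal.Quotient.lift _ Φ hΦ) fun i => Ideal.Quotient.mk _ (X (Sum.inl i))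
    have key : Ψ.comp (stMk (r := r) (F := F) l).toRingHom = Ideal.Quotient.mk _ := by
      refine MvPolynomial.ringHom_ext (fun c => ?_) (fun s => ?_)
      · change Ψ (stMk l (C c)) = _
        have h1 := stMk_rename (r := r) (F := F) l (C c)
        rw [rename_C] at h1
        rw [h1]
        simp [Ψ, Φ]
      · change Ψ (stMk l (X s)) = _
        rcases s with i | s
        · simp [stMk, Ψ]
        · have h1 := stMk_rename (r := r) (F := F) l (X s)
          rw [rename_X] at h1
          rw [h1]
          simp [Ψ, Φ]
    have h2 := RingHom.congr_fun key a
    rw [← Ideal.mem_span_singleton, ← Ideal.Quotient.eq_zero_iff_mem, ← h2]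
    change Ψ (stMk l a) = 0
    rw [h, map_zero]
  · rintro ⟨c, rfl⟩
    rw [map_mul, stG, stMk_rename,
      Ideal.Quotient.eq_zero_iff_mem.2 (Ideal.mem_span_singleton_self _), C_0, zero_mul]

theorem exists_polyIso {l N : ℕ}
    (e : MvPolynomial (Fin l) (RingA k m r F) ≃ₐ[k] MvPolynomial (Fin N) k) :
    Nonempty (PolyIso (Fin N) (stG k l m r F)) :=
  PolyIso.nonempty_of_equiv (W := MvPolynomial (Fin l) (RingA k m r F)) (stMk l)
    (stMk_surjective l) (stMk_eq_zero_iff l) e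

end
end RingA

namespace RingA
section
variable {k : Type} [Field k] {l m N : ℕ} {r : Fin m → ℕ} {F g : MvPolynomial (Fin m ⊕ Fin 2) k}

/-- Monomials in the variables `x`. -/
def xMon (k : Type) [CommRing k] (l : ℕ) {m : ℕ} (γ : Fin m → ℕ) :
    MvPolynomial (Fin l ⊕ (Fin m ⊕ Fin 2)) k := ∏ i, X (Sum.inr (Sum.inl i)) ^ γ i

theorem xMon_add (γ δ : Fin m → ℕ) : xMon k l (γ + δ) = xMon k l γ * xMon k l δ := by
  simp only [xMon, Pi.add_apply, pow_add, Finset.prod_mul_distrib]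

theorem xMon_nsmul (n : ℕ) (γ : Fin m → ℕ) : xMon k l (n • γ) = xMon k l γ ^ n := by
  simp only [xMon, Pi.smul_apply, smul_eq_mul, ← Finset.prod_pow, ← pow_mul, mul_comm n]

theorem xMon_single (j : Fin m) (n : ℕ) :
    xMon k l (Pi.single j n) = X (Sum.inr (Sum.inl j)) ^ n := by
  rw [xMon, Finset.prod_eq_single j]
  · simp
  · intro i _ hi; simp [Pi.single_eq_of_ne hi]
  · simp

theorem xMon_eq_monomial (γ : Fin m → ℕ) : xMon k l γ =
    monomial (Finsupp.equivFunOnFinite.symm (Sum.elim (fun _ => 0) (Sum.elim γ fun _ => 0))) 1 := by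
  rw [monomial_eq, Finsupp.prod_fintype _ _ (by simp)]
  simp [xMon]

theorem exists_xMon_of_dvd {a : MvPolynomial (Fin l ⊕ (Fin m ⊕ Fin 2)) k} {γ : Fin m → ℕ}
    (h : a ∣ xMon k l γ) : ∃ c δ, c ≠ 0 ∧ a = C c * xMon k l δ := by
  rw [xMon_eq_monomial, dvd_monomial_iff_exists one_ne_zero] at h
  obtain ⟨e, c, he, hc, rfl⟩ := h
  refine ⟨c, fun i => e (Sum.inr (Sum.inl i)), ?_, ?_⟩
  · rintro rfl
    exact one_ne_zero (zero_dvd_iff.1 hc)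
  · rw [xMon_eq_monomial, C_mul_monomial, mul_one]
    refine congrArg (fun e => monomial e c) (Finsupp.ext fun s => ?_)
    rcases s with s | s | s
    · exact Nat.le_zero.1 (by simpa using he (Sum.inl s))
    · rfl
    · exact Nat.le_zero.1 (by simpa using he (Sum.inr (Sum.inr s)))

/-- The inclusion of the polynomials free of `y`. -/
def freeY (l m : ℕ) : Fin l ⊕ (Fin m ⊕ Fin 2) → Fin l ⊕ (Fin m ⊕ Fin 3) :=
  Sum.map id (Sum.map id Fin.succ)

theorem stG_eq : stG k l m r F = rename (freeY l m) (xMon k l r) * X (Sum.inr (Sum.inr 0)) -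
    rename (freeY l m) (rename Sum.inr F) := by
  simp only [stG, relG, incl, map_sub, map_mul, map_prod, map_pow, rename_X, xMon, rename_rename]
  rfl

variable (I : PolyIso (Fin N) (stG k l m r F))

/-- The embedding of the polynomials free of `y`. -/
def free : MvPolynomial (Fin l ⊕ (Fin m ⊕ Fin 2)) k →ₐ[k] MvPolynomial (Fin N) k :=
  (aeval I.P).comp (rename (freeY l m))

theorem free_C (c : k) : free I (C c) = C c := algHom_C (free I) c

theorem free_mul_y : free I (xMon k l r) *
    aeval I.P (X (Sum.inr (Sum.inr 0)) : MvPolynomial (Fin l ⊕ (Fin m ⊕ Fin 3)) k) =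
    free I (rename Sum.inr F) := by
  have h := congrArg (aeval I.P) (stG_eq (k := k) (l := l) (r := r) (F := F))
  rw [I.aeval_G, map_sub, map_mul] at h
  exact (sub_eq_zero.1 h.symm)

theorem exists_free (w : MvPolynomial (Fin N) k) :
    ∃ β a, free I (xMon k l r) ^ β * w = free I a := by
  obtain ⟨b, rfl⟩ := I.aeval_surjective w
  induction b using MvPolynomial.induction_on with
  | C c => exact ⟨0, C c, by rw [algHom_C, algHom_C]; simp⟩
  | add p q hp hq =>
    obtain ⟨β, a, ha⟩ := hp
    obtain ⟨β', a', ha'⟩ := hq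
    refine ⟨β + β', xMon k l r ^ β' * a + xMon k l r ^ β * a', ?_⟩
    simp only [map_add, map_mul, map_pow, ← ha, ← ha']
    ring
  | mul_X p s hp =>
    obtain ⟨β, a, ha⟩ := hp
    have hs : (∃ t, s = freeY l m t) ∨ s = Sum.inr (Sum.inr 0) := by
      rcases s with i | i | i
      · exact Or.inl ⟨Sum.inl i, rfl⟩
      · exact Or.inl ⟨Sum.inr (Sum.inl i), rfl⟩
      · rcases Fin.eq_zero_or_eq_succ i with rfl | ⟨j, rfl⟩
        · exact Or.inr rfl
        · exact Or.inl ⟨Sum.inr (Sum.inr j), rfl⟩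
    rcases hs with ⟨t, rfl⟩ | rfl
    · refine ⟨β, a * X t, ?_⟩
      rw [map_mul, map_mul, ← ha, free, AlgHom.comp_apply, AlgHom.comp_apply, rename_X]
      ring
    · refine ⟨β + 1, a * rename Sum.inr F, ?_⟩
      rw [map_mul, map_mul, ← ha, ← free_mul_y]
      ring

theorem xMon_ne_zero (γ : Fin m → ℕ) : xMon k l γ ≠ 0 :=
  Finset.prod_ne_zero_iff.2 fun _ _ => pow_ne_zero _ (X_ne_zero _)

theorem free_injective : Function.Injective (free I) := by
  rw [injective_iff_map_eq_zero]
  intro a ha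
  rw [free, AlgHom.comp_apply, I.aeval_eq_zero_iff] at ha
  let A := MvPolynomial (Fin l ⊕ (Fin m ⊕ Fin 2)) k
  let φ : A →ₐ[k] FractionRing A := Algebra.algHom k A (FractionRing A)
  have hφ : Function.Injective φ := IsFractionRing.injective A (FractionRing A)
  let v : Fin l ⊕ (Fin m ⊕ Fin 3) → FractionRing A :=
    Sum.elim (fun i => φ (X (Sum.inl i))) (Sum.elim (fun i => φ (X (Sum.inr (Sum.inl i))))
      (Fin.cons (φ (rename Sum.inr F) / φ (xMon k l r)) fun i => φ (X (Sum.inr (Sum.inr i)))))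
  have hv : ∀ p, aeval v (rename (freeY l m) p) = φ p := fun p => by
    rw [aeval_rename]
    have : aeval (v ∘ freeY l m) = φ := by
      ext s
      rw [aeval_X]
      rcases s with i | i | i <;> rfl
    rw [this]
  have h0 : aeval v (stG k l m r F) = 0 := by
    rw [stG_eq, map_sub, map_mul, hv, hv, aeval_X]
    change _ * (φ (rename Sum.inr F) / φ (xMon k l r)) - _ = 0
    rw [mul_div_cancel₀, sub_self]
    rw [Ne, map_eq_zero_iff _ hφ]
    exact xMon_ne_zero _
  obtain ⟨c, hc⟩ := ha
  have := congrArg (aeval v) hc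
  rwa [hv, map_mul, h0, zero_mul, map_eq_zero_iff _ hφ] at this

/-- The specialization of `x` to constants and of the additional variables to zero. -/
def spec (l : ℕ) (v : Fin m → k) :
    MvPolynomial (Fin l ⊕ (Fin m ⊕ Fin 2)) k →ₐ[k] MvPolynomial (Fin 2) k :=
  aeval (Sum.elim (fun _ => 0) (Sum.elim (fun i => C (v i)) X))

theorem Hyp.spec_dvd (H : Hyp r F g) {v : Fin m → k} {j : Fin m} (hv : v j = 0)
    {a : MvPolynomial (Fin l ⊕ (Fin m ⊕ Fin 2)) k}
    (h : free I (X (Sum.inr (Sum.inl j))) ∣ free I a) : fOf k m F ∣ spec l v a := by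
  rw [free, AlgHom.comp_apply, AlgHom.comp_apply, I.aeval_dvd_iff] at h
  obtain ⟨c, d, hd⟩ := h
  let w : Fin l ⊕ (Fin m ⊕ Fin 3) → MvPolynomial (Fin 2) k :=
    Sum.elim (fun _ => 0) (Sum.elim (fun i => C (v i)) (Fin.cons 0 X))
  have hw : ∀ p, aeval w (rename (freeY l m) p) = spec l v p := fun p => by
    rw [aeval_rename, spec]
    congr 2
    ext s
    rcases s with i | i | i <;> rfl
  have hF : spec l v (rename Sum.inr F) = fOf k m F := by
    conv_lhs => rw [H.hFg]
    rw [map_add, map_mul, rename_rename, map_add, map_mul, map_prod, map_prod,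
      Finset.prod_eq_zero (Finset.mem_univ j), zero_mul, add_zero, spec, aeval_rename]
    · conv_rhs => rw [← AlgHom.id_apply (R := k) (fOf k m F)]
      congr 1
      ext s
      simp
    · simp [spec, hv]
  have := congrArg (aeval w) hd
  rw [map_sub, map_mul, map_mul, hw, hw, stG_eq, map_sub, map_mul, hw, hw, hF, aeval_X] at this
  have hx : spec l v (X (Sum.inr (Sum.inl j))) = 0 := by simp [spec, hv]
  have h0 : w (Sum.inr (Sum.inr 0)) = 0 := rfl
  rw [hx, h0, zero_mul, sub_zero, mul_zero, zero_sub] at this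
  exact ⟨-aeval w d, by rw [this]; ring⟩

theorem free_not_isUnit (j : Fin m) : ¬ IsUnit (free I (X (Sum.inr (Sum.inl j)))) := by
  intro h
  rw [MvPolynomial.isUnit_iff_totalDegree_of_isReduced] at h
  obtain ⟨c, hc⟩ := PlaneData.totalDegree_eq_zero_iff.1 h.2
  rw [← free_C I, (free_injective I).eq_iff] at hc
  have := congrArg totalDegree hc
  simp at this

theorem Hyp.free_xMon_dvd (H : Hyp r F g) (j : Fin m) :
    free I (X (Sum.inr (Sum.inl j))) ∣ free I (rename (Sum.inr ∘ Sum.inr) (fOf k m F)) := by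
  have h1 := free_mul_y I
  have h0 := congrArg (fun p => free I (rename Sum.inr p)) H.hFg
  simp only [map_add, map_mul (rename _), map_mul (free I), rename_rename] at h0
  rw [h0, map_prod] at h1
  have h2 : (X (Sum.inr (Sum.inl j)) : MvPolynomial (Fin l ⊕ (Fin m ⊕ Fin 2)) k) ∣
      ∏ i, rename Sum.inr (X (Sum.inl i) :
      MvPolynomial (Fin m ⊕ Fin 2) k) := by
    have := Finset.dvd_prod_of_mem (fun i => (rename Sum.inr (X (Sum.inl i) :
      MvPolynomial (Fin m ⊕ Fin 2) k) : MvPolynomial (Fin l ⊕ (Fin m ⊕ Fin 2)) k))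
      (Finset.mem_univ j)
    rwa [rename_X] at this
  have h3 : X (Sum.inr (Sum.inl j)) ∣ xMon k l r :=
    (dvd_pow_self _ (by have := H.hr j; omega)).trans (Finset.dvd_prod_of_mem
      (fun i => (X (Sum.inr (Sum.inl i)) : MvPolynomial (Fin l ⊕ (Fin m ⊕ Fin 2)) k) ^ r i)
      (Finset.mem_univ j))
  rw [← sub_eq_iff_eq_add] at h1
  rw [← h1]
  refine dvd_sub ((map_dvd _ h3).mul_right _) ((map_dvd _ ?_).mul_right _)
  exact h2

theorem Hyp.prime_of_polyIso (H : Hyp r F g) (I : PolyIso (Fin N) (stG k l m r F)) :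
    Prime (fOf k m F) := by
  have hu : ¬ IsUnit (fOf k m F) := fun hu => free_not_isUnit I ⟨0, H.hm⟩
    (isUnit_of_dvd_unit (H.free_xMon_dvd I _) ((hu.map (rename _)).map (free I)))
  have hinj := free_injective I
  have hne : ∀ γ, free I (xMon k l γ) ≠ 0 := fun γ =>
    (map_ne_zero_iff _ hinj).2 (xMon_ne_zero γ)
  refine ⟨H.hf, hu, ?_⟩
  obtain ⟨p, hp, q, hq⟩ := WfDvdMonoid.exists_irreducible_factor (free_not_isUnit I ⟨0, H.hm⟩)
    ((map_ne_zero_iff _ hinj).2 (X_ne_zero _))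
  rw [UniqueFactorizationMonoid.irreducible_iff_prime] at hp
  obtain ⟨j, hj⟩ : ∃ j, free I (X (Sum.inr (Sum.inl j))) ∣ p := by
    obtain ⟨β, a, ha⟩ := exists_free I p
    obtain ⟨β', b, hb⟩ := exists_free I q
    have hab : a * b = xMon k l (Pi.single ⟨0, H.hm⟩ 1 + (β + β') • r) := by
      apply hinj
      rw [map_mul, ← ha, ← hb, xMon_add, xMon_nsmul, xMon_single, map_mul, map_pow, pow_one, hq,
        pow_add, map_mul, map_pow, map_pow]
      ring
    obtain ⟨c, δ, hc, rfl⟩ := exists_xMon_of_dvd ⟨b, hab.symm⟩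
    rw [← map_pow, ← xMon_nsmul, map_mul, free_C] at ha
    have hle : β • r ≤ δ := by
      intro j
      by_contra hlt
      have hlt' : δ j + 1 ≤ (β • r) j := Nat.succ_le_of_lt (not_le.1 hlt)
      obtain ⟨ε, hε⟩ : ∃ ε : Fin m → ℕ, β • r = Pi.single j (δ j) + (Pi.single j 1 + ε) := by
        refine ⟨fun i => (β • r) i - Pi.single (M := fun _ => ℕ) j (δ j + 1) i, ?_⟩
        ext i
        by_cases hi : i = j
        · subst hi; simp only [Pi.add_apply, Pi.single_eq_same]; omega
        · simp [Pi.single_eq_of_ne hi]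
      have hδ : δ = Pi.single j (δ j) + Function.update δ j 0 := by
        ext i
        by_cases hi : i = j
        · subst hi; simp
        · simp [hi]
      have e1 := congrArg (fun γ => free I (xMon k l γ)) hε
      have e2 := congrArg (fun γ => free I (xMon k l γ)) hδ
      simp only [xMon_add, map_mul, xMon_single j 1, pow_one] at e1 e2
      obtain ⟨d, hd⟩ := H.spec_dvd I (v := Function.update 1 j 0) (j := j) (by simp)
        (a := C c * xMon k l (Function.update δ j 0)) ⟨free I (xMon k l ε) * p, by
          refine mul_left_cancel₀ (hne (Pi.single j (δ j))) ?_
          rw [map_mul (free I) (C c), free_C]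
          linear_combination -ha + p * e1 - C c * e2⟩
      refine hu (isUnit_of_dvd_unit ⟨d, hd⟩ ?_)
      have : spec l (Function.update 1 j 0) (xMon k l (Function.update δ j 0)) = 1 := by
        simp only [xMon, spec, map_prod, map_pow, aeval_X, Sum.elim_inr, Sum.elim_inl]
        refine Finset.prod_eq_one fun i _ => ?_
        by_cases hi : i = j
        · subst hi; simp
        · simp [hi]
      rw [map_mul, this, mul_one]
      exact (((Ne.isUnit hc).map C).map _)
    obtain ⟨ε, rfl⟩ : ∃ ε, δ = β • r + ε := ⟨δ - β • r, (add_tsub_cancel_of_le hle).symm⟩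
    have hpε : p = C c * free I (xMon k l ε) := by
      refine mul_left_cancel₀ (hne (β • r)) ?_
      rw [ha, xMon_add, map_mul]
      ring
    have hε : ε ≠ 0 := by
      rintro rfl
      apply hp.not_isUnit
      rw [hpε]
      simp [xMon, hc]
    obtain ⟨j, hj⟩ := Function.ne_iff.1 hε
    refine ⟨j, ?_⟩
    rw [hpε]
    refine dvd_mul_of_dvd_right (map_dvd _ ((dvd_pow_self _ hj).trans ?_)) _
    exact Finset.dvd_prod_of_mem
      (fun i => (X (Sum.inr (Sum.inl i)) : MvPolynomial (Fin l ⊕ (Fin m ⊕ Fin 2)) k) ^ ε i)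
      (Finset.mem_univ j)
  intro a b hab
  have hdvd : p ∣ free I (rename (Sum.inr ∘ Sum.inr) (a * b)) :=
    (Dvd.intro _ hq.symm).trans ((H.free_xMon_dvd I _).trans (map_dvd _ (map_dvd _ hab)))
  have hspec : ∀ c : MvPolynomial (Fin 2) k, spec l 0 (rename (Sum.inr ∘ Sum.inr) c :
      MvPolynomial (Fin l ⊕ (Fin m ⊕ Fin 2)) k) = c := fun c => by
    rw [spec, aeval_rename]
    conv_rhs => rw [← AlgHom.id_apply (R := k) c]
    congr 1
    ext s
    simp
  rw [map_mul, map_mul] at hdvd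
  refine (hp.dvd_or_dvd hdvd).imp (fun h => ?_) (fun h => ?_)
  · have := H.spec_dvd I (v := 0) rfl (hj.trans h)
    rwa [hspec] at this
  · have := H.spec_dvd I (v := 0) rfl (hj.trans h)
    rwa [hspec] at this

end
end RingA

namespace RingA
section
variable {k : Type} {l m : ℕ} {r : Fin m → ℕ}

theorem eval_stG [CommRing k] {F : MvPolynomial (Fin m ⊕ Fin 2) k}
    (p : Fin l ⊕ (Fin m ⊕ Fin 3) → k) : eval p (stG k l m r F) =
    (∏ i, p (Sum.inr (Sum.inl i)) ^ r i) * p (Sum.inr (Sum.inr 0)) -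
      eval (Sum.elim (fun i => p (Sum.inr (Sum.inl i))) fun i =>
        p (Sum.inr (Sum.inr i.succ))) F := by
  simp only [stG, relG, incl, map_sub, map_mul, map_prod, map_pow, rename_X, eval_X, eval_rename]
  congr 1
  exact congrArg (fun w => eval w F) (funext fun s => by rcases s with i | i <;> rfl)

/-- The points of the hypersurface, sorted by their `x`-coordinates. -/
def pointsEquiv (l : ℕ) (r : Fin m → ℕ) [CommRing k] (F : MvPolynomial (Fin m ⊕ Fin 2) k) :
    {p : Fin l ⊕ (Fin m ⊕ Fin 3) → k // eval p (stG k l m r F) = 0} ≃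
      (Fin l → k) × (Σ x : Fin m → k, {u : k × (Fin 2 → k) //
        (∏ i, x i ^ r i) * u.1 = eval (Sum.elim x u.2) F}) where
  toFun p := (fun i => p.1 (Sum.inl i), ⟨fun i => p.1 (Sum.inr (Sum.inl i)),
    (p.1 (Sum.inr (Sum.inr 0)), fun i => p.1 (Sum.inr (Sum.inr i.succ))), by
      have := p.2
      rwa [eval_stG, sub_eq_zero] at this⟩)
  invFun q := ⟨Sum.elim q.1 (Sum.elim q.2.1 (Fin.cons q.2.2.1.1 q.2.2.1.2)), by
    rw [eval_stG, sub_eq_zero]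
    exact q.2.2.2⟩
  left_inv p := by
    refine Subtype.ext (funext fun s => ?_)
    rcases s with i | i | i
    · rfl
    · rfl
    · refine Fin.cases ?_ (fun j => ?_) i <;> rfl
  right_inv q := rfl

theorem card_fiber_of_ne [Field k] [Finite k] {F : MvPolynomial (Fin m ⊕ Fin 2) k} {x : Fin m → k}
    (hx : ∏ i, x i ≠ 0) :
    Nat.card {u : k × (Fin 2 → k) // (∏ i, x i ^ r i) * u.1 = eval (Sum.elim x u.2) F} =
      Nat.card k ^ 2 := by
  have hx' : ∏ i, x i ^ r i ≠ 0 := Finset.prod_ne_zero_iff.2 fun i hi =>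
    pow_ne_zero _ (Finset.prod_ne_zero_iff.1 hx i hi)
  rw [Nat.card_congr (β := Fin 2 → k)
    { toFun := fun u => u.1.2
      invFun := fun v => ⟨((∏ i, x i ^ r i)⁻¹ * eval (Sum.elim x v) F, v),
        mul_inv_cancel_left₀ hx' _⟩
      left_inv := fun u => Subtype.ext (Prod.ext (by
        change _ * eval (Sum.elim x u.1.2) F = _
        rw [← u.2, inv_mul_cancel_left₀ hx']) rfl)
      right_inv := fun v => rfl }]
  simp [Nat.card_fun]

theorem card_fiber_of_eq [Field k] [Finite k] {F g : MvPolynomial (Fin m ⊕ Fin 2) k}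
    {f : MvPolynomial (Fin 2) k} (hr : ∀ i, r i ≠ 0)
    (hF : F = rename Sum.inr f + (∏ i, X (Sum.inl i)) * g) {x : Fin m → k} (hx : ∏ i, x i = 0) :
    Nat.card {u : k × (Fin 2 → k) // (∏ i, x i ^ r i) * u.1 = eval (Sum.elim x u.2) F} =
      Nat.card k * Nat.card {v : Fin 2 → k // eval v f = 0} := by
  have hx' : ∏ i, x i ^ r i = 0 := by
    obtain ⟨i, hi, h⟩ := Finset.prod_eq_zero_iff.1 hx
    exact Finset.prod_eq_zero hi (by rw [h, zero_pow (hr i)])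
  have hf : ∀ v, eval (Sum.elim x v) F = eval v f := fun v => by
    rw [hF, map_add, map_mul, map_prod, eval_rename]
    simp [hx]
  rw [← Nat.card_prod]
  refine Nat.card_congr
    { toFun := fun u => (u.1.1, ⟨u.1.2,
        (hf _).symm.trans (u.2.symm.trans (mul_eq_zero_of_left hx' _))⟩)
      invFun := fun v => ⟨(v.1, v.2.1), by rw [hf, v.2.2, hx', zero_mul]⟩
      left_inv := fun u => rfl
      right_inv := fun v => rfl }

/-- If the hypersurface is stably an affine space over a finite field, then `f` has as many zeros
as a line. -/
theorem card_zeros [Field k] [Finite k] {F g : MvPolynomial (Fin m ⊕ Fin 2) k}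
    {f : MvPolynomial (Fin 2) k} (hm : 1 ≤ m) (hr : ∀ i, r i ≠ 0)
    (hF : F = rename Sum.inr f + (∏ i, X (Sum.inl i)) * g)
    (I : PolyIso (Fin (l + m + 2)) (stG k l m r F)) :
    Nat.card {v : Fin 2 → k // eval v f = 0} = Nat.card k := by
  classical
  have := Fintype.ofFinite k
  have h1 := Nat.card_congr ((pointsEquiv l r F).symm.trans I.points)
  rw [Nat.card_prod, Nat.card_sigma, Nat.card_fun, Nat.card_fun, Nat.card_fin, Nat.card_fin] at h1
  set q := Nat.card k with hq
  set n := Nat.card {v : Fin 2 → k // eval v f = 0}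
  have hq0 : 0 < q := Nat.card_pos
  have h2 : ∀ x : Fin m → k, Nat.card {u : k × (Fin 2 → k) //
      (∏ i, x i ^ r i) * u.1 = eval (Sum.elim x u.2) F} =
      if ∏ i, x i = 0 then q * n else q ^ 2 := by
    intro x
    split_ifs with hx
    · exact card_fiber_of_eq hr hF hx
    · exact card_fiber_of_ne hx
  simp only [h2] at h1
  rw [Finset.sum_ite, Finset.sum_const, Finset.sum_const, smul_eq_mul, smul_eq_mul] at h1
  have h3 := Finset.card_filter_add_card_filter_not (s := (Finset.univ : Finset (Fin m → k)))
    (fun x => ∏ i, x i = 0)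
  have h4 : 0 < (Finset.univ.filter fun x : Fin m → k => ∏ i, x i = 0).card :=
    Finset.card_pos.2 ⟨0, by simp [Finset.prod_eq_zero (Finset.mem_univ (⟨0, hm⟩ : Fin m))]⟩
  rw [Finset.card_univ, Fintype.card_fun, Fintype.card_fin, ← Nat.card_eq_fintype_card, ← hq] at h3
  generalize (Finset.univ.filter fun x : Fin m → k => ∏ i, x i = 0).card = b at *
  generalize (Finset.univ.filter fun x : Fin m → k => ¬ ∏ i, x i = 0).card = a at *
  rw [pow_add, pow_add, mul_assoc, ← h3] at h1
  have h5 := Nat.eq_of_mul_eq_mul_left (pow_pos hq0 l) h1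
  have h6 : b * q * n = b * q * q := by nlinarith
  exact Nat.eq_of_mul_eq_mul_left (Nat.mul_pos h4 hq0) h6

end
end RingA

/-- A surjective endomorphism of a Noetherian ring is injective. -/
theorem injective_of_surjective_endomorphism {S : Type} [CommRing S] [IsNoetherianRing S]
    (φ : S →+* S) (hφ : Function.Surjective φ) : Function.Injective φ := by
  let K : ℕ →o Ideal S := ⟨fun n => RingHom.ker (φ ^ n), monotone_nat_of_le_succ fun n x hx => by
    rw [RingHom.mem_ker] at hx ⊢
    rw [pow_succ', RingHom.mul_def, RingHom.comp_apply, hx, map_zero]⟩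
  obtain ⟨n, hn⟩ := monotone_stabilizes_iff_noetherian.2 ‹_› K
  rw [injective_iff_map_eq_zero]
  intro a ha
  obtain ⟨b, rfl⟩ : ∃ b, (φ ^ n) b = a := by
    rw [RingHom.coe_pow]
    exact hφ.iterate n a
  have : b ∈ K (n + 1) := by
    change b ∈ RingHom.ker (φ ^ (n + 1))
    rw [RingHom.mem_ker, pow_succ', RingHom.mul_def, RingHom.comp_apply, ha]
  rw [← hn (n + 1) n.le_succ] at this
  exact this

/-- Polynomial identities witnessing that two polynomials generate `S[X, Y]`. -/
structure Coords (S : Type) [CommRing S] where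
  /-- The coordinates. -/
  v : Fin 2 → MvPolynomial (Fin 2) S
  /-- The variables in terms of the coordinates. -/
  u : Fin 2 → MvPolynomial (Fin 2) S
  aeval_v : ∀ i, aeval v (u i) = X i
  aeval_u : ∀ i, aeval u (v i) = X i

/-- The polynomial `a₀(X) + a₁(X) Y`. -/
def linPoly {S : Type} [CommRing S] (a₀ a₁ : Polynomial S) : MvPolynomial (Fin 2) S :=
  Polynomial.aeval (X 0) a₀ + Polynomial.aeval (X 0) a₁ * X 1

/-- The isomorphism `S[X, Y] → S[X][Y]`. -/
def toPoly₂ (S : Type) [CommRing S] : MvPolynomial (Fin 2) S →ₐ[S] Polynomial (Polynomial S) :=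
  aeval ![Polynomial.C Polynomial.X, Polynomial.X]

section
variable {S S' : Type} [CommRing S] [CommRing S']

theorem toPoly₂_aeval (a : Polynomial S) :
    toPoly₂ S (Polynomial.aeval (X 0) a) = Polynomial.C a := by
  rw [← Polynomial.aeval_algHom_apply]
  have : (Polynomial.CAlgHom : Polynomial S →ₐ[S] Polynomial (Polynomial S)) =
      Polynomial.aeval (toPoly₂ S (X 0)) := by
    ext
    simp [toPoly₂]
  exact (DFunLike.congr_fun this a).symm

theorem toPoly₂_linPoly (a₀ a₁ : Polynomial S) :
    toPoly₂ S (linPoly a₀ a₁) = Polynomial.C a₁ * Polynomial.X + Polynomial.C a₀ := by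
  rw [linPoly, map_add, map_mul, toPoly₂_aeval, toPoly₂_aeval, add_comm]
  simp [toPoly₂]

theorem map_linPoly (φ : S →+* S') (a₀ a₁ : Polynomial S) :
    map φ (linPoly a₀ a₁) = linPoly (a₀.map φ) (a₁.map φ) := by
  have h : ∀ a : Polynomial S, map φ (Polynomial.aeval (X 0 : MvPolynomial (Fin 2) S) a) =
      Polynomial.aeval (X 0) (a.map φ) := fun a => by
    induction a using Polynomial.induction_on with
    | C c => simp
    | add p q hp hq => simp only [map_add, Polynomial.map_add, hp, hq]
    | monomial n c _ => simp
  rw [linPoly, map_add, map_mul, h, h, map_X, linPoly]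

theorem eval_linPoly (a₀ a₁ : Polynomial S) (w : Fin 2 → S) :
    eval w (linPoly a₀ a₁) = a₀.eval (w 0) + a₁.eval (w 0) * w 1 := by
  have h : ∀ a : Polynomial S, eval w (Polynomial.aeval (X 0 : MvPolynomial (Fin 2) S) a) =
      a.eval (w 0) := fun a => by
    induction a using Polynomial.induction_on with
    | C c => simp
    | add p q hp hq => simp only [map_add, Polynomial.eval_add, hp, hq]
    | monomial n c _ => simp
  rw [linPoly, map_add, map_mul, h, h, eval_X]

namespace Coords

/-- Base change of coordinates. -/
def map (φ : S →+* S') (C : Coords S) : Coords S' where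
  v i := MvPolynomial.map φ (C.v i)
  u i := MvPolynomial.map φ (C.u i)
  aeval_v i := by rw [PolyIso.aeval_map, C.aeval_v, map_X]
  aeval_u i := by rw [PolyIso.aeval_map, C.aeval_u, map_X]

/-- The automorphism of `S[X, Y]` given by coordinates. -/
def equiv (C : Coords S) : MvPolynomial (Fin 2) S ≃ₐ[S] MvPolynomial (Fin 2) S :=
  AlgEquiv.ofAlgHom (aeval C.v) (aeval C.u) 
    (by ext i : 1; rw [AlgHom.comp_apply, aeval_X, C.aeval_v, AlgHom.id_apply])
    (by ext i : 1; rw [AlgHom.comp_apply, aeval_X, C.aeval_u, AlgHom.id_apply])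

/-- The bijection on points given by coordinates. -/
def points (C : Coords S) : (Fin 2 → S) ≃ (Fin 2 → S) where
  toFun w i := eval w (C.v i)
  invFun w i := eval w (C.u i)
  left_inv w := funext fun i => by
    change eval (fun j => eval w (C.v j)) (C.u i) = w i
    rw [PolyIso.eval_comp, C.aeval_v, eval_X]
  right_inv w := funext fun i => by
    change eval (fun j => eval w (C.u j)) (C.v i) = w i
    rw [PolyIso.eval_comp, C.aeval_u, eval_X]

theorem exists_of_adjoin {k : Type} [Field k] {h t : MvPolynomial (Fin 2) k}
    (hht : Algebra.adjoin k {h, t} = ⊤) : ∃ C : Coords k, C.v 0 = h ∧ C.v 1 = t := by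
  have hs : Function.Surjective (aeval ![h, t] : MvPolynomial (Fin 2) k →ₐ[k] _) := by
    rw [← AlgHom.range_eq_top, ← Algebra.adjoin_range_eq_range_aeval, ← hht]
    congr 1
    simp [Matrix.range_cons, Set.pair_comm]
  have hi : Function.Injective (aeval ![h, t] : MvPolynomial (Fin 2) k →ₐ[k] _) :=
    injective_of_surjective_endomorphism (S := MvPolynomial (Fin 2) k)
      (aeval ![h, t] : MvPolynomial (Fin 2) k →ₐ[k] MvPolynomial (Fin 2) k).toRingHom hs
  choose u hu using fun i => hs (X i)
  refine ⟨⟨![h, t], u, hu, fun i => hi ?_⟩, rfl, rfl⟩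
  have : (aeval ![h, t]).comp (aeval u) = AlgHom.id k (MvPolynomial (Fin 2) k) := by
    ext i : 1
    rw [AlgHom.comp_apply, aeval_X, hu, AlgHom.id_apply]
  have := DFunLike.congr_fun this (![h, t] i)
  rw [AlgHom.comp_apply] at this
  rw [this, aeval_X, AlgHom.id_apply]

end Coords
end

/-- A variable of `k[Z, T]`. -/
def IsCoord {k : Type} [CommRing k] (f : MvPolynomial (Fin 2) k) : Prop :=
  ∃ σ : MvPolynomial (Fin 2) k ≃ₐ[k] MvPolynomial (Fin 2) k, σ (X 0) = f

section
variable {k : Type} [Field k] {a₀ a₁ : Polynomial k}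

theorem isCoord_X_one : IsCoord (X 1 : MvPolynomial (Fin 2) k) :=
  ⟨renameEquiv k (Equiv.swap 0 1), by simp⟩

theorem isCoord_linPoly_C (a : Polynomial k) {c : k} (hc : c ≠ 0) :
    IsCoord (linPoly a (Polynomial.C c)) := by
  obtain ⟨σ, hσ⟩ := isCoord_X_one (k := k)
  have h : ∀ v : Fin 2 → MvPolynomial (Fin 2) k, v 0 = X 0 →
      aeval v (Polynomial.aeval (X 0 : MvPolynomial (Fin 2) k) a) = Polynomial.aeval (X 0) a := by
    intro v hv
    rw [← Polynomial.aeval_algHom_apply, aeval_X, hv]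
  refine ⟨σ.trans (AlgEquiv.ofAlgHom (aeval ![X 0, linPoly a (Polynomial.C c)])
    (aeval ![X 0, C c⁻¹ * (X 1 - Polynomial.aeval (X 0) a)]) ?_ ?_), ?_⟩
  · ext i : 1
    fin_cases i
    · simp
    · rw [Fin.mk_one, AlgHom.comp_apply, aeval_X, AlgHom.id_apply]
      change aeval _ (C c⁻¹ * (X 1 - Polynomial.aeval (X 0) a)) = _
      rw [map_mul, map_sub, h _ (by simp), linPoly]
      simp [algebraMap_eq, ← mul_assoc, ← map_mul, hc]
  · ext i : 1
    fin_cases i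
    · simp
    · rw [Fin.mk_one, AlgHom.comp_apply, aeval_X, AlgHom.id_apply]
      change aeval _ (linPoly a (Polynomial.C c)) = _
      rw [linPoly, map_add, map_mul, h _ (by simp)]
      simp [algebraMap_eq, ← mul_assoc, ← map_mul, hc]
  · rw [AlgEquiv.trans_apply, hσ]
    simp

theorem isCoord_linPoly_zero {a : Polynomial k} (ha : a.natDegree = 1) :
    IsCoord (linPoly a 0) := by
  obtain ⟨σ, hσ⟩ := isCoord_linPoly_C (k := k) (Polynomial.C (a.coeff 0)) (c := a.coeff 1) (by
    rw [← ha]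
    exact Polynomial.leadingCoeff_ne_zero.2 fun h => by simp [h] at ha)
  refine ⟨σ.trans (renameEquiv k (Equiv.swap 0 1)), ?_⟩
  rw [AlgEquiv.trans_apply, hσ]
  conv_rhs => rw [Polynomial.eq_X_add_C_of_natDegree_le_one ha.le]
  simp [linPoly, add_comm]

theorem toPoly₂_isUnit {p : MvPolynomial (Fin 2) k} (h : IsUnit p) :
    (toPoly₂ k p).natDegree = 0 := Polynomial.natDegree_eq_zero_of_isUnit (h.map (toPoly₂ k))

theorem isCoprime_of_irreducible_linPoly (h : Irreducible (linPoly a₀ a₁)) (h1 : a₁ ≠ 0) :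
    IsCoprime a₀ a₁ := by
  refine isCoprime_of_prime_dvd (fun h' => h1 h'.2) ?_
  rintro p hp ⟨b₀, rfl⟩ ⟨b₁, rfl⟩
  have : linPoly (p * b₀) (p * b₁) = Polynomial.aeval (X 0) p * linPoly b₀ b₁ := by
    simp only [linPoly, map_mul]
    ring
  rcases h.isUnit_or_isUnit this with h | h
  · have := h.map (toPoly₂ k)
    rw [toPoly₂_aeval, Polynomial.isUnit_C] at this
    exact hp.not_isUnit this
  · have := toPoly₂_isUnit h
    rw [toPoly₂_linPoly, Polynomial.natDegree_linear (right_ne_zero_of_mul h1)] at this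
    exact one_ne_zero this

/-- A polynomial `a₀(X) + a₁(X) Y` whose zero locus has only trivial units is a variable. -/
theorem linPoly_dichotomy {D : Type} [CommRing D] [IsDomain D] [Algebra k D]
    (hD : ∀ d : D, IsUnit d → ∃ c : k, d = algebraMap k D c)
    (φ : MvPolynomial (Fin 2) k →ₐ[k] D) (hφ : ∀ p, φ p = 0 ↔ linPoly a₀ a₁ ∣ p)
    (h0 : linPoly a₀ a₁ ≠ 0) :
    (a₁ = 0 ∧ a₀.natDegree = 1) ∨ ∃ c : k, c ≠ 0 ∧ a₁ = Polynomial.C c := by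
  have hp : Prime (linPoly a₀ a₁) := by
    refine ⟨h0, fun h => one_ne_zero (α := D) ?_, fun p q h => ?_⟩
    · rw [← map_one φ, hφ]
      exact h.dvd
    · rw [← hφ, map_mul, mul_eq_zero, hφ, hφ] at h
      exact h
  have hl : φ (linPoly a₀ a₁) = 0 := (hφ _).2 dvd_rfl
  by_cases h1 : a₁ = 0
  · subst h1
    have h0' : a₀ ≠ 0 := by
      rintro rfl
      exact h0 (by simp [linPoly])
    obtain ⟨c, hc⟩ : ∃ c : k, φ (X 0) = algebraMap k D c := by
      by_cases hx : φ (X 0) = 0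
      · exact ⟨0, by rw [hx, map_zero]⟩
      · refine hD _ (IsIntegral.isUnit (isAlgebraic_iff_isIntegral.1 ⟨a₀, h0', ?_⟩) hx)
        rw [Polynomial.aeval_algHom_apply]
        simpa [linPoly] using hl
    have hc : a₀ ∣ Polynomial.X - Polynomial.C c := by
      rw [← φ.commutes, ← sub_eq_zero, ← map_sub, hφ] at hc
      have := map_dvd (aeval ![Polynomial.X, 0] : MvPolynomial (Fin 2) k →ₐ[k] Polynomial k) hc
      rw [linPoly, map_zero, zero_mul, add_zero, ← Polynomial.aeval_algHom_apply, map_sub, aeval_X,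
        AlgHom.commutes] at this
      simpa using this
    refine Or.inl ⟨rfl, le_antisymm ?_ ?_⟩
    · simpa using Polynomial.natDegree_le_of_dvd hc (Polynomial.X_sub_C_ne_zero c)
    · rw [Nat.one_le_iff_ne_zero]
      intro h
      rw [Polynomial.eq_C_of_natDegree_eq_zero h] at hp h0'
      refine hp.not_isUnit ?_
      rw [Ne, Polynomial.C_eq_zero] at h0'
      simp [linPoly, algebraMap_eq, h0']
  · right
    obtain ⟨s, t, hst⟩ := isCoprime_of_irreducible_linPoly hp.irreducible h1
    obtain ⟨c, hc⟩ := hD (φ (Polynomial.aeval (X 0) a₁)) (by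
      have := congrArg (fun a => φ (Polynomial.aeval (X 0 : MvPolynomial (Fin 2) k) a)) hst
      simp only [linPoly, map_add, map_mul, map_one] at this hl
      refine IsUnit.of_mul_eq_one (φ (Polynomial.aeval (X 0) t) -
        φ (Polynomial.aeval (X 0) s) * φ (X 1)) ?_
      linear_combination this - φ (Polynomial.aeval (X 0) s) * hl)
    rw [← φ.commutes, ← sub_eq_zero, ← map_sub, hφ] at hc
    have hc := map_dvd (toPoly₂ k) hc
    rw [toPoly₂_linPoly, map_sub, toPoly₂_aeval, AlgHom.commutes, Polynomial.algebraMap_apply,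
      Polynomial.algebraMap_eq, ← map_sub Polynomial.C] at hc
    have : a₁ - Polynomial.C c = 0 := by
      by_contra h
      have := Polynomial.natDegree_le_of_dvd hc (Polynomial.C_ne_zero.2 h)
      rw [Polynomial.natDegree_linear h1, Polynomial.natDegree_C] at this
      omega
    rw [sub_eq_zero] at this
    refine ⟨c, ?_, this⟩
    rintro rfl
    exact h1 (by simpa using this)

end

theorem Coords.aeval_linPoly {S : Type} [CommRing S] (C : Coords S) (a₀ a₁ : Polynomial S) :
    C.equiv (linPoly a₀ a₁) =
      Polynomial.aeval (C.v 0) a₀ + Polynomial.aeval (C.v 0) a₁ * C.v 1 := by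
  change aeval C.v (linPoly a₀ a₁) = _
  rw [linPoly, map_add, map_mul, ← Polynomial.aeval_algHom_apply, ← Polynomial.aeval_algHom_apply,
    aeval_X, aeval_X]

theorem Coords.map_equiv {S S' : Type} [CommRing S] [CommRing S'] (C : Coords S) (φ : S →+* S')
    (p : MvPolynomial (Fin 2) S) :
    MvPolynomial.map φ (C.equiv p) = (C.map φ).equiv (MvPolynomial.map φ p) :=
  (PolyIso.aeval_map φ C.v p).symm

section
variable {k : Type} [Field k]

theorem PlaneData.exists_linPoly {f : MvPolynomial (Fin 2) k} (D : PlaneData f) :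
    ∃ (C : Coords k) (a₀ a₁ : Polynomial k), f = C.equiv (linPoly a₀ a₁) := by
  obtain ⟨h, t, hht, hf⟩ := D.exists_coords
  obtain ⟨C, rfl, rfl⟩ := Coords.exists_of_adjoin hht
  rcases hf with ⟨R, hR⟩ | ⟨a₀, a₁, -, hf⟩
  · exact ⟨C, R, 0, by rw [C.aeval_linPoly, hR]; simp⟩
  · exact ⟨C, a₀, a₁, by rw [C.aeval_linPoly, hf]⟩

theorem IsCoord.map_equiv {p : MvPolynomial (Fin 2) k} (hp : IsCoord p)
    (τ : MvPolynomial (Fin 2) k ≃ₐ[k] MvPolynomial (Fin 2) k) : IsCoord (τ p) := by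
  obtain ⟨σ, rfl⟩ := hp
  exact ⟨σ.trans τ, rfl⟩

/-- `a₀(X) + a₁(X) Y` is a variable if `a₀` is linear and `a₁ = 0`, or if `a₁` is a nonzero
constant. -/
theorem isCoord_linPoly {κ : Type} [Field κ] (ι : k →+* κ) {a₀ a₁ : Polynomial k}
    (h : (a₁.map ι = 0 ∧ (a₀.map ι).natDegree = 1) ∨ ∃ c : κ, c ≠ 0 ∧ a₁.map ι = Polynomial.C c) :
    IsCoord (linPoly a₀ a₁) := by
  rcases h with ⟨h, h'⟩ | ⟨c, hc, h⟩
  · rw [Polynomial.map_eq_zero] at h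
    rw [Polynomial.natDegree_map] at h'
    rw [h]
    exact isCoord_linPoly_zero h'
  · have : a₁.natDegree = 0 := by
      rw [← Polynomial.natDegree_map ι, h, Polynomial.natDegree_C]
    rw [Polynomial.eq_C_of_natDegree_eq_zero this] at h ⊢
    refine isCoord_linPoly_C _ fun h' => hc ?_
    rw [h', map_zero, Polynomial.map_zero] at h
    exact (Polynomial.C_eq_zero.1 h.symm)

/-- If, over some field extension, the zero locus of `f` is integral with only trivial units, then
plane data for `f` make `f` a variable. -/
theorem PlaneData.isCoord {f : MvPolynomial (Fin 2) k} (P : PlaneData f) (hf : f ≠ 0)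
    {κ D : Type} [Field κ] (ι : k →+* κ) [CommRing D] [IsDomain D] [Algebra κ D]
    (hD : ∀ d : D, IsUnit d → ∃ c : κ, d = algebraMap κ D c)
    (φ : MvPolynomial (Fin 2) κ →ₐ[κ] D) (hφ : ∀ p, φ p = 0 ↔ map ι f ∣ p) : IsCoord f := by
  obtain ⟨C, a₀, a₁, rfl⟩ := P.exists_linPoly
  refine (isCoord_linPoly ι ?_).map_equiv _
  refine linPoly_dichotomy hD (φ.comp (C.map ι).equiv) (fun p => ?_) ?_
  · rw [AlgHom.comp_apply, hφ, C.map_equiv, map_linPoly]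
    exact map_dvd_iff (C.map ι).equiv
  · rw [← map_linPoly]
    intro h
    rw [map_eq_zero_iff _ (map_injective _ ι.injective)] at h
    exact hf (by rw [h, map_zero])

theorem Polynomial.eq_algebraMap_of_isUnit (d : Polynomial k) (h : IsUnit d) :
    ∃ c : k, d = algebraMap k (Polynomial k) c := by
  obtain ⟨c, -, rfl⟩ := Polynomial.isUnit_iff.1 h
  exact ⟨c, rfl⟩

theorem MvPolynomial.eq_algebraMap_of_isUnit {σ : Type} (d : MvPolynomial σ k) (h : IsUnit d) :
    ∃ c : k, d = algebraMap k (MvPolynomial σ k) c := by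
  rw [MvPolynomial.isUnit_iff_totalDegree_of_isReduced] at h
  exact ⟨_, (totalDegree_eq_zero_iff_eq_C.1 h.2)⟩

end

theorem isJacobsonRing_int : IsJacobsonRing ℤ := by
  refine isJacobsonRing_iff_prime_eq.2 fun P hP => ?_
  by_cases h : P = ⊥
  · subst h
    refine le_antisymm (fun x hx => ?_) Ideal.le_jacobson
    have := Ideal.mem_jacobson_bot.1 hx x
    rw [Ideal.mem_bot]
    rcases Int.isUnit_iff.1 this with h | h <;> nlinarith
  · have : P.IsMaximal := hP.isMaximal h
    exact Ideal.jacobson_eq_self_of_isMaximal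

/-- A field that is finitely generated as a ring is finite. -/
theorem finite_of_finiteType_int (κ : Type) [Field κ] [Algebra.FiniteType ℤ κ] : Finite κ := by
  have := isJacobsonRing_int
  have : Module.Finite ℤ κ := finite_of_finite_type_of_isJacobsonRing ℤ κ
  refine Module.finite_of_fg_torsion κ ?_
  obtain ⟨n, hn, h⟩ : ∃ n : ℤ, n ≠ 0 ∧ (n : κ) = 0 := by
    by_contra! h
    refine Int.not_isField (isField_of_isIntegral_of_isField (R := ℤ) (S := κ) ?_
      (Field.toIsField κ))
    exact (injective_iff_map_eq_zero _).2 fun n hn => by_contra fun h' => h n h' (by simpa using hn)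
  intro x
  exact ⟨⟨n, mem_nonZeroDivisors_of_ne_zero hn⟩, by
    change n • x = 0
    rw [zsmul_eq_mul, h, zero_mul]⟩

theorem exists_finite_field (R : Type) [CommRing R] [Nontrivial R] [Algebra.FiniteType ℤ R] :
    ∃ (κ : Type) (_ : Field κ) (_ : Finite κ), Nonempty (R →+* κ) := by
  obtain ⟨M, hM⟩ := Ideal.exists_maximal R
  have : Algebra.FiniteType ℤ (R ⧸ M) := Algebra.FiniteType.of_surjective
    (Ideal.Quotient.mkₐ ℤ M) (Ideal.Quotient.mkₐ_surjective ℤ M)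
  exact ⟨R ⧸ M, Ideal.Quotient.field M, @finite_of_finiteType_int _ (Ideal.Quotient.field M) this,
    ⟨Ideal.Quotient.mk M⟩⟩

namespace RingA

/-- Polynomial identities saying that `A` is stably an affine space, while in some coordinates
`f = a₀(X) + a₁(X) Y` with `a₀`, `a₁` coprime and `a₁` having a root. -/
structure Spread (l m : ℕ) (r : Fin m → ℕ) (S : Type) [CommRing S] where
  /-- The polynomial defining `A`. -/
  F : MvPolynomial (Fin m ⊕ Fin 2) S
  /-- The cofactor. -/
  g : MvPolynomial (Fin m ⊕ Fin 2) S
  /-- The coordinates. -/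
  C : Coords S
  /-- The constant term. -/
  a₀ : Polynomial S
  /-- The linear coefficient. -/
  a₁ : Polynomial S
  /-- A Bézout coefficient. -/
  b₀ : Polynomial S
  /-- A Bézout coefficient. -/
  b₁ : Polynomial S
  /-- The root. -/
  α : S
  hF : F = rename Sum.inr (C.equiv (linPoly a₀ a₁)) + (∏ i, X (Sum.inl i)) * g
  /-- The isomorphism. -/
  I : PolyIso (Fin (l + m + 2)) (stG S l m r F)
  bezout : b₀ * a₀ + b₁ * a₁ = 1
  hα : a₁.eval α = 0

namespace Spread
variable {l m : ℕ} {r : Fin m → ℕ}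

/-- Base change. -/
def map {S S' : Type} [CommRing S] [CommRing S'] (D : Spread l m r S) (φ : S →+* S') :
    Spread l m r S' where
  F := MvPolynomial.map φ D.F
  g := MvPolynomial.map φ D.g
  C := D.C.map φ
  a₀ := D.a₀.map φ
  a₁ := D.a₁.map φ
  b₀ := D.b₀.map φ
  b₁ := D.b₁.map φ
  α := φ D.α
  hF := by
    conv_lhs => rw [D.hF]
    rw [map_add, map_rename, D.C.map_equiv, map_linPoly, map_mul, map_prod]
    simp
  I := map_stG φ l ▸ D.I.map φ
  bezout := by
    rw [← Polynomial.map_mul, ← Polynomial.map_mul, ← Polynomial.map_add, D.bezout,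
      Polynomial.map_one]
  hα := by rw [Polynomial.eval_map_apply, D.hα, map_zero]

theorem false_of_finite {κ : Type} [Field κ] [Finite κ] (hm : 1 ≤ m) (hr : ∀ i, r i ≠ 0)
    (D : Spread l m r κ) : False := by
  classical
  have h := card_zeros hm hr D.hF D.I
  have h' : Nat.card {v : Fin 2 → κ // eval v (D.C.equiv (linPoly D.a₀ D.a₁)) = 0} <
      Nat.card κ := by
    have hα := D.hα
    have hb : ∀ x, D.a₁.eval x = 0 → D.a₀.eval x ≠ 0 := fun x hx hx' => by
      have := congrArg (Polynomial.eval x) D.bezout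
      rw [Polynomial.eval_add, Polynomial.eval_mul, Polynomial.eval_mul, hx, hx'] at this
      simp at this
    have key : ∀ v : Fin 2 → κ, eval v (D.C.equiv (linPoly D.a₀ D.a₁)) =
        D.a₀.eval (D.C.points v 0) + D.a₁.eval (D.C.points v 0) * D.C.points v 1 := fun v => by
      rw [← eval_linPoly]
      exact (PolyIso.eval_comp _ _ _).symm
    have := Fintype.ofFinite κ
    rw [Nat.card_eq_fintype_card, Nat.card_eq_fintype_card]
    refine Fintype.card_lt_of_injective_of_notMem
      (f := fun v : {v : Fin 2 → κ // eval v (D.C.equiv (linPoly D.a₀ D.a₁)) = 0} =>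
        D.C.points v.1 0) ?_ (b := D.α) ?_
    · rintro ⟨v, hv⟩ ⟨w, hw⟩ (hvw : D.C.points v 0 = D.C.points w 0)
      rw [key] at hv hw
      refine Subtype.ext (D.C.points.injective (funext fun i => ?_))
      fin_cases i
      · exact hvw
      · change D.C.points v 1 = D.C.points w 1
        rw [hvw] at hv
        have h1 : D.a₁.eval (D.C.points w 0) ≠ 0 := fun h1 => hb _ h1 (by
          rwa [h1, zero_mul, add_zero] at hw)
        exact mul_left_cancel₀ h1 (by linear_combination hv - hw)
    · rintro ⟨⟨v, hv⟩, h1⟩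
      rw [key] at hv
      replace h1 : D.a₁.eval (D.C.points v 0) = 0 :=
        (congrArg (fun x => D.a₁.eval x) h1).trans D.hα
      rw [h1, zero_mul, add_zero] at hv
      exact hb _ h1 hv
  omega

theorem _root_.PolyIso.nonempty_of_map {S S' σ ι : Type} [CommRing S] [CommRing S']
    {φ : S →+* S'} (hφ : Function.Injective φ) {G : MvPolynomial σ S}
    {G' : MvPolynomial σ S'} (hG : MvPolynomial.map φ G = G') (I : PolyIso ι G')
    (hP : ∀ s, I.P s ∈ Set.range (MvPolynomial.map φ))
    (hQ : ∀ s, I.Q s ∈ Set.range (MvPolynomial.map φ))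
    (hH : ∀ s, I.H s ∈ Set.range (MvPolynomial.map φ)) : Nonempty (PolyIso ι G) := by
  subst hG
  choose P hP using hP
  choose Q hQ using hQ
  choose H hH using hH
  refine ⟨⟨P, Q, H, map_injective _ hφ ?_, fun j => map_injective _ hφ ?_,
    fun s => map_injective _ hφ ?_⟩⟩
  · simp only [← PolyIso.aeval_map, hP, I.aeval_G, map_zero]
  · simp only [← PolyIso.aeval_map, hP, hQ, I.aeval_Q, map_X]
  · simp only [← PolyIso.aeval_map, hP, hQ, I.aeval_P, map_X, map_add, map_mul, hH]

/-- Such data descend to a finitely generated ring. -/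
theorem exists_descent {L : Type} [Field L] (D : Spread l m r L) :
    ∃ (R : Type) (_ : CommRing R) (_ : Nontrivial R), Algebra.FiniteType ℤ R ∧
      Nonempty (Spread l m r R) := by
  classical
  obtain ⟨T, TF, Tg, Tv, Tu, Ta₀, Ta₁, Tb₀, Tb₁, Tα, TP, TQ, TH⟩ : ∃ T : Finset L,
      D.F.coeffs ⊆ T ∧ D.g.coeffs ⊆ T ∧
      (Finset.univ.biUnion fun i => (D.C.v i).coeffs) ⊆ T ∧
      (Finset.univ.biUnion fun i => (D.C.u i).coeffs) ⊆ T ∧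
      D.a₀.coeffs ⊆ T ∧ D.a₁.coeffs ⊆ T ∧ D.b₀.coeffs ⊆ T ∧ D.b₁.coeffs ⊆ T ∧ {D.α} ⊆ T ∧
      (Finset.univ.biUnion fun i => (D.I.P i).coeffs) ⊆ T ∧
      (Finset.univ.biUnion fun i => (D.I.Q i).coeffs) ⊆ T ∧
      (Finset.univ.biUnion fun i => (D.I.H i).coeffs) ⊆ T := by
    refine ⟨D.F.coeffs ∪ D.g.coeffs ∪ (Finset.univ.biUnion fun i => (D.C.v i).coeffs) ∪
      (Finset.univ.biUnion fun i => (D.C.u i).coeffs) ∪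
      D.a₀.coeffs ∪ D.a₁.coeffs ∪ D.b₀.coeffs ∪ D.b₁.coeffs ∪ {D.α} ∪
      (Finset.univ.biUnion fun i => (D.I.P i).coeffs) ∪
      (Finset.univ.biUnion fun i => (D.I.Q i).coeffs) ∪
      (Finset.univ.biUnion fun i => (D.I.H i).coeffs), ?_⟩
    refine ⟨?_, ?_, ?_, ?_, ?_, ?_, ?_, ?_, ?_, ?_, ?_, ?_⟩ <;> intro x hx <;>
      simp only [Finset.mem_union, hx, true_or, or_true]
  let R := Algebra.adjoin ℤ (T : Set L)
  have hR : Algebra.FiniteType ℤ R := .adjoin_of_finite T.finite_toSet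
  let φ : R →+* L := R.val
  have hφ : Function.Injective φ := Subtype.val_injective
  have hT : ∀ x ∈ T, x ∈ Set.range φ := fun x hx => ⟨⟨x, Algebra.subset_adjoin hx⟩, rfl⟩
  have lift : ∀ {σ : Type} (p : MvPolynomial σ L), p.coeffs ⊆ T →
      p ∈ Set.range (MvPolynomial.map φ) := fun p hp =>
    mem_range_map_iff_coeffs_subset.2 fun x hx => hT x (hp hx)
  have lift' : ∀ p : Polynomial L, p.coeffs ⊆ T → ∃ q : Polynomial R, q.map φ = p := fun p hp =>
    (Polynomial.mem_lifts _).1 ((Polynomial.lifts_iff_coeffs_subset_range _).2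
      fun x hx => hT x (hp hx))
  have mem : ∀ {ι : Type} [Fintype ι] {σ : Type} (p : ι → MvPolynomial σ L),
      (Finset.univ.biUnion fun i => (p i).coeffs) ⊆ T →
        ∀ i, p i ∈ Set.range (MvPolynomial.map φ) := fun p hp i =>
    lift _ fun x hx => hp (Finset.mem_biUnion.2 ⟨i, Finset.mem_univ _, hx⟩)
  obtain ⟨F, hF⟩ := lift D.F TF
  obtain ⟨g, hg⟩ := lift D.g Tg
  choose v hv using mem D.C.v Tv
  choose u hu using mem D.C.u Tu
  obtain ⟨a₀, ha₀⟩ := lift' D.a₀ Ta₀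
  obtain ⟨a₁, ha₁⟩ := lift' D.a₁ Ta₁
  obtain ⟨b₀, hb₀⟩ := lift' D.b₀ Tb₀
  obtain ⟨b₁, hb₁⟩ := lift' D.b₁ Tb₁
  obtain ⟨α, hα⟩ := hT D.α (Tα (Finset.mem_singleton_self _))
  obtain ⟨I⟩ := PolyIso.nonempty_of_map hφ ((map_stG φ l).trans (by rw [hF])) D.I
    (mem _ TP) (mem _ TQ) (mem _ TH)
  let C : Coords R :=
    { v := v
      u := u
      aeval_v := fun i => map_injective _ hφ (by
        simp only [← PolyIso.aeval_map, hv, hu, D.C.aeval_v, map_X])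
      aeval_u := fun i => map_injective _ hφ (by
        simp only [← PolyIso.aeval_map, hv, hu, D.C.aeval_u, map_X]) }
  have hC : C.map φ = D.C := by
    cases hDC : D.C
    simp only [Coords.map, C, Coords.mk.injEq]
    rw [hDC] at hv hu
    exact ⟨funext hv, funext hu⟩
  refine ⟨R, inferInstance, inferInstance, hR, ⟨{
    F := F, g := g, C := C, a₀ := a₀, a₁ := a₁, b₀ := b₀, b₁ := b₁, α := α, I := I
    hF := map_injective _ hφ ?_
    bezout := Polynomial.map_injective _ hφ ?_
    hα := hφ ?_ }⟩⟩
  · rw [hF, map_add, map_rename, C.map_equiv, map_linPoly, map_mul, map_prod, hC, ha₀, ha₁, hg]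
    simp only [map_X]
    exact D.hF
  · rw [Polynomial.map_add, Polynomial.map_mul, Polynomial.map_mul, ha₀, ha₁, hb₀, hb₁, D.bezout,
      Polynomial.map_one]
  · rw [← Polynomial.eval_map_apply, ha₁, hα, D.hα, map_zero]

theorem false {L : Type} [Field L] (hm : 1 ≤ m) (hr : ∀ i, r i ≠ 0) (D : Spread l m r L) :
    False := by
  obtain ⟨R, _, _, _, ⟨D⟩⟩ := D.exists_descent
  obtain ⟨κ, _, _, ⟨φ⟩⟩ := exists_finite_field R
  exact (D.map φ).false_of_finite hm hr

end Spread
end RingA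

theorem natDegree_eq_one_of_prime_linPoly {L : Type} [Field L] [IsAlgClosed L] {a : Polynomial L}
    (h : Prime (linPoly a 0)) : a.natDegree = 1 := by
  have ha : linPoly a 0 = Polynomial.aeval (X 0) a := by simp [linPoly]
  rw [ha] at h
  have h0 : a ≠ 0 := by
    rintro rfl
    exact h.ne_zero (map_zero _)
  have hu : ∀ b : Polynomial L, IsUnit (Polynomial.aeval (X 0 : MvPolynomial (Fin 2) L) b) ↔
      IsUnit b := fun b => by
    refine ⟨fun hb => ?_, fun hb => hb.map _⟩
    have := hb.map (toPoly₂ L)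
    rwa [toPoly₂_aeval, Polynomial.isUnit_C] at this
  have hirr : Irreducible a := by
    refine ⟨fun h' => h.not_isUnit ((hu _).2 h'), fun p q hpq => ?_⟩
    rw [← hu, ← hu]
    exact h.irreducible.isUnit_or_isUnit (by rw [hpq, map_mul])
  exact Polynomial.natDegree_eq_of_degree_eq_some (IsAlgClosed.degree_eq_one_of_irreducible L hirr)

namespace RingA
section
variable {k : Type} [Field k] {m : ℕ} {r : Fin m → ℕ} {F g : MvPolynomial (Fin m ⊕ Fin 2) k}

theorem fOf_map {S S' : Type} [CommRing S] [CommRing S'] (φ : S →+* S')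
    (F : MvPolynomial (Fin m ⊕ Fin 2) S) : fOf S' m (map φ F) = map φ (fOf S m F) := by
  rw [fOf, fOf, ← PolyIso.aeval_map]
  congr 2
  funext s
  rcases s with i | i <;> simp

theorem Hyp.map (H : Hyp r F g) {L : Type} [Field L] (φ : k →+* L) :
    Hyp r (MvPolynomial.map φ F) (MvPolynomial.map φ g) where
  hm := H.hm
  hr := H.hr
  hf := by
    rw [fOf_map]
    exact (map_ne_zero_iff _ (map_injective _ φ.injective)).2 H.hf
  hFg := by
    rw [fOf_map]
    have := congrArg (MvPolynomial.map φ) H.hFg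
    rw [map_add, map_rename, map_mul, map_prod] at this
    simpa only [map_X] using this

theorem Hyp.isCoord_of_stable [IsDomain (RingA k m r F)] (H : Hyp r F g)
    (hml : MakarLimanov k (RingA k m r F) = ⊥) {l : ℕ}
    (e : MvPolynomial (Fin l) (RingA k m r F) ≃ₐ[k] MvPolynomial (Fin (l + m + 2)) k) :
    IsCoord (fOf k m F) := by
  obtain ⟨I⟩ := exists_polyIso e
  obtain ⟨P⟩ := H.exists_planeData_of_ml (H.prime_of_polyIso I) hml
  obtain ⟨C, a₀, a₁, hf⟩ := P.exists_linPoly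
  let L := AlgebraicClosure k
  let φ := algebraMap k L
  have HL := H.map φ
  obtain ⟨IL⟩ : Nonempty (PolyIso (Fin (l + m + 2)) (stG L l m r (MvPolynomial.map φ F))) := by
    rw [← map_stG]
    exact ⟨I.map φ⟩
  have hL : fOf L m (MvPolynomial.map φ F) =
      (C.map φ).equiv (linPoly (a₀.map φ) (a₁.map φ)) := by
    rw [fOf_map, hf, C.map_equiv, map_linPoly]
  have hp : Prime (linPoly (a₀.map φ) (a₁.map φ)) := by
    have := HL.prime_of_polyIso IL
    rw [hL] at this
    exact (MulEquiv.prime_iff (C.map φ).equiv).1 this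
  rw [hf]
  refine (isCoord_linPoly φ ?_).map_equiv _
  by_cases h1 : a₁.map φ = 0
  · rw [h1] at hp
    exact Or.inl ⟨h1, natDegree_eq_one_of_prime_linPoly hp⟩
  right
  by_cases hd : (a₁.map φ).degree = 0
  · rw [Polynomial.eq_C_of_degree_eq_zero hd]
    refine ⟨_, fun h => h1 ?_, rfl⟩
    rw [Polynomial.eq_C_of_degree_eq_zero hd, h, map_zero]
  obtain ⟨α, hα⟩ := IsAlgClosed.exists_root _ hd
  obtain ⟨b₀, b₁, hb⟩ := isCoprime_of_irreducible_linPoly hp.irreducible h1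
  have D : Spread l m r L :=
    { F := MvPolynomial.map φ F
      g := MvPolynomial.map φ g
      C := C.map φ
      a₀ := a₀.map φ
      a₁ := a₁.map φ
      b₀ := b₀
      b₁ := b₁
      α := α
      hF := by
        rw [← hL]
        exact HL.hFg
      I := IL
      bezout := hb
      hα := hα }
  exact (D.false H.hm fun i => (zero_lt_one.trans (H.hr i)).ne').elim

theorem prime_of_prime_map {κ : Type} [Field κ] (ι : k →+* κ) {f : MvPolynomial (Fin 2) k}
    (h : Prime (MvPolynomial.map ι f)) : Prime f := by
  have hu : ∀ p : MvPolynomial (Fin 2) k, IsUnit (MvPolynomial.map ι p) → IsUnit p := fun p hp => by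
    rw [MvPolynomial.isUnit_iff_totalDegree_of_isReduced] at hp ⊢
    rw [coeff_map, totalDegree, support_map_of_injective p ι.injective] at hp
    exact ⟨isUnit_iff_ne_zero.2 fun h => hp.1.ne_zero (by rw [h, map_zero]), hp.2⟩
  refine Irreducible.prime ⟨fun hf => h.not_isUnit (hf.map (MvPolynomial.map ι)), fun p q hpq => ?_⟩
  exact (h.irreducible.isUnit_or_isUnit (by rw [hpq, map_mul])).imp (hu p) (hu q)

theorem Hyp.isCoord_of_hom [IsDomain (RingA k m r F)] (H : Hyp r F g)
    (hml : MakarLimanov k (RingA k m r F) = ⊥)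
    {κ D : Type} [Field κ] (ι : k →+* κ) [CommRing D] [IsDomain D] [Algebra κ D]
    (hD : ∀ d : D, IsUnit d → ∃ c : κ, d = algebraMap κ D c)
    (φ : MvPolynomial (Fin 2) κ →ₐ[κ] D) (hφ : ∀ p, φ p = 0 ↔ MvPolynomial.map ι (fOf k m F) ∣ p) :
    IsCoord (fOf k m F) := by
  have hp : Prime (MvPolynomial.map ι (fOf k m F)) := by
    refine ⟨(map_ne_zero_iff _ (MvPolynomial.map_injective _ ι.injective)).2 H.hf,
      fun h => one_ne_zero (α := D) ?_, fun p q h => ?_⟩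
    · rw [← map_one φ, hφ]
      exact h.dvd
    · rw [← hφ, map_mul, mul_eq_zero, hφ, hφ] at h
      exact h
  obtain ⟨P⟩ := H.exists_planeData_of_ml (prime_of_prime_map ι hp) hml
  exact P.isCoord H.hf ι hD φ hφ

theorem Hyp.isCoord_of_line [IsDomain (RingA k m r F)] (H : Hyp r F g)
    (hml : MakarLimanov k (RingA k m r F) = ⊥)
    (e : Curve k m F ≃ₐ[k] Polynomial k) : IsCoord (fOf k m F) := by
  refine H.isCoord_of_hom hml (RingHom.id k) Polynomial.eq_algebraMap_of_isUnit
    ((e : Curve k m F →ₐ[k] Polynomial k).comp (Curve.mk k m F)) fun p => ?_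
  rw [MvPolynomial.map_id, ← Ideal.mem_span_singleton]
  change e (Curve.mk k m F p) = 0 ↔ _
  rw [map_eq_zero_iff _ e.injective]
  exact Ideal.Quotient.eq_zero_iff_mem

end
end RingA

theorem exists_sub_mem_of_dvd_pow {R : Type} [CommRing R] {a π : R} {N : ℕ} (h : a ∣ π ^ N)
    (G : Polynomial R) :
    ∃ c : R, a ∣ c + π * G.eval c ∧ ∀ {A : Type} [CommRing A] (α : R →+* A) (ζ y : A),
      α a * y = ζ + α π * G.eval₂ α ζ → ∃ v, α c + α a * v = ζ := by
  let c : ℕ → R := fun n => (fun c => -(π * G.eval c))^[n] 0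
  have hc : ∀ n, c (n + 1) = -(π * G.eval (c n)) := fun n =>
    Function.iterate_succ_apply' _ n 0
  have hcc : ∀ n, π ^ n ∣ c n - c (n + 1) := by
    intro n
    induction n with
    | zero => simp
    | succ n ih =>
      obtain ⟨q, hq⟩ := ih.trans (Polynomial.sub_dvd_eval_sub (c n) (c (n + 1)) G)
      exact ⟨-q, by rw [hc (n + 1), pow_succ]; nth_rw 1 [hc n]; linear_combination -π * hq⟩
  refine ⟨c N, h.trans (by simpa [hc] using hcc N), fun {A} _ α ζ y hy => ?_⟩
  have key : ∀ n, ∃ w v, ζ - α (c n) = α π ^ n * w + α a * v := by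
    intro n
    induction n with
    | zero => exact ⟨ζ, 0, by simp [c]⟩
    | succ n ih =>
      obtain ⟨w, v, hwv⟩ := ih
      obtain ⟨q, hq⟩ := Polynomial.sub_dvd_eval_sub ζ (α (c n)) (G.map α)
      rw [Polynomial.eval_map, Polynomial.eval_map, Polynomial.eval₂_at_apply, hwv] at hq
      refine ⟨-(w * q), y - α π * v * q, ?_⟩
      rw [hc, map_neg, map_mul]
      linear_combination -hy - α π * hq
  obtain ⟨w, v, hwv⟩ := key N
  obtain ⟨d, hd⟩ := h
  have hd' := congrArg α hd
  rw [map_pow, map_mul] at hd'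
  exact ⟨α d * w + v, by rw [hd'] at hwv; linear_combination -hwv⟩

theorem Polynomial.exists_C_mul_eq_of_dvd {R : Type} [CommRing R] {a π c : R} {G : Polynomial R}
    (h : a ∣ c + π * G.eval c) :
    ∃ P : Polynomial R, Polynomial.C a * P =
      (Polynomial.C c + Polynomial.C a * Polynomial.X) +
        Polynomial.C π * G.eval₂ Polynomial.C (Polynomial.C c + Polynomial.C a * Polynomial.X) := by
  obtain ⟨b, hb⟩ := h
  obtain ⟨q, hq⟩ := Polynomial.sub_dvd_eval_sub (Polynomial.C c + Polynomial.C a * Polynomial.X)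
    (Polynomial.C c) (G.map Polynomial.C)
  rw [Polynomial.eval_map, Polynomial.eval_map, Polynomial.eval₂_at_apply] at hq
  have hb' := congrArg (Polynomial.C (R := R)) hb
  rw [map_add, map_mul, map_mul] at hb'
  refine ⟨Polynomial.C b + Polynomial.X + Polynomial.C π * Polynomial.X * q, ?_⟩
  linear_combination -hb' - Polynomial.C π * hq

theorem exists_equiv_of_leftInverse {k A R : Type} [CommRing k] [CommRing A] [IsDomain A]
    [Algebra k A] [CommRing R] [IsDomain R] [Algebra k R] {a c : R} {α : R →ₐ[k] A} {w ζ y : A}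
    (ha : α a ≠ 0) (hw : α c + α a * w = ζ) {Ψ : A →ₐ[k] Polynomial R}
    (hΨα : ∀ d, Ψ (α d) = Polynomial.C d)
    (hΨζ : Ψ ζ = Polynomial.C c + Polynomial.C a * Polynomial.X) {s : Set A}
    (hs : s ⊆ Algebra.adjoin k (Set.range α ∪ {ζ}))
    (hgen : Algebra.adjoin k (insert y s) = ⊤)
    (hy : α a * y ∈ Algebra.adjoin k (Set.range α ∪ {ζ})) :
    ∃ e : A ≃ₐ[k] Polynomial R, ∀ d, e (α d) = Polynomial.C d := by
  have ha' : Polynomial.C a ≠ 0 := Polynomial.C_ne_zero.2 fun h => ha (by rw [h, map_zero])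
  have hΨw : Ψ w = Polynomial.X := by
    rw [← hw, map_add, map_mul, hΨα, hΨα] at hΨζ
    exact mul_left_cancel₀ ha' (add_left_cancel hΨζ)
  let Φ : Polynomial R →ₐ[k] A := Polynomial.eval₂AlgHom α w fun _ => Commute.all _ _
  have hΦC : ∀ d, Φ (Polynomial.C d) = α d := fun d => Polynomial.eval₂_C _ _
  have hΦX : Φ Polynomial.X = w := Polynomial.eval₂_X _ _
  have h1 : Algebra.adjoin k (Set.range α ∪ {ζ}) ≤ AlgHom.equalizer (Φ.comp Ψ) (AlgHom.id k A) := by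
    refine Algebra.adjoin_le ?_
    rintro b (⟨d, rfl⟩ | hb)
    · change Φ (Ψ (α d)) = α d
      rw [hΨα, hΦC]
    · change Φ (Ψ b) = b
      rw [Set.mem_singleton_iff.1 hb, hΨζ, map_add, map_mul, hΦC, hΦC, hΦX, hw]
  have h2 : ∀ b, Φ (Ψ b) = b := by
    have : (⊤ : Subalgebra k A) ≤ AlgHom.equalizer (Φ.comp Ψ) (AlgHom.id k A) := by
      rw [← hgen]
      refine Algebra.adjoin_le (Set.insert_subset ?_ (hs.trans h1))
      have h3 : Φ (Ψ (α a * y)) = α a * y := h1 hy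
      rw [map_mul, map_mul, hΨα, hΦC] at h3
      exact mul_left_cancel₀ ha h3
    exact fun b => this trivial
  have h3 : ∀ q, Ψ (Φ q) = q := by
    intro q
    induction q using Polynomial.induction_on' with
    | add p q hp hq => rw [map_add, map_add, hp, hq]
    | monomial n d =>
      rw [← Polynomial.C_mul_X_pow_eq_monomial, map_mul, map_mul, map_pow, map_pow, hΦC, hΦX, hΨα,
        hΨw]
  exact ⟨AlgEquiv.ofAlgHom Ψ Φ (AlgHom.ext h3) (AlgHom.ext h2), hΨα⟩

theorem MvPolynomial.eval₂_aeval_polynomial {k R S τ : Type} [CommRing k] [CommRing R]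
    [CommRing S] [Algebra k R] [Algebra k S] (α : R →ₐ[k] S) (ζ : S) (v : τ → Polynomial R)
    (p : MvPolynomial τ k) :
    (aeval v p).eval₂ (α : R →+* S) ζ = aeval (fun j => (v j).eval₂ (α : R →+* S) ζ) p := by
  have := DFunLike.congr_fun (comp_aeval v (Polynomial.eval₂AlgHom α ζ fun _ => Commute.all _ _)) p
  exact this

namespace RingA
section
variable {k : Type} [Field k] {m : ℕ} {r : Fin m → ℕ} {F : MvPolynomial (Fin m ⊕ Fin 2) k}
variable {g : MvPolynomial (Fin m ⊕ Fin 2) k}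

theorem prod_X_pow_dvd {R : Type} [CommRing R] (x : Fin m → R) (r : Fin m → ℕ) :
    ∏ i, x i ^ r i ∣ (∏ i, x i) ^ ∑ i, r i := by
  rw [← Finset.prod_pow]
  exact Finset.prod_dvd_prod_of_dvd _ _ fun i _ =>
    pow_dvd_pow _ (Finset.single_le_sum (f := r) (fun _ _ => Nat.zero_le _) (Finset.mem_univ i))

/-- The arguments at which `g` is evaluated when `Z` and `T` are expressed in the coordinates
`σ (X 0)` and `σ (X 1)`. -/
def coordArg {S : Type} [CommRing S] [Algebra k S]
    (σ : MvPolynomial (Fin 2) k ≃ₐ[k] MvPolynomial (Fin 2) k) (x : Fin m → S) (Z T : S) :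
    Fin m ⊕ Fin 2 → S :=
  Sum.elim x fun j => aeval ![Z, T] (σ.symm (X j))

theorem aeval_coordArg_rename {S : Type} [CommRing S] [Algebra k S]
    (σ : MvPolynomial (Fin 2) k ≃ₐ[k] MvPolynomial (Fin 2) k) (x : Fin m → S) (Z T : S)
    (p : MvPolynomial (Fin 2) k) :
    aeval (coordArg σ x Z T) (rename Sum.inr (σ p)) = aeval ![Z, T] p := by
  rw [aeval_rename]
  have h : (aeval ![Z, T]).comp (σ.symm : MvPolynomial (Fin 2) k →ₐ[k] MvPolynomial (Fin 2) k) =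
      aeval (coordArg σ x Z T ∘ Sum.inr) := by
    refine algHom_ext fun j => ?_
    rw [aeval_X]; rfl
  rw [← h]
  change aeval _ (σ.symm (σ p)) = _
  rw [AlgEquiv.symm_apply_apply]

theorem Hyp.exists_hom (H : Hyp r F g) {S : Type} [CommRing S] [Algebra k S]
    {σ : MvPolynomial (Fin 2) k ≃ₐ[k] MvPolynomial (Fin 2) k} (hσ : σ (X 0) = fOf k m F)
    {x : Fin m → S} {Z T y : S}
    (h : (∏ i, x i ^ r i) * y = Z + (∏ i, x i) * aeval (coordArg σ x Z T) g) :
    ∃ Ψ : RingA k m r F →ₐ[k] S, (∀ i, Ψ (xA k m r F i) = x i) ∧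
      ∀ p, Ψ (evP r F (σ p)) = aeval ![Z, T] p := by
  let v : Fin m ⊕ Fin 3 → S :=
    Sum.elim x ![y, aeval ![Z, T] (σ.symm (X 0)), aeval ![Z, T] (σ.symm (X 1))]
  have hv : v ∘ Sum.map id Fin.succ = coordArg σ x Z T := by
    funext j
    rcases j with i | j
    · rfl
    · fin_cases j <;> rfl
  have hv' : ∀ j : Fin 2, v (Sum.inr j.succ) = aeval ![Z, T] (σ.symm (X j)) := by
    intro j
    fin_cases j <;> rfl
  have hF : aeval (coordArg σ x Z T) F = Z + (∏ i, x i) * aeval (coordArg σ x Z T) g := by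
    have h1 := congrArg (aeval (coordArg σ x Z T)) H.hFg
    rw [map_add, map_mul, map_prod, ← hσ, aeval_coordArg_rename, aeval_X] at h1
    rw [h1]
    simp only [aeval_X, coordArg, Sum.elim_inl]
    rfl
  have hrel : (∏ i, v (Sum.inl i) ^ r i) * v (Sum.inr 0) = aeval (v ∘ Sum.map id Fin.succ) F :=
    h.trans (hF.symm.trans (by rw [hv]))
  refine ⟨liftA v hrel, fun i => (liftA_mk v hrel _).trans (aeval_X _ _), fun p => ?_⟩
  have h2 : (liftA v hrel).comp (evP r F) = (aeval ![Z, T]).comp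
      (σ.symm : MvPolynomial (Fin 2) k →ₐ[k] MvPolynomial (Fin 2) k) := by
    refine algHom_ext fun j => ?_
    rw [AlgHom.comp_apply, evP, aeval_X]
    refine Eq.trans ?_ (hv' j)
    fin_cases j <;> exact (liftA_mk v hrel _).trans (aeval_X _ _)
  refine (DFunLike.congr_fun h2 (σ p)).trans ?_
  change aeval _ (σ.symm (σ p)) = _
  rw [AlgEquiv.symm_apply_apply]

theorem evB_eq_aeval_coordArg (σ : MvPolynomial (Fin 2) k ≃ₐ[k] MvPolynomial (Fin 2) k) :
    evB r F = aeval (coordArg σ (xA k m r F) (evP r F (σ (X 0))) (evP r F (σ (X 1)))) := by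
  have h : aeval ![evP r F (σ (X 0)), evP r F (σ (X 1))] =
      (evP r F).comp (σ : MvPolynomial (Fin 2) k →ₐ[k] MvPolynomial (Fin 2) k) := by
    refine algHom_ext fun j => ?_
    rw [aeval_X]
    fin_cases j <;> rfl
  refine algHom_ext fun j => ?_
  rw [aeval_X, evB, aeval_X]
  rcases j with i | j
  · rfl
  · change _ = aeval _ (σ.symm (X j))
    rw [h]
    change _ = evP r F (σ (σ.symm (X j)))
    rw [AlgEquiv.apply_symm_apply, evP, aeval_X]
    rfl

theorem adjoin_yA_evB : Algebra.adjoin k (insert (yA k m r F) (Set.range (evB r F))) = ⊤ := by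
  have h : Ideal.Quotient.mkₐ k (Ideal.span {relG k m r F}) = aeval (gen r F) :=
    algHom_ext fun j => by rw [aeval_X]; rfl
  have h' := AlgHom.range_eq_top _ |>.2
    (Ideal.Quotient.mkₐ_surjective k (Ideal.span {relG k m r F}))
  rw [h, aeval_range] at h'
  rw [eq_top_iff, ← h']
  refine Algebra.adjoin_le ?_
  have hB : ∀ p, evB r F p ∈
      Algebra.adjoin k (insert (yA k m r F) (Set.range (evB r F))) :=
    fun p => Algebra.subset_adjoin (Or.inr ⟨p, rfl⟩)
  have hj : ∀ j : Fin 2, evB r F (X (Sum.inr j)) = gen r F (Sum.inr j.succ) := fun j => by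
    rw [evB, aeval_X]
    fin_cases j <;> rfl
  rintro _ ⟨i | j, rfl⟩
  · have := hB (X (Sum.inl i))
    rw [evB, aeval_X] at this
    exact this
  · induction j using Fin.cases with
    | zero => exact Algebra.subset_adjoin (Or.inl rfl)
    | succ j =>
      rw [← hj]
      exact hB _

theorem Hyp.exists_equiv_polynomial [IsDomain (RingA k m r F)] (H : Hyp r F g)
    (hx : ∀ i, xA k m r F i ≠ 0) (hf : IsCoord (fOf k m F)) :
    ∃ e : RingA k m r F ≃ₐ[k] Polynomial (MvPolynomial (Fin m ⊕ Unit) k),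
      ∀ i, e (xA k m r F i) = Polynomial.C (X (Sum.inl i)) := by
  obtain ⟨σ, hσ⟩ := hf
  set R := MvPolynomial (Fin m ⊕ Unit) k
  obtain ⟨x, hxX⟩ : ∃ x : Fin m → R, ∀ i, x i = X (Sum.inl i) := ⟨_, fun _ => rfl⟩
  obtain ⟨τ, hτ⟩ : ∃ τ : R, τ = X (Sum.inr ()) := ⟨_, rfl⟩
  have hG : ∀ {S : Type} [CommRing S] [Algebra k S] (α : R →ₐ[k] S) (ζ : S),
      (aeval (coordArg σ (fun i => Polynomial.C (x i)) Polynomial.X (Polynomial.C τ)) g).eval₂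
        (α : R →+* S) ζ = aeval (coordArg σ (fun i => α (x i)) ζ (α τ)) g := by
    intro S _ _ α ζ
    rw [MvPolynomial.eval₂_aeval_polynomial]
    congr 2
    funext j
    rcases j with i | j
    · exact Polynomial.eval₂_C _ _
    · change Polynomial.eval₂ _ _ (aeval _ (σ.symm (X j))) = aeval _ (σ.symm (X j))
      rw [MvPolynomial.eval₂_aeval_polynomial]
      congr 2
      funext j
      fin_cases j
      · exact Polynomial.eval₂_X _ _
      · exact Polynomial.eval₂_C _ _
  obtain ⟨c, hc, hcA⟩ := exists_sub_mem_of_dvd_pow (prod_X_pow_dvd x r)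
    (aeval (coordArg σ (fun i => Polynomial.C (x i)) Polynomial.X (Polynomial.C τ)) g)
  obtain ⟨P, hP⟩ := Polynomial.exists_C_mul_eq_of_dvd hc
  have hGC := hG (Polynomial.CAlgHom (R := k) (A := R))
    (Polynomial.C c + Polynomial.C (∏ i, x i ^ r i) * Polynomial.X)
  obtain ⟨Ψ, hΨx, hΨσ⟩ := H.exists_hom hσ (S := Polynomial R) (x := fun i => Polynomial.C (x i))
    (Z := Polynomial.C c + Polynomial.C (∏ i, x i ^ r i) * Polynomial.X) (T := Polynomial.C τ)
    (y := P) (by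
      simp only [← map_pow, ← map_prod]
      refine hP.trans ?_
      congr 2)
  obtain ⟨α, hαx, hατ⟩ : ∃ α : R →ₐ[k] RingA k m r F,
      (∀ i, α (x i) = xA k m r F i) ∧ α τ = evP r F (σ (X 1)) :=
    ⟨aeval (Sum.elim (xA k m r F) fun _ => evP r F (σ (X 1))),
      fun i => by rw [hxX, aeval_X]; rfl, by rw [hτ, aeval_X]; rfl⟩
  have hαa : α (∏ i, x i ^ r i) = ∏ i, xA k m r F i ^ r i := by
    simp only [map_prod, map_pow, hαx]
  have hαπ : α (∏ i, x i) = ∏ i, xA k m r F i := by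
    simp only [map_prod, hαx]
  have hrel : α (∏ i, x i ^ r i) * yA k m r F = evB r F F := by
    rw [hαa]
    exact relation
  obtain ⟨w, hw⟩ := hcA (α : R →+* RingA k m r F) (evP r F (σ (X 0))) (yA k m r F) (by
    rw [hG, hατ]
    refine hrel.trans ?_
    rw [H.evB_F, evB_eq_aeval_coordArg σ, hσ]
    simp only [RingHom.coe_coe, hαπ, hαx])
  have hΨα : ∀ d, Ψ (α d) = Polynomial.C d := by
    intro d
    have h1 : Ψ.comp α = Polynomial.CAlgHom (R := k) (A := R) := by
      refine algHom_ext fun j => ?_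
      rcases j with i | j
      · rw [AlgHom.comp_apply, ← hxX, hαx, hΨx]
        rfl
      · change Ψ (α (X (Sum.inr ()))) = Polynomial.C (X (Sum.inr ()))
        rw [← hτ, hατ, hΨσ, aeval_X]
        rfl
    exact DFunLike.congr_fun h1 d
  have hB : ∀ p, evB r F p ∈ Algebra.adjoin k (Set.range α ∪ {evP r F (σ (X 0))}) := by
    intro p
    have h1 : ∀ {τ : Type} {A' : Subalgebra k (RingA k m r F)} {v : τ → RingA k m r F},
        (∀ j, v j ∈ A') → ∀ q : MvPolynomial τ k, aeval v q ∈ A' := by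
      intro τ A' v hv q
      refine Algebra.adjoin_le (S := A') (Set.range_subset_iff.2 hv) ?_
      rw [← aeval_range]
      exact ⟨q, rfl⟩
    rw [evB_eq_aeval_coordArg σ]
    have h2 : ∀ d, α d ∈ Algebra.adjoin k (Set.range α ∪ {evP r F (σ (X 0))}) :=
      fun d => Algebra.subset_adjoin (Or.inl ⟨d, rfl⟩)
    refine h1 (fun j => ?_) p
    rcases j with i | j
    · have h3 := h2 (x i)
      rw [hαx] at h3
      exact h3
    · refine h1 (fun j => ?_) _
      fin_cases j
      · exact Algebra.subset_adjoin (Or.inr rfl)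
      · have h3 := h2 τ
        rw [hατ] at h3
        exact h3
  obtain ⟨e, he⟩ := exists_equiv_of_leftInverse (a := ∏ i, x i ^ r i)
    (by
      rw [hαa]
      exact Finset.prod_ne_zero_iff.2 fun i _ => pow_ne_zero _ (hx i))
    hw hΨα (by rw [hΨσ, aeval_X]; rfl) (s := Set.range (evB r F))
    (by rintro _ ⟨p, rfl⟩; exact hB p) adjoin_yA_evB (by rw [hrel]; exact hB F)
  exact ⟨e, fun i => by rw [← hαx, he, hxX]⟩

end
end RingA

namespace ExpMap
variable {k D D' : Type} [CommRing k] [CommRing D] [CommRing D'] [Algebra k D'] [Algebra k D]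

/-- The transport of an exponential map along an isomorphism. -/
def congr (φ : ExpMap k D') (e : D ≃ₐ[k] D') : ExpMap k D where
  toAlgHom := (Polynomial.mapAlgHom (e.symm : D' →ₐ[k] D)).comp
    (φ.toAlgHom.comp (e : D →ₐ[k] D'))
  eval_zero d := by
    change Polynomial.eval 0 (Polynomial.map (e.symm : D' →+* D) (φ.toAlgHom (e d))) = d
    rw [Polynomial.eval_zero_map, φ.eval_zero]
    exact e.symm_apply_apply d
  comp_add d := by
    change Polynomial.eval₂ _ _ (Polynomial.map (e.symm : D' →+* D) (φ.toAlgHom (e d))) =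
      Polynomial.eval₂ _ _ (Polynomial.map (e.symm : D' →+* D) (φ.toAlgHom (e d)))
    have h := congrArg (Polynomial.mapRingHom (Polynomial.mapRingHom (e.symm : D' →+* D)))
      (φ.comp_add (e d))
    rw [Polynomial.hom_eval₂, Polynomial.hom_eval₂] at h
    rw [Polynomial.eval₂_map, Polynomial.eval₂_map]
    convert h using 2
    · refine RingHom.ext fun a => ?_
      change Polynomial.map _ (Polynomial.map (e.symm : D' →+* D) (φ.toAlgHom (e (e.symm a)))) =
        Polynomial.map _ (Polynomial.map _ (φ.toAlgHom a))
      rw [e.apply_symm_apply, Polynomial.map_map, Polynomial.map_map]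
      congr 1
      refine RingHom.ext fun b => ?_
      simp
    · simp
    · refine RingHom.ext fun a => ?_
      simp
    · simp

theorem mem_invariants_congr (φ : ExpMap k D') (e : D ≃ₐ[k] D') {d : D}
    (h : d ∈ (φ.congr e).invariants) : e d ∈ φ.invariants := by
  have h1 : Polynomial.map (e.symm : D' →+* D) (φ.toAlgHom (e d)) = Polynomial.C d := h
  have h2 := congrArg (Polynomial.map (e : D →+* D')) h1
  rw [Polynomial.map_map, Polynomial.map_C] at h2
  have h3 : (e : D →+* D').comp (e.symm : D' →+* D) = RingHom.id D' :=
    RingHom.ext e.apply_symm_apply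
  rw [h3, Polynomial.map_id] at h2
  exact h2

variable (k) in
/-- The translation `X j ↦ X j + U` of a polynomial ring. -/
def shift {σ : Type} [DecidableEq σ] (j : σ) : ExpMap k (MvPolynomial σ k) where
  toAlgHom := aeval fun i => Polynomial.C (X i) + if i = j then Polynomial.X else 0
  eval_zero d := by
    have h : (Polynomial.evalRingHom (0 : MvPolynomial σ k)).comp
        (aeval (R := k) fun i => Polynomial.C (X i : MvPolynomial σ k) +
          if i = j then Polynomial.X else 0 : MvPolynomial σ k →ₐ[k] _).toRingHom =
        RingHom.id (MvPolynomial σ k) := by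
      refine MvPolynomial.ringHom_ext (fun c => ?_) fun i => ?_
      · simp [Polynomial.algebraMap_apply, MvPolynomial.algebraMap_eq]
      · by_cases hi : i = j <;> simp [hi]
    exact DFunLike.congr_fun h d
  comp_add d := by
    set φ : MvPolynomial σ k →ₐ[k] Polynomial (MvPolynomial σ k) :=
      aeval fun i => Polynomial.C (X i) + if i = j then Polynomial.X else 0 with hφ
    have h : (Polynomial.eval₂RingHom (S := Polynomial (Polynomial (MvPolynomial σ k)))
          ((Polynomial.mapRingHom (Polynomial.C (R := MvPolynomial σ k))).comp φ.toRingHom)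
          (Polynomial.C Polynomial.X)).comp φ.toRingHom =
        (Polynomial.eval₂RingHom (S := Polynomial (Polynomial (MvPolynomial σ k)))
          ((Polynomial.C (R := Polynomial (MvPolynomial σ k))).comp
          (Polynomial.C (R := MvPolynomial σ k)))
          (Polynomial.C Polynomial.X + Polynomial.X)).comp φ.toRingHom := by
      refine MvPolynomial.ringHom_ext (fun c => ?_) fun i => ?_
      · simp [Polynomial.algebraMap_apply, MvPolynomial.algebraMap_eq, hφ]
      · by_cases hi : i = j <;> simp [hi, hφ]
        ring
    exact DFunLike.congr_fun h d

theorem aeval_update_of_mem_shift {σ : Type} [DecidableEq σ] {j : σ} {p : MvPolynomial σ k}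
    (hp : p ∈ (shift k j).invariants) (v : σ → D) (s : D) :
    aeval (fun i => v i + if i = j then s else 0) p = aeval v p := by
  have h1 : (aeval fun i => Polynomial.C (X i) + if i = j then Polynomial.X else 0) p =
    Polynomial.C p := hp
  have h2 := congrArg (Polynomial.eval₂AlgHom (aeval v : MvPolynomial σ k →ₐ[k] D) s
    fun _ => Commute.all _ _) h1
  rw [← AlgHom.comp_apply, comp_aeval] at h2
  refine Eq.trans ?_ (h2.trans (Polynomial.eval₂_C _ _))
  congr 2
  funext i
  change _ = Polynomial.eval₂ ((aeval v : MvPolynomial σ k →ₐ[k] D) : MvPolynomial σ k →+* D) s _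
  by_cases hi : i = j <;> simp [hi]

theorem exists_eq_algebraMap_of_shift {σ : Type} [DecidableEq σ] [Fintype σ] {p : MvPolynomial σ k}
    (hp : ∀ j, p ∈ (shift k j).invariants) : ∃ c, p = algebraMap k _ c := by
  have h : ∀ S : Finset σ, aeval (fun i => if i ∈ S then 0 else X i) p = p := by
    intro S
    induction S using Finset.induction_on with
    | empty => simp
    | insert j S _ ih =>
      refine Eq.trans ?_ ih
      rw [← aeval_update_of_mem_shift (hp j)
        (fun i => if i ∈ S then (0 : MvPolynomial σ k) else X i)
        (-(if j ∈ S then 0 else X j))]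
      congr 2
      funext i
      by_cases hi : i = j
      · subst hi; simp
      · simp [hi]
  have h1 := h Finset.univ
  have h2 := DFunLike.congr_fun (comp_aeval (fun _ : σ => (0 : k))
    (Algebra.ofId k (MvPolynomial σ k))) p
  refine ⟨aeval (fun _ => (0 : k)) p, h1.symm.trans (Eq.trans ?_ h2.symm)⟩
  congr 2
  funext i
  simp

end ExpMap

theorem makarLimanov_eq_bot_of_equiv {k D σ : Type} [CommRing k] [CommRing D] [Algebra k D]
    [Fintype σ] (e : D ≃ₐ[k] MvPolynomial σ k) : MakarLimanov k D = ⊥ := by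
  classical
  refine eq_bot_iff.2 fun d hd => ?_
  rw [MakarLimanov, Algebra.mem_iInf] at hd
  obtain ⟨c, hc⟩ := ExpMap.exists_eq_algebraMap_of_shift fun j =>
    ExpMap.mem_invariants_congr _ e (hd ((ExpMap.shift k j).congr e))
  exact ⟨c, e.injective ((e.commutes c).trans hc.symm)⟩

theorem MvPolynomial.exists_algEquiv_subalgebra {k A S ι : Type} [CommRing k] [CommRing A]
    [Algebra k A] [CommRing S] [Algebra k S] {E : Subalgebra k A} {j : S →ₐ[k] A}
    (hE : E = j.range) (Θ : MvPolynomial ι S ≃+* A) (hΘ : ∀ s, Θ (C s) = j s) :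
    Nonempty (A ≃ₐ[E] MvPolynomial ι E) := by
  subst hE
  have hj : Function.Injective j := fun a b h => C_injective ι S (Θ.injective (by rw [hΘ, hΘ, h]))
  let ε : S ≃+* j.range := (AlgEquiv.ofInjective j hj).toRingEquiv
  have hε : ∀ s, (ε s : A) = j s := fun s => AlgEquiv.ofInjective_apply (f := j) hj s
  refine ⟨AlgEquiv.ofRingEquiv (f := Θ.symm.trans (mapEquiv ι ε)) fun b => ?_⟩
  obtain ⟨s, rfl⟩ := ε.surjective b
  change mapEquiv ι ε (Θ.symm (ε s : A)) = _
  rw [hε, ← hΘ, RingEquiv.symm_apply_apply, mapEquiv_apply, map_C]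
  rfl

theorem isAnFibration_of_equiv {R D : Type} [CommRing R] [CommRing D] [Algebra R D] {n : ℕ}
    (e : D ≃ₐ[R] MvPolynomial (Fin n) R) : IsAnFibration R D n :=
  ⟨Algebra.FiniteType.equiv inferInstance e.symm, Module.Flat.of_linearEquiv e.toLinearEquiv,
    fun _ => ⟨(Algebra.TensorProduct.congr AlgEquiv.refl e).trans
      (MvPolynomial.algebraTensorAlgEquiv R _)⟩⟩

/-- Splitting off the last two variables. -/
def optionSumUnitEquiv (m : ℕ) : Option (Fin m ⊕ Unit) ≃ Fin 2 ⊕ Fin m where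
  toFun o := o.elim (Sum.inl 0) (Sum.elim Sum.inr fun _ => Sum.inl 1)
  invFun := Sum.elim ![none, some (Sum.inr ())] fun i => some (Sum.inl i)
  left_inv := by rintro (_ | _ | _) <;> rfl
  right_inv := by
    rintro (j | i)
    · fin_cases j <;> rfl
    · rfl

namespace RingA
section
variable {k : Type} [Field k] {m : ℕ} {r : Fin m → ℕ} {F : MvPolynomial (Fin m ⊕ Fin 2) k}
variable {g : MvPolynomial (Fin m ⊕ Fin 2) k}

theorem Hyp.exists_equiv [IsDomain (RingA k m r F)] (H : Hyp r F g)
    (hx : ∀ i, xA k m r F i ≠ 0) (hf : IsCoord (fOf k m F)) :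
    ∃ e : RingA k m r F ≃ₐ[k] MvPolynomial (Fin 2 ⊕ Fin m) k,
      ∀ i, e (xA k m r F i) = X (Sum.inr i) := by
  obtain ⟨e, he⟩ := H.exists_equiv_polynomial hx hf
  refine ⟨e.trans ((optionEquivLeft k _).symm.trans (renameEquiv k (optionSumUnitEquiv m))),
    fun i => ?_⟩
  change renameEquiv k _ ((optionEquivLeft k _).symm (e _)) = _
  rw [he, optionEquivLeft_symm_apply]
  simp [optionSumUnitEquiv]

theorem Hyp.isAnFibration [IsDomain (RingA k m r F)] (H : Hyp r F g)
    (hx : ∀ i, xA k m r F i ≠ 0) (hf : IsCoord (fOf k m F)) :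
    IsAnFibration (EA k m r F) (RingA k m r F) 2 := by
  obtain ⟨e, he⟩ := H.exists_equiv hx hf
  have hE : EA k m r F = (aeval (xA k m r F)).range := (aeval_range ..).symm
  obtain ⟨e'⟩ := MvPolynomial.exists_algEquiv_subalgebra hE
    ((sumAlgEquiv k (Fin 2) (Fin m)).symm.trans e.symm).toRingEquiv fun s => by
      have h : ((e.symm : MvPolynomial (Fin 2 ⊕ Fin m) k →ₐ[k] RingA k m r F).comp
          ((sumAlgEquiv k (Fin 2) (Fin m)).symm : _ →ₐ[k] MvPolynomial (Fin 2 ⊕ Fin m) k)).comp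
          (IsScalarTower.toAlgHom k (MvPolynomial (Fin m) k)
            (MvPolynomial (Fin 2) (MvPolynomial (Fin m) k))) = aeval (xA k m r F) := by
        refine algHom_ext fun i => ?_
        rw [aeval_X]
        change e.symm ((sumAlgEquiv k (Fin 2) (Fin m)).symm (C (X i))) = _
        rw [sumAlgEquiv_symm_C_X, ← he, AlgEquiv.symm_apply_apply]
      exact DFunLike.congr_fun h s
  exact isAnFibration_of_equiv e'

theorem Curve.nonempty_equiv (hf : IsCoord (fOf k m F)) :
    Nonempty (Curve k m F ≃ₐ[k] Polynomial k) := by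
  obtain ⟨σ, hσ⟩ := hf
  have h0 : (aeval ![(0 : Polynomial k), Polynomial.X]) (σ.symm (fOf k m F)) = 0 := by
    rw [← hσ, AlgEquiv.symm_apply_apply, aeval_X]
    rfl
  let φ : Curve k m F →ₐ[k] Polynomial k := Curve.lift
    ((aeval ![(0 : Polynomial k), Polynomial.X]).comp
      (σ.symm : MvPolynomial (Fin 2) k →ₐ[k] MvPolynomial (Fin 2) k)) h0
  let ψ : Polynomial k →ₐ[k] Curve k m F := Polynomial.aeval (Curve.mk k m F (σ (X 1)))
  have hφ : ∀ p, φ (Curve.mk k m F (σ p)) = aeval ![(0 : Polynomial k), Polynomial.X] p := by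
    intro p
    change aeval _ (σ.symm (σ p)) = _
    rw [AlgEquiv.symm_apply_apply]
  have h1 : φ.comp ψ = AlgHom.id k _ := by
    refine Polynomial.algHom_ext ?_
    rw [AlgHom.comp_apply, Polynomial.aeval_X, hφ, aeval_X]
    rfl
  have h2 : ∀ p, ψ (φ (Curve.mk k m F (σ p))) = Curve.mk k m F (σ p) := by
    have h3 : ψ.comp (aeval ![(0 : Polynomial k), Polynomial.X]) = (Curve.mk k m F).comp
        (σ : MvPolynomial (Fin 2) k →ₐ[k] MvPolynomial (Fin 2) k) := by
      refine algHom_ext fun j => ?_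
      rw [AlgHom.comp_apply, aeval_X]
      fin_cases j
      · change ψ 0 = Curve.mk k m F (σ (X 0))
        rw [map_zero, hσ, Curve.mk_fOf]
      · exact Polynomial.aeval_X _
    intro p
    rw [hφ]
    exact DFunLike.congr_fun h3 p
  refine ⟨AlgEquiv.ofAlgHom φ ψ h1 (AlgHom.ext fun c => ?_)⟩
  obtain ⟨p, rfl⟩ := Ideal.Quotient.mk_surjective c
  obtain ⟨p, rfl⟩ := σ.surjective p
  exact h2 p

end
end RingA

theorem exists_universal_hom {E κ A D : Type} [CommRing E] [CommRing κ] [CommRing A] [CommRing D]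
    [Algebra E κ] [Algebra E A] [Algebra κ D] (e : TensorProduct E κ A ≃ₐ[κ] D) :
    ∃ s : A →+* D, (∀ x, s (algebraMap E A x) = algebraMap κ D (algebraMap E κ x)) ∧
      ∀ {S : Type} [CommRing S] (j : κ →+* S) (τ : A →+* S),
        (∀ x, τ (algebraMap E A x) = j (algebraMap E κ x)) →
        ∃ l : D →+* S, (∀ c, l (algebraMap κ D c) = j c) ∧ ∀ a, l (s a) = τ a := by
  refine ⟨(e : TensorProduct E κ A →+* D).comp
    (Algebra.TensorProduct.includeRight : A →ₐ[E] TensorProduct E κ A).toRingHom, fun x => ?_,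
    fun {S} _ j τ h => ?_⟩
  · change e (1 ⊗ₜ[E] algebraMap E A x) = _
    rw [← Algebra.TensorProduct.algebraMap_apply', IsScalarTower.algebraMap_apply E κ, e.commutes]
  · let _ : Algebra E S := (j.comp (algebraMap E κ)).toAlgebra
    let j' : κ →ₐ[E] S := { j with commutes' := fun _ => rfl }
    let τ' : A →ₐ[E] S := { τ with commutes' := h }
    refine ⟨(Algebra.TensorProduct.productMap j' τ' : TensorProduct E κ A →+* S).comp
      (e.symm : D →+* TensorProduct E κ A), fun c => ?_, fun a => ?_⟩
    · change Algebra.TensorProduct.productMap j' τ' (e.symm (algebraMap κ D c)) = _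
      rw [e.symm.commutes, Algebra.TensorProduct.algebraMap_apply,
        Algebra.TensorProduct.productMap_apply_tmul, map_one, mul_one]
      rfl
    · change Algebra.TensorProduct.productMap j' τ' (e.symm (e _)) = _
      rw [e.symm_apply_apply]
      change Algebra.TensorProduct.productMap j' τ' (1 ⊗ₜ[E] a) = _
      rw [Algebra.TensorProduct.productMap_apply_tmul, map_one, one_mul]
      rfl

theorem algebraMap_residueField_eq_zero {R : Type} [CommRing R] (p : PrimeSpectrum R) {x : R}
    (hx : x ∈ p.asIdeal) :
    algebraMap R (IsLocalRing.ResidueField (Localization.AtPrime p.asIdeal)) x = 0 := by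
  rw [IsScalarTower.algebraMap_apply R (Localization.AtPrime p.asIdeal)]
  refine Ideal.Quotient.eq_zero_iff_mem.2 ?_
  rwa [IsLocalization.AtPrime.to_map_mem_maximal_iff _ p.asIdeal]

namespace RingA
section
variable {k : Type} [Field k] {m : ℕ} {r : Fin m → ℕ} {F : MvPolynomial (Fin m ⊕ Fin 2) k}
variable {g : MvPolynomial (Fin m ⊕ Fin 2) k}

theorem Hyp.exists_ringHom (H : Hyp r F g) {S : Type} [CommRing S] (ι : k →+* S) (u : Fin 2 → S)
    (hu : eval₂ ι u (fOf k m F) = 0) :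
    ∃ τ : RingA k m r F →+* S, (∀ c, τ (algebraMap k _ c) = ι c) ∧ (∀ i, τ (xA k m r F i) = 0) ∧
      ∀ p, τ (evP r F p) = eval₂ ι u p := by
  let _ : Algebra k S := ι.toAlgebra
  have hi : ∏ _i : Fin m, (0 : S) = 0 := Finset.prod_eq_zero (Finset.mem_univ ⟨0, H.hm⟩) rfl
  have hi' : ∏ i : Fin m, (0 : S) ^ r i = 0 :=
    Finset.prod_eq_zero (Finset.mem_univ ⟨0, H.hm⟩) (zero_pow (zero_lt_one.trans (H.hr _)).ne')
  let v : Fin m ⊕ Fin 3 → S := Sum.elim (fun _ => 0) ![0, u 0, u 1]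
  have hv : (v ∘ Sum.map id Fin.succ) ∘ Sum.inr = u := by
    funext j
    fin_cases j <;> rfl
  have hF := congrArg (aeval (v ∘ Sum.map id Fin.succ)) H.hFg
  rw [map_add, map_mul, map_prod, aeval_rename, hv] at hF
  simp only [aeval_X] at hF
  have hrel : (∏ i, v (Sum.inl i) ^ r i) * v (Sum.inr 0) =
      aeval (v ∘ Sum.map id Fin.succ) F := by
    refine Eq.trans ?_ hF.symm
    refine (congrArg (· * v (Sum.inr 0)) hi').trans ?_
    refine Eq.trans ?_ (congrArg₂ (· + · * _) hu.symm hi.symm)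
    simp
  refine ⟨(liftA v hrel : RingA k m r F →+* S), fun c => (liftA v hrel).commutes c,
    fun i => (liftA_mk v hrel _).trans (aeval_X _ _), fun p => ?_⟩
  have h2 : (liftA v hrel).comp (evP r F) = aeval u := by
    refine algHom_ext fun j => ?_
    rw [AlgHom.comp_apply, evP, aeval_X, aeval_X]
    fin_cases j <;> exact (liftA_mk v hrel _).trans (aeval_X _ _)
  exact DFunLike.congr_fun h2 p

variable (r F) in
/-- The elements `x i` of `E`. -/
def xE (i : Fin m) : EA k m r F := ⟨xA k m r F i, Algebra.subset_adjoin ⟨i, rfl⟩⟩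

theorem aeval_xE_surjective : Function.Surjective (aeval (R := k) (xE r F)) := by
  rintro ⟨a, ha⟩
  have hE : EA k m r F = (aeval (xA k m r F)).range := (aeval_range ..).symm
  obtain ⟨p, rfl⟩ := hE ▸ ha
  refine ⟨p, Subtype.ext ?_⟩
  exact (DFunLike.congr_fun (comp_aeval (xE r F) (EA k m r F).val) p)

theorem aeval_xE_injective :
    Function.Injective (aeval (R := k) (xE r F)) := by
  let P := MvPolynomial (Fin m ⊕ Fin 2) k
  let K := FractionRing P
  let ψ : P →ₐ[k] K := IsScalarTower.toAlgHom k P K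
  have hψ : Function.Injective ψ := IsFractionRing.injective P K
  let v : Fin m ⊕ Fin 3 → K := Sum.elim (fun i => ψ (X (Sum.inl i)))
    ![ψ F / ∏ i, ψ (X (Sum.inl i)) ^ r i, ψ (X (Sum.inr 0)), ψ (X (Sum.inr 1))]
  have hv : aeval (v ∘ Sum.map id Fin.succ) = ψ := by
    refine algHom_ext fun j => ?_
    rw [aeval_X]
    rcases j with i | j
    · rfl
    · fin_cases j <;> rfl
  have hne : ∏ i, ψ (X (Sum.inl i)) ^ r i ≠ 0 := Finset.prod_ne_zero_iff.2 fun i _ =>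
    pow_ne_zero _ ((map_ne_zero_iff ψ hψ).2 (X_ne_zero _))
  have hrel : (∏ i, v (Sum.inl i) ^ r i) * v (Sum.inr 0) = aeval (v ∘ Sum.map id Fin.succ) F := by
    rw [hv]
    exact mul_div_cancel₀ _ hne
  have h : ((liftA v hrel).comp (EA k m r F).val).comp (aeval (xE r F)) =
      ψ.comp (rename Sum.inl) := by
    refine algHom_ext fun i => ?_
    rw [AlgHom.comp_apply, AlgHom.comp_apply, AlgHom.comp_apply, aeval_X, rename_X]
    exact (liftA_mk v hrel _).trans (aeval_X _ _)
  have h' : Function.Injective (ψ.comp (rename Sum.inl : MvPolynomial (Fin m) k →ₐ[k] P)) :=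
    hψ.comp (rename_injective _ Sum.inl_injective)
  rw [← h] at h'
  exact fun a b hab => h' (congrArg ((liftA v hrel).comp (EA k m r F).val) hab)

theorem exists_residue : ∃ π : EA k m r F →ₐ[k] k, ∀ i, π (xE r F i) = 0 := by
  let ε := AlgEquiv.ofBijective (aeval (R := k) (xE r F))
    ⟨aeval_xE_injective, aeval_xE_surjective⟩
  refine ⟨(aeval fun _ => (0 : k)).comp (ε.symm : EA k m r F →ₐ[k] MvPolynomial (Fin m) k),
    fun i => ?_⟩
  have h : ε (X i) = xE r F i := aeval_X _ _
  rw [← h]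
  change aeval _ (ε.symm (ε (X i))) = _
  rw [AlgEquiv.symm_apply_apply, aeval_X]

theorem Hyp.dvd_evP_fOf (H : Hyp r F g) (i : Fin m) : xA k m r F i ∣ evP r F (fOf k m F) := by
  have h : xA k m r F i ∣ ∏ j, xA k m r F j := Finset.dvd_prod_of_mem _ (Finset.mem_univ i)
  have h' : xA k m r F i ∣ ∏ j, xA k m r F j ^ r j :=
    (dvd_pow_self _ (zero_lt_one.trans (H.hr i)).ne').trans
      (Finset.dvd_prod_of_mem (fun j => xA k m r F j ^ r j) (Finset.mem_univ i))
  have h1 := relation (r := r) (F := F)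
  rw [H.evB_F] at h1
  exact (dvd_add_left (h.mul_right _)).1 (h1 ▸ h'.mul_right _)

theorem Hyp.fibre_eq_zero_iff (H : Hyp r F g) {κ D : Type} [Field κ] [CommRing D] [Algebra κ D]
    (q : EA k m r F →+* κ) (h0 : ∀ i, q (xE r F i) = 0) {s : RingA k m r F →+* D}
    (hs : ∀ x : EA k m r F, s x = algebraMap κ D (q x))
    (hu : ∀ {S : Type} [CommRing S] (j : κ →+* S) (τ : RingA k m r F →+* S),
        (∀ x : EA k m r F, τ x = j (q x)) →
        ∃ l : D →+* S, (∀ c, l (algebraMap κ D c) = j c) ∧ ∀ a, l (s a) = τ a)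
    (p : MvPolynomial (Fin 2) κ) :
    aeval (fun j => s (evP r F (X j))) p = 0 ↔
      MvPolynomial.map (q.comp (algebraMap k (EA k m r F))) (fOf k m F) ∣ p := by
  set ι := q.comp (algebraMap k (EA k m r F))
  set φ : MvPolynomial (Fin 2) κ →ₐ[κ] D := aeval fun j => s (evP r F (X j))
  constructor
  · intro hp
    have key : ∀ {S : Type} [CommRing S] (j : MvPolynomial (Fin 2) κ →+* S),
        j (MvPolynomial.map ι (fOf k m F)) = 0 → j p = 0 := by
      intro S _ j hj
      have hj' : j.comp (MvPolynomial.map ι) = eval₂Hom ((j.comp C).comp ι) fun i => j (X i) :=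
        ringHom_ext (fun c => by simp) fun i => by simp
      obtain ⟨τ, hτk, hτx, hτP⟩ := H.exists_ringHom ((j.comp C).comp ι) (fun i => j (X i))
        ((DFunLike.congr_fun hj' _).symm.trans hj)
      obtain ⟨l, hlc, hls⟩ := hu (j.comp C) τ (by
        intro e
        obtain ⟨s, rfl⟩ := aeval_xE_surjective e
        have h1 : (τ.comp (EA k m r F).val.toRingHom).comp
              (aeval (R := k) (xE r F) : MvPolynomial (Fin m) k →ₐ[k] EA k m r F).toRingHom =
            ((j.comp C).comp q).comp
              (aeval (R := k) (xE r F) : MvPolynomial (Fin m) k →ₐ[k] EA k m r F).toRingHom := by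
          refine ringHom_ext (fun c => ?_) fun i => ?_
          · have h2 : (aeval (R := k) (xE r F)) (C c) = algebraMap k (EA k m r F) c :=
              (aeval (R := k) (xE r F)).commutes c
            change τ (aeval (xE r F) (C c) : EA k m r F) = j (C (q (aeval (xE r F) (C c))))
            rw [h2]
            exact hτk c
          · change τ (aeval (xE r F) (X i) : EA k m r F) = j (C (q (aeval (xE r F) (X i))))
            rw [aeval_X, h0, map_zero, map_zero]
            exact hτx i
        exact DFunLike.congr_fun h1 s)
      have h3 : l.comp φ.toRingHom = j := by
        refine ringHom_ext (fun c => ?_) fun i => ?_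
        · change l (φ (C c)) = _
          rw [algHom_C, hlc]
          rfl
        · change l (φ (X i)) = _
          rw [aeval_X, hls, hτP, eval₂_X]
      rw [← h3]
      exact (congrArg l hp).trans (map_zero l)
    rw [← Ideal.mem_span_singleton, ← Ideal.Quotient.eq_zero_iff_mem]
    exact key _ (Ideal.Quotient.eq_zero_iff_mem.2 (Ideal.mem_span_singleton_self _))
  · have h1 : ∀ u : MvPolynomial (Fin 2) k, φ (MvPolynomial.map ι u) = s (evP r F u) := by
      intro u
      have h2 : φ.toRingHom.comp (MvPolynomial.map ι) = s.comp (evP r F).toRingHom := by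
        refine ringHom_ext (fun c => ?_) fun i => ?_
        · change φ (MvPolynomial.map ι (C c)) = s (evP r F (C c))
          rw [map_C, algHom_C, algHom_C]
          exact (hs _).symm
        · change φ (MvPolynomial.map ι (X i)) = s (evP r F (X i))
          rw [map_X, aeval_X]
      exact DFunLike.congr_fun h2 u
    rintro ⟨u, rfl⟩
    obtain ⟨b, hb⟩ := H.dvd_evP_fOf ⟨0, H.hm⟩
    have h3 : s (xA k m r F ⟨0, H.hm⟩) = algebraMap κ D (q (xE r F ⟨0, H.hm⟩)) :=
      hs (xE r F ⟨0, H.hm⟩)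
    rw [map_mul, h1, hb, map_mul, h3, h0, map_zero, zero_mul, zero_mul]

theorem Hyp.isCoord_of_isAnFibration [IsDomain (RingA k m r F)] (H : Hyp r F g)
    (hml : MakarLimanov k (RingA k m r F) = ⊥)
    (h : IsAnFibration (EA k m r F) (RingA k m r F) 2) : IsCoord (fOf k m F) := by
  obtain ⟨p, hp⟩ : ∃ p : PrimeSpectrum (EA k m r F), ∀ i, xE r F i ∈ p.asIdeal := by
    obtain ⟨π, hπ⟩ := exists_residue (r := r) (F := F)
    exact ⟨⟨RingHom.ker π, RingHom.ker_isPrime _⟩, hπ⟩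
  obtain ⟨e⟩ := h.2.2 p
  obtain ⟨s, hs, hu⟩ := exists_universal_hom e
  have h0 : ∀ i, algebraMap (EA k m r F)
      (IsLocalRing.ResidueField (Localization.AtPrime p.asIdeal)) (xE r F i) = 0 := by
    exact fun i => algebraMap_residueField_eq_zero p (hp i)
  exact H.isCoord_of_hom hml _ (MvPolynomial.eq_algebraMap_of_isUnit (σ := Fin 2)) _
    (H.fibre_eq_zero_iff _ h0 hs hu)

end
end RingA

/-!
STATEMENT 9.  Suppose `F = f(Z,T) + X_1⋯X_m·g(X_1,…,X_m,Z,T)`.  Then the following are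
equivalent:
(iv) `A ≅ k^{[m+2]}`;
(ix) `f(Z,T)` is a line in `k[Z,T]`, and `ML(A) = k`;
(x) `A^{[l]} ≅ k^{[l+m+2]}` for some `l ≥ 0`, and `ML(A) = k`;
(xi) `A` is an `𝔸²`-fibration over `E`, and `ML(A) = k`.
-/

theorem statement9 (k : Type) [Field k] (m : ℕ) (hm : 1 ≤ m)
    (r : Fin m → ℕ) (hr : ∀ i, 1 < r i)
    (F : MvPolynomial (Fin m ⊕ Fin 2) k) (hf : fOf k m F ≠ 0)
    [IsDomain (RingA k m r F)]
    (g : MvPolynomial (Fin m ⊕ Fin 2) k)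
    (hFg : F = rename Sum.inr (fOf k m F) + (∏ i, X (Sum.inl i)) * g) :
    List.TFAE
      [ Nonempty (RingA k m r F ≃ₐ[k] MvPolynomial (Fin (m + 2)) k),
        Nonempty ((MvPolynomial (Fin 2) k ⧸ Ideal.span {fOf k m F}) ≃ₐ[k] Polynomial k)
          ∧ MakarLimanov k (RingA k m r F) = ⊥,
        (∃ l : ℕ, Nonempty (MvPolynomial (Fin l) (RingA k m r F)
            ≃ₐ[k] MvPolynomial (Fin (l + m + 2)) k))
          ∧ MakarLimanov k (RingA k m r F) = ⊥,
        IsAnFibration ↥(EA k m r F) (RingA k m r F) 2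
          ∧ MakarLimanov k (RingA k m r F) = ⊥ ] := by
  have H : RingA.Hyp r F g := ⟨hm, hr, hf, hFg⟩
  have hx : ∀ i, xA k m r F i ≠ 0 :=
    H.xA_ne_zero (RingA.weight_lexWeight (Equiv.refl _))
  have key : IsCoord (fOf k m F) →
      Nonempty (RingA k m r F ≃ₐ[k] MvPolynomial (Fin (m + 2)) k) := fun h => by
    obtain ⟨e, -⟩ := H.exists_equiv hx h
    exact ⟨e.trans (renameEquiv k (Fintype.equivOfCardEq (by simp [add_comm])))⟩
  have h13 : Nonempty (RingA k m r F ≃ₐ[k] MvPolynomial (Fin (m + 2)) k) →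
      (∃ l : ℕ, Nonempty (MvPolynomial (Fin l) (RingA k m r F)
        ≃ₐ[k] MvPolynomial (Fin (l + m + 2)) k)) ∧ MakarLimanov k (RingA k m r F) = ⊥ := by
    rintro ⟨e⟩
    refine ⟨⟨0, ⟨(MvPolynomial.mapAlgEquiv (Fin 0) e).trans
      (((isEmptyAlgEquiv (MvPolynomial (Fin (m + 2)) k) (Fin 0)).restrictScalars k).trans
        (renameEquiv k (finCongr (by omega))))⟩⟩, makarLimanov_eq_bot_of_equiv e⟩
  have coord : Nonempty (RingA k m r F ≃ₐ[k] MvPolynomial (Fin (m + 2)) k) →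
      IsCoord (fOf k m F) := fun h => by
    obtain ⟨⟨l, ⟨e⟩⟩, hml⟩ := h13 h
    exact H.isCoord_of_stable hml e
  have ml : Nonempty (RingA k m r F ≃ₐ[k] MvPolynomial (Fin (m + 2)) k) →
      MakarLimanov k (RingA k m r F) = ⊥ := fun h => (h13 h).2
  tfae_have 1 → 3 := h13
  tfae_have 1 → 2 := fun h => ⟨RingA.Curve.nonempty_equiv (coord h), ml h⟩
  tfae_have 1 → 4 := fun h => ⟨H.isAnFibration hx (coord h), ml h⟩
  tfae_have 2 → 1 := fun ⟨⟨e⟩, hml⟩ => key (H.isCoord_of_line hml e)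
  tfae_have 3 → 1 := fun ⟨⟨_, ⟨e⟩⟩, hml⟩ => key (H.isCoord_of_stable hml e)
  tfae_have 4 → 1 := fun ⟨h, hml⟩ => key (H.isCoord_of_isAnFibration hml h)
  tfae_finish
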